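/- The coefficients PA_n admit a complete asymptotic expansion: there exist families of complex numbers c_{j,ℓ,k} (for integers j ≥ 0, 0 ≤ ℓ ≤ j, k ∈ ℤ) with ∑_{k∈ℤ} |c_{j,ℓ,k}| < ∞ for each (j,ℓ), defining the absolutely convergent Fourier series Ξ_{j,ℓ}(u) = ∑_{k∈ℤ} c_{j,ℓ,k} e^{2πiku} of period 1, such that for every integer J ≥ 1, as n → ∞, PA_n = 2ⁿ + 2ⁿ · n^g · ∑_{j=0}^{J-1} n^{-j} ∑_{ℓ=0}^{j} (log n)^ℓ · Ξ_{j,ℓ}(log₂ n) + O( 2ⁿ · n^{g-J} · (log n)^J ), where g = log₂ 3; in particular Ξ_{0,0}(u) = κ₀ + κ(u) has constant term κ₀ ≐ 0.1083842947. -/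

import Mathlib

open Complex Filter Asymptotics Topology

noncomputable section

/-- finite q-Pochhammer symbol `(x;q)_n` -/
def qPF (x q : ℂ) (n : ℕ) : ℂ := ∏ i ∈ Finset.range n, (1 - x * q ^ i)

/-- infinite q-Pochhammer symbol `(x;q)_∞` -/
def qPI (x q : ℂ) : ℂ := ∏' i : ℕ, (1 - x * q ^ i)

def uF (q : ℂ) : ℂ := q / (1 - q)
def vF (q : ℂ) : ℂ := (1 - q + q ^ 2) / (1 - q)
def aF (q : ℂ) : ℂ := q ^ 2 / (1 - q + q ^ 2)
def AF (q : ℂ) : ℂ := 2 * q * (1 - q) ^ 2 / (1 - 2 * q) ^ 2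
def CF (q : ℂ) : ℂ := 2 * q * (3 - 10 * q + 9 * q ^ 2 - q ^ 3) / ((1 - q) * (1 - 2 * q) ^ 2)
def DF (q : ℂ) : ℂ := CF q - (q ^ 2 / (1 - q) ^ 2) * AF q * qPI (vF q) q / qPI (aF q * vF q) q

/-- the `m`-th term (for `m ≥ 1`) of the explicit series for `PA(q)` -/
def PAterm (q : ℂ) (m : ℕ) : ℂ :=
  (-1) ^ m * q ^ (2 * m) / ((1 - 2 * q) ^ m * (1 - q - q ^ (m + 1))) *
    ∏ k ∈ Finset.Icc 1 (m - 1),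
      ((1 - q - q ^ k + q ^ (k + 1) - q ^ (k + 2)) / (1 - q - q ^ (k + 1)))

/-- the explicit convergent series defining `PA(q)` for small `q` -/
def PAseries (q : ℂ) : ℂ :=
  (-2 * q ^ 3 * (1 - q) ^ 2 / (1 - 2 * q) ^ 2) * (∑' m : ℕ, PAterm q (m + 1))
    + 2 * q * (3 - 10 * q + 9 * q ^ 2 - q ^ 3) / ((1 - 2 * q) ^ 2 * (1 - q))

/-- the critical exponent `g = log₂ 3` -/
def gExp : ℝ := Real.logb 2 3

/-- the principal constant `κ₀` -/
def kappa0 : ℝ :=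
  Real.pi / (9 * Real.log 2 * Real.sin (Real.pi * gExp) * Real.Gamma (gExp + 1)) *
    ∏' j : ℕ, ((1 - (1 / 3) * (2 : ℝ) ^ (-(j : ℤ))) * (1 - (3 / 2) * (2 : ℝ) ^ (-(j : ℤ))) /
      (1 - (1 / 2) * (2 : ℝ) ^ (-(j : ℤ))) ^ 2)

/-- the Fourier coefficients `κ_k` -/
def kappaCoef (k : ℤ) : ℂ :=
  (kappa0 : ℂ) *
    ((Real.sin (Real.pi * gExp) : ℂ) /
      Complex.sin ((Real.pi : ℂ) * (gExp : ℂ) +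
        2 * Complex.I * (k : ℂ) * (Real.pi : ℂ) ^ 2 / (Real.log 2 : ℂ))) *
    (Complex.Gamma (1 + (gExp : ℂ)) /
      Complex.Gamma (1 + (gExp : ℂ) + 2 * Complex.I * (k : ℂ) * (Real.pi : ℂ) / (Real.log 2 : ℂ)))



/-! ### Part 1: q-Pochhammer symbols and the q-binomial theorem -/

lemma qP_summable (x q : ℂ) (hq : ‖q‖ < 1) : Summable (fun i : ℕ => ‖-(x * q ^ i)‖) := by
  simp only [norm_neg, norm_mul, norm_pow]
  exact (summable_geometric_of_lt_one (norm_nonneg _) hq).mul_left _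

lemma qPI_multipliable (x q : ℂ) (hq : ‖q‖ < 1) : Multipliable (fun i : ℕ => 1 - x * q ^ i) := by
  simp_rw [sub_eq_add_neg]
  exact multipliable_one_add_of_summable (qP_summable x q hq)

lemma qPF_succ (x q : ℂ) (n : ℕ) : qPF x q (n + 1) = qPF x q n * (1 - x * q ^ n) := by
  simp [qPF, Finset.prod_range_succ]

lemma qPF_zero (x q : ℂ) : qPF x q 0 = 1 := by simp [qPF]

lemma qPI_split (x q : ℂ) (hq : ‖q‖ < 1) (n : ℕ) :
    qPI x q = qPF x q n * qPI (x * q ^ n) q := by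
  have h : Multipliable (fun i : ℕ => 1 - x * q ^ (i + n)) := by
    have := qPI_multipliable (x * q ^ n) q hq
    refine this.congr (fun i => ?_)
    ring
  have := h.prod_mul_tprod_nat_mul' (f := fun i : ℕ => 1 - x * q ^ i)
  simp only [qPI, qPF]
  rw [← this]
  congr 1
  refine tprod_congr (fun i => ?_)
  ring

lemma qPI_ne_zero (x q : ℂ) (hq : ‖q‖ < 1) (h : ∀ i : ℕ, 1 - x * q ^ i ≠ 0) : qPI x q ≠ 0 := by
  unfold qPI
  simp_rw [sub_eq_add_neg] at h ⊢
  exact tprod_one_add_ne_zero_of_summable h (qP_summable x q hq)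

lemma qPF_ne_zero (x q : ℂ) (h : ∀ i : ℕ, 1 - x * q ^ i ≠ 0) (n : ℕ) : qPF x q n ≠ 0 := by
  unfold qPF
  exact Finset.prod_ne_zero_iff.mpr (fun i _ => h i)

lemma qPI_differentiableOn {U : Set ℂ} (hU : IsOpen U) {X Q : ℂ → ℂ} {C ρ : ℝ}
    (hX : DifferentiableOn ℂ X U) (hQ : DifferentiableOn ℂ Q U)
    (hC : ∀ z ∈ U, ‖X z‖ ≤ C) (hρ : ∀ z ∈ U, ‖Q z‖ ≤ ρ) (hρ1 : ρ < 1) :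
    DifferentiableOn ℂ (fun z => qPI (X z) (Q z)) U := by
  rcases U.eq_empty_or_nonempty with hN | ⟨z0, hz0⟩
  · rw [hN]; exact differentiableOn_empty
  have hρ0 : 0 ≤ ρ := (norm_nonneg _).trans (hρ z0 hz0)
  have hC0 : 0 ≤ C := (norm_nonneg _).trans (hC z0 hz0)
  have h1 : Summable (fun n : ℕ => C * ρ ^ n) := (summable_geometric_of_lt_one hρ0 hρ1).mul_left _
  have h2 := h1.hasProdLocallyUniformlyOn_nat_one_add (K := U)
    (f := fun n z => -(X z * Q z ^ n)) hU
    (.of_forall fun n z hz => by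
      rw [norm_neg, norm_mul, norm_pow]
      gcongr
      · exact hC z hz
      · exact hρ z hz)
    (fun n => ((hX.mul (hQ.pow n)).neg).continuousOn)
  have h3 := h2.differentiableOn
    (.of_forall fun s => by
      simpa [Finset.prod_fn] using
        DifferentiableOn.fun_finsetProd (u := s) (f := fun n z => 1 + -(X z * Q z ^ n))
          (fun n _ => ((hX.mul (hQ.pow n)).neg).const_add 1)) hU
  simpa [qPI, sub_eq_add_neg] using h3

lemma qPI_zero (q : ℂ) : qPI 0 q = 1 := by simp [qPI]

/-- the coefficients of the q-binomial series -/
def tG (a q : ℂ) (n : ℕ) : ℂ := qPF a q n / qPF q q n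

lemma one_sub_qpow_ne (q : ℂ) (hq : ‖q‖ < 1) (i : ℕ) : 1 - q * q ^ i ≠ 0 := by
  intro h
  have h1 : q ^ (i + 1) = 1 := by rw [pow_succ']; exact (sub_eq_zero.mp h).symm
  have h2 : ‖q‖ ^ (i + 1) = 1 := by rw [← norm_pow, h1, norm_one]
  have h3 : ‖q‖ ^ (i + 1) < 1 := pow_lt_one₀ (norm_nonneg _) hq (by omega)
  linarith

lemma tG_succ (a q : ℂ) (hq : ‖q‖ < 1) (n : ℕ) :
    tG a q (n + 1) * (1 - q ^ (n + 1)) = tG a q n * (1 - a * q ^ n) := by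
  have h := one_sub_qpow_ne q hq
  have h1 := qPF_ne_zero q q h n
  have h2 := h n
  unfold tG
  rw [qPF_succ, qPF_succ, pow_succ', div_mul_eq_mul_div, div_mul_eq_mul_div,
    div_eq_div_iff (mul_ne_zero h1 h2) h1]
  ring

lemma tG_zero (a q : ℂ) : tG a q 0 = 1 := by simp [tG, qPF_zero]

lemma tG_bound (a q : ℂ) {A r : ℝ} (hr : r < 1) (hq : ‖q‖ ≤ r) (ha : ‖a‖ ≤ A) (n : ℕ) :
    ‖tG a q n‖ ≤ Real.exp (A / (1 - r) + r / (1 - r) ^ 2) := by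
  have hr0 : 0 ≤ r := (norm_nonneg _).trans hq
  have hA0 : 0 ≤ A := (norm_nonneg _).trans ha
  have h1r : 0 < 1 - r := by linarith
  have key : ∀ n : ℕ, ‖tG a q n‖ ≤
      Real.exp (∑ i ∈ Finset.range n, (A * r ^ i + r / (1 - r) * r ^ i)) := by
    intro n
    induction n with
    | zero => simp [tG_zero]
    | succ n ih =>
      have h := one_sub_qpow_ne q (hq.trans_lt hr)
      have h1 := qPF_ne_zero q q h n
      have h2 := h n
      have e : tG a q (n + 1) = tG a q n * ((1 - a * q ^ n) / (1 - q * q ^ n)) := by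
        unfold tG
        rw [qPF_succ, qPF_succ]
        field_simp
      rw [e, norm_mul, Finset.sum_range_succ, Real.exp_add]
      have b1 : ‖1 - a * q ^ n‖ ≤ Real.exp (A * r ^ n) := by
        calc ‖1 - a * q ^ n‖ ≤ ‖(1 : ℂ)‖ + ‖a * q ^ n‖ := norm_sub_le _ _
          _ ≤ 1 + A * r ^ n := by
            rw [norm_one, norm_mul, norm_pow]; gcongr
          _ ≤ _ := by linarith [Real.add_one_le_exp (A * r ^ n)]
      have hy : r * r ^ n ≤ r := by
        have : r ^ n ≤ 1 := pow_le_one₀ hr0 hr.le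
        nlinarith
      have b2 : 1 - r * r ^ n ≤ ‖1 - q * q ^ n‖ := by
        have : ‖(1 : ℂ)‖ - ‖q * q ^ n‖ ≤ ‖1 - q * q ^ n‖ := norm_sub_norm_le _ _
        rw [norm_one, norm_mul, norm_pow] at this
        have : ‖q‖ * ‖q‖ ^ n ≤ r * r ^ n := by gcongr
        linarith
      have hpos : 0 < 1 - r * r ^ n := by linarith
      have b3 : (‖1 - q * q ^ n‖)⁻¹ ≤ Real.exp (r / (1 - r) * r ^ n) := by
        calc (‖1 - q * q ^ n‖)⁻¹ ≤ (1 - r * r ^ n)⁻¹ := by gcongr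
          _ = 1 + r * r ^ n / (1 - r * r ^ n) := by field_simp; ring
          _ ≤ 1 + r * r ^ n / (1 - r) := by gcongr
          _ = r / (1 - r) * r ^ n + 1 := by ring
          _ ≤ _ := Real.add_one_le_exp _
      rw [norm_div, div_eq_mul_inv, Real.exp_add]
      gcongr
  refine (key n).trans (Real.exp_le_exp.mpr ?_)
  rw [Finset.sum_add_distrib, ← Finset.mul_sum, ← Finset.mul_sum]
  have hs : ∑ i ∈ Finset.range n, r ^ i ≤ 1 / (1 - r) := by
    have := Summable.sum_le_tsum (Finset.range n) (fun i _ => pow_nonneg hr0 i)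
      (summable_geometric_of_lt_one hr0 hr)
    rwa [tsum_geometric_of_lt_one hr0 hr, ← one_div] at this
  calc _ ≤ A * (1 / (1 - r)) + r / (1 - r) * (1 / (1 - r)) := by gcongr
    _ = _ := by field_simp

/-- summability in the q-binomial theorem -/
lemma tG_summable (a q t : ℂ) (hq : ‖q‖ < 1) (ht : ‖t‖ < 1) :
    Summable (fun n : ℕ => tG a q n * t ^ n) := by
  apply Summable.of_norm
  refine Summable.of_nonneg_of_le (fun _ => norm_nonneg _) (fun n => ?_)
    ((summable_geometric_of_lt_one (norm_nonneg t) ht).mul_left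
      (Real.exp (‖a‖ / (1 - ‖q‖) + ‖q‖ / (1 - ‖q‖) ^ 2)))
  rw [norm_mul, norm_pow]
  gcongr
  exact tG_bound a q hq le_rfl le_rfl n

/-- finite form of the functional equation -/
lemma fM_func (a q w : ℂ) (hq : ‖q‖ < 1) (M : ℕ) :
    (1 - w) * ∑ n ∈ Finset.range M, tG a q n * w ^ n =
      (1 - a * w) * ∑ n ∈ Finset.range M, tG a q n * (q * w) ^ n
        - w ^ M * tG a q M * (1 - q ^ M) := by
  induction M with
  | zero => simp
  | succ M ih =>
    rw [Finset.sum_range_succ, Finset.sum_range_succ, mul_add, mul_add, ih]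
    have h := tG_succ a q hq M
    rw [mul_assoc (w ^ (M + 1)), h, mul_pow]
    ring

lemma qbinom_func (a q t : ℂ) (hq : ‖q‖ < 1) (ht : ‖t‖ < 1) :
    (1 - t) * ∑' n : ℕ, tG a q n * t ^ n = (1 - a * t) * ∑' n : ℕ, tG a q n * (q * t) ^ n := by
  have hqt : ‖q * t‖ < 1 := by
    rw [norm_mul]
    nlinarith [norm_nonneg q, norm_nonneg t]
  have h1 := (tG_summable a q t hq ht).hasSum.tendsto_sum_nat.const_mul (1 - t)
  have h2 := (tG_summable a q (q * t) hq hqt).hasSum.tendsto_sum_nat.const_mul (1 - a * t)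
  have h3 : Tendsto (fun M : ℕ => t ^ M * tG a q M * (1 - q ^ M)) atTop (𝓝 0) := by
    have e1 := (tG_summable a q t hq ht).tendsto_atTop_zero
    have e2 : Tendsto (fun M : ℕ => 1 - q ^ M) atTop (𝓝 (1 - 0)) :=
      (tendsto_pow_atTop_nhds_zero_of_norm_lt_one hq).const_sub 1
    have := e1.mul e2
    simp only [zero_mul] at this
    exact this.congr (fun n => by ring)
  have h4 := h2.sub h3
  simp only [sub_zero] at h4
  refine tendsto_nhds_unique h1 (h4.congr (fun M => ?_))
  rw [fM_func a q t hq M]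

lemma one_sub_tq_ne (q t : ℂ) (hq : ‖q‖ < 1) (ht : ‖t‖ < 1) (i : ℕ) : 1 - t * q ^ i ≠ 0 := by
  intro h
  have h2 : ‖t‖ * ‖q‖ ^ i = 1 := by
    rw [← norm_pow, ← norm_mul, ← (sub_eq_zero.mp h), norm_one]
  have h3 : ‖q‖ ^ i ≤ 1 := pow_le_one₀ (norm_nonneg _) hq.le
  nlinarith [norm_nonneg t]

/-- the q-binomial theorem -/
theorem qbinom (a q t : ℂ) (hq : ‖q‖ < 1) (ht : ‖t‖ < 1) :
    ∑' n : ℕ, tG a q n * t ^ n = qPI (a * t) q / qPI t q := by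
  set f : ℂ → ℂ := fun t => ∑' n : ℕ, tG a q n * t ^ n with hf
  have hne := one_sub_tq_ne q t hq ht
  have htk : ∀ k : ℕ, ‖t * q ^ k‖ < 1 := by
    intro k
    rw [norm_mul, norm_pow]
    have h3 : ‖q‖ ^ k ≤ 1 := pow_le_one₀ (norm_nonneg _) hq.le
    nlinarith [norm_nonneg t]
  have step : ∀ k : ℕ, qPF t q k * f t = qPF (a * t) q k * f (t * q ^ k) := by
    intro k
    induction k with
    | zero => simp [qPF_zero]
    | succ k ih =>
      have := qbinom_func a q (t * q ^ k) hq (htk k)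
      rw [show q * (t * q ^ k) = t * q ^ (k + 1) by ring] at this
      change (1 - t * q ^ k) * f (t * q ^ k) = (1 - a * (t * q ^ k)) * f (t * q ^ (k + 1)) at this
      rw [qPF_succ, qPF_succ]
      calc qPF t q k * (1 - t * q ^ k) * f t = (1 - t * q ^ k) * (qPF t q k * f t) := by ring
        _ = qPF (a * t) q k * ((1 - t * q ^ k) * f (t * q ^ k)) := by rw [ih]; ring
        _ = _ := by rw [this]; ring
  have hcont : ContinuousAt f 0 := by
    have h1 : ContinuousOn f (Metric.ball 0 (1 / 2)) := by
      refine continuousOn_tsum (u := fun n : ℕ =>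
        Real.exp (‖a‖ / (1 - ‖q‖) + ‖q‖ / (1 - ‖q‖) ^ 2) * (1 / 2) ^ n) (fun n => by fun_prop)
        ((summable_geometric_of_lt_one (by norm_num) (by norm_num)).mul_left _) ?_
      intro n x hx
      rw [norm_mul, norm_pow]
      have : ‖x‖ ≤ 1 / 2 := by simpa using (mem_ball_zero_iff.mp hx).le
      gcongr
      exact tG_bound a q hq le_rfl le_rfl n
    exact h1.continuousAt (Metric.ball_mem_nhds _ (by norm_num))
  have hf0 : f 0 = 1 := by
    simp only [hf]
    rw [tsum_eq_single 0]
    · simp [tG_zero]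
    · intro n hn; simp [hn]
  have l1 : Tendsto (fun k : ℕ => qPF t q k * f t) atTop (𝓝 (qPI t q * f t)) :=
    ((qPI_multipliable t q hq).hasProd.tendsto_prod_nat).mul_const _
  have l2 : Tendsto (fun k : ℕ => qPF (a * t) q k * f (t * q ^ k)) atTop
      (𝓝 (qPI (a * t) q * 1)) := by
    refine ((qPI_multipliable (a * t) q hq).hasProd.tendsto_prod_nat).mul ?_
    rw [← hf0]
    refine hcont.tendsto.comp ?_
    simpa using (tendsto_pow_atTop_nhds_zero_of_norm_lt_one hq).const_mul t
  have l3 := tendsto_nhds_unique l1 (l2.congr (fun k => (step k).symm))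
  rw [eq_div_iff (qPI_ne_zero t q hq hne), mul_comm]
  simpa using l3


/-! ### Part 2: the transformed series -/

def tF (q : ℂ) (n : ℕ) : ℂ := tG (aF q) q n
def BB (q : ℂ) : ℂ := 2 * q ^ 5 * (1 - q) * qPI (vF q * q) q / qPI (uF q * q) q
def hF (n : ℕ) (q : ℂ) : ℂ := BB q * tF q n * (vF q * q) ^ n
def Dn (n : ℕ) (q : ℂ) : ℂ := 1 - 2 * q + q ^ (n + 2)
def pF (n : ℕ) (q : ℂ) : ℂ := hF n q / Dn n q
def Ct (q : ℂ) : ℂ := 2 * q * (3 - 10 * q + 9 * q ^ 2 - q ^ 3) / (1 - q)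

/-- the working radius -/
def R0 : ℝ := 14 / 25

lemma one_sub_ge {q : ℂ} (hq : ‖q‖ < R0) : 11 / 25 ≤ ‖1 - q‖ := by
  have : ‖(1 : ℂ)‖ - ‖q‖ ≤ ‖1 - q‖ := norm_sub_norm_le _ _
  rw [norm_one] at this
  unfold R0 at hq
  linarith

lemma one_sub_ne {q : ℂ} (hq : ‖q‖ < R0) : 1 - q ≠ 0 := by
  have := one_sub_ge hq
  rw [← norm_pos_iff]; linarith

lemma quad_ge {q : ℂ} (hq : ‖q‖ < R0) : 79 / 625 ≤ ‖1 - q + q ^ 2‖ := by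
  have h1 : ‖(1 : ℂ) - q‖ - ‖-(q ^ 2)‖ ≤ ‖1 - q - -(q ^ 2)‖ := norm_sub_norm_le _ _
  rw [norm_neg, norm_pow, sub_neg_eq_add] at h1
  have := one_sub_ge hq
  unfold R0 at hq
  nlinarith [norm_nonneg q]

lemma quad_ne {q : ℂ} (hq : ‖q‖ < R0) : 1 - q + q ^ 2 ≠ 0 := by
  have := quad_ge hq
  rw [← norm_pos_iff]; linarith

lemma aF_le {q : ℂ} (hq : ‖q‖ < R0) : ‖aF q‖ ≤ 3 := by
  unfold aF
  have h := quad_ge hq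
  rw [norm_div, norm_pow, div_le_iff₀ (by linarith)]
  unfold R0 at hq
  nlinarith [norm_nonneg q]

lemma uq_le {q : ℂ} (hq : ‖q‖ < R0) : ‖uF q * q‖ ≤ 3 / 4 := by
  unfold uF
  have h := one_sub_ge hq
  rw [norm_mul, norm_div, div_mul_eq_mul_div, div_le_iff₀ (by linarith)]
  unfold R0 at hq
  nlinarith [norm_nonneg q]

lemma vq_le {q : ℂ} (hq : ‖q‖ < R0) : ‖vF q * q‖ ≤ 24 / 25 := by
  have h0 := one_sub_ne hq
  have e : vF q * q = q + q ^ 3 / (1 - q) := by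
    unfold vF; field_simp
  have h := one_sub_ge hq
  rw [e]
  have h1 : ‖q ^ 3 / (1 - q)‖ ≤ 2 / 5 := by
    rw [norm_div, norm_pow, div_le_iff₀ (by linarith)]
    unfold R0 at hq
    have : ‖q‖ ^ 3 ≤ (14 / 25) ^ 3 := by gcongr
    nlinarith
  have := norm_add_le q (q ^ 3 / (1 - q))
  unfold R0 at hq
  linarith

lemma av_eq {q : ℂ} (hq : ‖q‖ < R0) : aF q * vF q = uF q * q := by
  have h0 := one_sub_ne hq
  have h1 := quad_ne hq
  unfold aF vF uF
  field_simp

lemma R0_lt : R0 < 1 := by unfold R0; norm_num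

lemma tF_bound : ∃ C : ℝ, 0 < C ∧ ∀ q : ℂ, ‖q‖ < R0 → ∀ n, ‖tF q n‖ ≤ C :=
  ⟨_, Real.exp_pos _, fun q hq n => tG_bound (aF q) q R0_lt hq.le (aF_le hq) n⟩

lemma PA_prod (q : ℂ) (hq : ‖q‖ < R0) (m : ℕ) :
    ∏ k ∈ Finset.Icc 1 m, ((1 - q - q ^ k + q ^ (k + 1) - q ^ (k + 2)) / (1 - q - q ^ (k + 1)))
      = qPF (vF q * q) q m / qPF (uF q * q) q m := by
  have h0 := one_sub_ne hq
  induction m with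
  | zero => simp [qPF_zero]
  | succ m ih =>
    rw [Finset.prod_Icc_succ_top (by omega), ih, qPF_succ, qPF_succ, mul_div_mul_comm]
    congr 1
    have e1 : 1 - q - q ^ (m + 1) + q ^ (m + 1 + 1) - q ^ (m + 1 + 2)
        = (1 - q) * (1 - vF q * q * q ^ m) := by
      unfold vF; field_simp; ring
    have e2 : 1 - q - q ^ (m + 1 + 1) = (1 - q) * (1 - uF q * q * q ^ m) := by
      unfold uF; field_simp; ring
    rw [e1, e2, mul_div_mul_left _ _ h0]

lemma PAterm_eq (q : ℂ) (hq : ‖q‖ < R0) (m : ℕ) :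
    PAterm q (m + 1) = (-q ^ 2 / (1 - 2 * q)) ^ (m + 1) / (1 - q) *
      (qPF (vF q * q) q m / qPF (uF q * q) q (m + 1)) := by
  have h0 := one_sub_ne hq
  unfold PAterm
  rw [show m + 1 - 1 = m from rfl, PA_prod q hq m, qPF_succ]
  have e2 : 1 - q - q ^ (m + 1 + 1) = (1 - q) * (1 - uF q * q * q ^ m) := by
    unfold uF; field_simp; ring
  rw [e2, neg_div, neg_pow (q ^ 2 / (1 - 2 * q)) (m + 1), div_pow, pow_mul]
  simp only [div_eq_mul_inv, mul_inv]
  ring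

lemma uq_ne {q : ℂ} (hq : ‖q‖ < R0) (i : ℕ) : 1 - uF q * q * q ^ i ≠ 0 :=
  one_sub_tq_ne q _ (hq.trans R0_lt) ((uq_le hq).trans_lt (by norm_num)) i

lemma vq_ne {q : ℂ} (hq : ‖q‖ < R0) (i : ℕ) : 1 - vF q * q * q ^ i ≠ 0 :=
  one_sub_tq_ne q _ (hq.trans R0_lt) ((vq_le hq).trans_lt (by norm_num)) i

lemma PA_ratio (q : ℂ) (hq : ‖q‖ < R0) (m : ℕ) :
    qPF (vF q * q) q m / qPF (uF q * q) q (m + 1) =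
      qPI (vF q * q) q / qPI (uF q * q) q * ∑' n : ℕ, tF q n * (vF q * q * q ^ m) ^ n := by
  have hq1 := hq.trans R0_lt
  have hb : ‖vF q * q * q ^ m‖ < 1 := by
    rw [norm_mul, norm_pow]
    have h3 : ‖q‖ ^ m ≤ 1 := pow_le_one₀ (norm_nonneg _) hq1.le
    have := vq_le hq
    nlinarith [norm_nonneg (vF q * q)]
  have h := qbinom (aF q) q (vF q * q * q ^ m) hq1 hb
  unfold tF
  rw [h, qPI_split (vF q * q) q hq1 m, qPI_split (uF q * q) q hq1 (m + 1)]
  have e : aF q * (vF q * q * q ^ m) = uF q * q * q ^ (m + 1) := by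
    rw [show aF q * (vF q * q * q ^ m) = aF q * vF q * q ^ (m + 1) by ring, av_eq hq]
  rw [e]
  have n1 : qPI (vF q * q * q ^ m) q ≠ 0 :=
    qPI_ne_zero _ _ hq1 (one_sub_tq_ne q _ hq1 hb)
  have n2 : qPI (uF q * q * q ^ (m + 1)) q ≠ 0 := by
    refine qPI_ne_zero _ _ hq1 (fun i => ?_)
    have := uq_ne hq (m + 1 + i)
    rwa [pow_add, ← mul_assoc] at this
  have n3 : qPF (uF q * q) q (m + 1) ≠ 0 := qPF_ne_zero _ _ (uq_ne hq) _
  generalize qPI (vF q * q * q ^ m) q = A1 at *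
  generalize qPI (uF q * q * q ^ (m + 1)) q = A2 at *
  generalize qPF (uF q * q) q (m + 1) = A3 at *
  generalize qPF (vF q * q) q m = A4 at *
  field_simp

theorem PAseries_eq (q : ℂ) (hq : ‖q‖ < 1 / 4) :
    PAseries q = (Ct q + ∑' n : ℕ, pF n q) / (1 - 2 * q) ^ 2 := by
  have hqR : ‖q‖ < R0 := hq.trans (by unfold R0; norm_num)
  have hq1 := hqR.trans R0_lt
  have h0 := one_sub_ne hqR
  have hd : 1 / 2 ≤ ‖1 - 2 * q‖ := by
    have : ‖(1 : ℂ)‖ - ‖2 * q‖ ≤ ‖1 - 2 * q‖ := norm_sub_norm_le _ _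
    rw [norm_one, norm_mul] at this
    norm_num at this
    linarith
  have hd0 : 1 - 2 * q ≠ 0 := by rw [← norm_pos_iff]; linarith
  set z : ℂ := -q ^ 2 / (1 - 2 * q) with hz
  have hz1 : ‖z‖ ≤ 1 / 8 := by
    rw [hz, norm_div, norm_neg, norm_pow, div_le_iff₀ (by linarith)]
    nlinarith [norm_nonneg q]
  set w : ℂ := vF q * q with hw
  have hw1 : ‖w‖ ≤ 24 / 25 := vq_le hqR
  obtain ⟨C, hC0, hC⟩ := tF_bound
  set K : ℂ := qPI w q / qPI (uF q * q) q with hK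
  have hsum2 : Summable (fun p : ℕ × ℕ => z ^ (p.1 + 1) * (tF q p.2 * (w * q ^ p.1) ^ p.2)) := by
    have s1 : Summable (fun p : ℕ × ℕ => (1 / 8 : ℝ) ^ p.1 * (C * (24 / 25 : ℝ) ^ p.2)) := by
      apply Summable.mul_of_nonneg (f := fun n : ℕ => (1 / 8 : ℝ) ^ n)
        (g := fun n : ℕ => C * (24 / 25 : ℝ) ^ n)
      · exact summable_geometric_of_lt_one (by norm_num) (by norm_num)
      · exact (summable_geometric_of_lt_one (by norm_num) (by norm_num)).mul_left _
      · intro n; positivity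
      · intro n; positivity
    refine Summable.of_norm_bounded s1 (fun p => ?_)
    rw [norm_mul, norm_mul, norm_pow, norm_pow, norm_mul, norm_pow]
    have h3 : ‖q‖ ^ p.1 ≤ 1 := pow_le_one₀ (norm_nonneg _) hq1.le
    have h4 : ‖z‖ ^ (p.1 + 1) ≤ (1 / 8) ^ p.1 := by
      rw [pow_succ]
      calc ‖z‖ ^ p.1 * ‖z‖ ≤ (1 / 8) ^ p.1 * 1 := by
            gcongr; linarith
        _ = _ := by ring
    gcongr
    · exact hC q hqR _
    · nlinarith [norm_nonneg w]
  have e1 : ∑' m : ℕ, PAterm q (m + 1) =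
      K / (1 - q) * ∑' m : ℕ, ∑' n : ℕ, z ^ (m + 1) * (tF q n * (w * q ^ m) ^ n) := by
    rw [← tsum_mul_left]
    refine tsum_congr (fun m => ?_)
    rw [PAterm_eq q hqR m, PA_ratio q hqR m, tsum_mul_left]
    ring
  have hD : ∀ n, Dn n q = (1 - 2 * q) * (1 - z * q ^ n) := by
    intro n
    unfold Dn
    rw [hz]
    field_simp
    ring
  have hzq : ∀ n : ℕ, ‖z * q ^ n‖ < 1 := by
    intro n
    rw [norm_mul, norm_pow]
    have h3 : ‖q‖ ^ n ≤ 1 := pow_le_one₀ (norm_nonneg _) hq1.le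
    nlinarith [norm_nonneg z]
  have e2 : ∑' m : ℕ, ∑' n : ℕ, z ^ (m + 1) * (tF q n * (w * q ^ m) ^ n) =
      ∑' n : ℕ, -q ^ 2 * (tF q n * w ^ n / Dn n q) := by
    have h := (hsum2.tsum_comm (f := fun m n => z ^ (m + 1) * (tF q n * (w * q ^ m) ^ n)))
    rw [← h]
    refine tsum_congr (fun n => ?_)
    have e : ∀ m : ℕ, z ^ (m + 1) * (tF q n * (w * q ^ m) ^ n)
        = z * tF q n * w ^ n * (z * q ^ n) ^ m := by
      intro m
      rw [mul_pow w, mul_pow z, ← pow_mul, ← pow_mul, mul_comm m n]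
      ring
    simp_rw [e]
    rw [tsum_mul_left, tsum_geometric_of_norm_lt_one (hzq n), hD n]
    have hne : 1 - z * q ^ n ≠ 0 := by
      intro h
      have := hzq n
      rw [← (sub_eq_zero.mp h), norm_one] at this
      exact lt_irrefl _ this
    have hzz : z * (1 - 2 * q) = -q ^ 2 := by rw [hz]; exact div_mul_cancel₀ _ hd0
    rw [← hzz]
    field_simp
  have e3 : ∑' n : ℕ, pF n q = BB q * ∑' n : ℕ, (tF q n * w ^ n / Dn n q) := by
    rw [← tsum_mul_left]
    refine tsum_congr (fun n => ?_)
    unfold pF hF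
    ring
  unfold PAseries
  rw [e1, e2, e3, tsum_mul_left]
  have hBB : BB q = 2 * q ^ 5 * (1 - q) * K := by
    unfold BB; rw [hK]; ring
  rw [hBB]
  unfold Ct
  field_simp
  ring


/-! ### Part 3: coefficient extraction -/

/-- Taylor coefficient at the origin -/
def cf (f : ℂ → ℂ) (N : ℕ) : ℂ := (N.factorial : ℂ)⁻¹ * iteratedDeriv N f 0

lemma cf_hasSum {f : ℂ → ℂ} {r : ℝ} (hf : DifferentiableOn ℂ f (Metric.ball 0 r)) {q : ℂ}
    (hq : ‖q‖ < r) : HasSum (fun n => cf f n * q ^ n) (f q) := by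
  have h := Complex.hasSum_taylorSeries_on_ball (f := f) (c := 0) (r := r) hf (z := q) (by simpa using hq)
  have e2 : (fun n => cf f n * q ^ n) =
      fun n : ℕ => (n.factorial : ℂ)⁻¹ • (q - 0) ^ n • iteratedDeriv n f 0 := by
    funext n
    simp only [cf, smul_eq_mul, sub_zero]; ring
  rw [e2]; exact h

lemma coeff_unique {c d : ℕ → ℂ} {r : ℝ} (hr : 0 < r)
    (h : ∀ q : ℂ, ‖q‖ < r → ∃ s, HasSum (fun n => c n * q ^ n) s ∧ HasSum (fun n => d n * q ^ n) s) :
    c = d := by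
  set φ : ℂ → ℂ := fun q => ∑' n, c n * q ^ n
  have key : ∀ c : ℕ → ℂ, (∀ q : ℂ, ‖q‖ < r → HasSum (fun n => c n * q ^ n) (φ q)) →
      HasFPowerSeriesAt φ (FormalMultilinearSeries.ofScalars ℂ c) 0 := by
    intro c hc
    rw [hasFPowerSeriesAt_iff]
    filter_upwards [Metric.ball_mem_nhds (0 : ℂ) hr] with z hz
    have := hc z (by simpa using hz)
    simpa [FormalMultilinearSeries.coeff_ofScalars, smul_eq_mul, mul_comm] using this
  have h1 := key c (fun q hq => by
    obtain ⟨s, hs, -⟩ := h q hq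
    simpa [φ, hs.tsum_eq] using hs)
  have h2 := key d (fun q hq => by
    obtain ⟨s, hs, hs'⟩ := h q hq
    simpa [φ, hs.tsum_eq] using hs')
  have := h1.eq_formalMultilinearSeries h2
  funext n
  have h3 := congrArg (fun p => p.coeff n) this
  simpa [FormalMultilinearSeries.coeff_ofScalars] using h3

lemma cf_eq_of_hasSum {f : ℂ → ℂ} {c : ℕ → ℂ} {r : ℝ} (hr : 0 < r)
    (hf : DifferentiableOn ℂ f (Metric.ball 0 r))
    (h : ∀ q : ℂ, ‖q‖ < r → HasSum (fun n => c n * q ^ n) (f q)) (N : ℕ) : cf f N = c N := by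
  have := coeff_unique hr (c := cf f) (d := c) (fun q hq => ⟨f q, cf_hasSum hf hq, h q hq⟩)
  rw [this]

lemma cf_bound {f : ℂ → ℂ} {r ρ M : ℝ} (hρ : 0 < ρ) (hr : ρ < r)
    (hf : DifferentiableOn ℂ f (Metric.ball 0 r)) (hM : ∀ q : ℂ, ‖q‖ < r → ‖f q‖ ≤ M) (N : ℕ) :
    ‖cf f N‖ ≤ M / ρ ^ N := by
  have hd : DiffContOnCl ℂ f (Metric.ball 0 ρ) := by
    apply DifferentiableOn.diffContOnCl
    rw [closure_ball _ hρ.ne']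
    exact hf.mono (Metric.closedBall_subset_ball hr)
  have h := Complex.norm_iteratedDeriv_le_of_forall_mem_sphere_norm_le N hρ hd (C := M)
    (fun z hz => hM z (by
      have : ‖z‖ = ρ := by simpa using hz
      linarith))
  unfold cf
  rw [norm_mul, norm_inv, Complex.norm_natCast]
  have hpos : (0 : ℝ) < N.factorial := by positivity
  rw [inv_mul_le_iff₀ hpos]
  calc _ ≤ _ := h
    _ = _ := by ring

lemma cf_congr {f g : ℂ → ℂ} {r : ℝ} (hr : 0 < r) (h : ∀ q : ℂ, ‖q‖ < r → f q = g q) (N : ℕ) :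
    cf f N = cf g N := by
  unfold cf
  congr 1
  apply Filter.EventuallyEq.iteratedDeriv_eq
  filter_upwards [Metric.ball_mem_nhds (0 : ℂ) hr] with z hz
  exact h z (by simpa using hz)

lemma cf_add {f g : ℂ → ℂ} {r : ℝ} (hr : 0 < r) (hf : DifferentiableOn ℂ f (Metric.ball 0 r))
    (hg : DifferentiableOn ℂ g (Metric.ball 0 r)) (N : ℕ) :
    cf (fun q => f q + g q) N = cf f N + cf g N := by
  refine cf_eq_of_hasSum (c := fun n => cf f n + cf g n) hr (hf.add hg) (fun q hq => ?_) N
  simpa [add_mul] using (cf_hasSum hf hq).add (cf_hasSum hg hq)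

lemma cf_smul {f : ℂ → ℂ} {r : ℝ} (hr : 0 < r) (hf : DifferentiableOn ℂ f (Metric.ball 0 r))
    (k : ℂ) (N : ℕ) :
    cf (fun q => k * f q) N = k * cf f N := by
  refine cf_eq_of_hasSum (c := fun n => k * cf f n) hr (hf.const_mul k) (fun q hq => ?_) N
  simpa [mul_assoc] using (cf_hasSum hf hq).mul_left k

lemma cf_lin3 {f g h : ℂ → ℂ} {r : ℝ} (hr : 0 < r) (hf : DifferentiableOn ℂ f (Metric.ball 0 r))
    (hg : DifferentiableOn ℂ g (Metric.ball 0 r)) (hh : DifferentiableOn ℂ h (Metric.ball 0 r))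
    (a b c : ℂ) (N : ℕ) :
    cf (fun q => a * f q + (b * g q + c * h q)) N = a * cf f N + (b * cf g N + c * cf h N) := by
  rw [cf_add (g := fun q => b * g q + c * h q) hr (hf.const_mul _)
    ((hg.const_mul _).fun_add (hh.const_mul _)),
    cf_add hr (hg.const_mul _) (hh.const_mul _), cf_smul hr hf, cf_smul hr hg, cf_smul hr hh]

lemma delta_ne {q : ℂ} (hq : ‖q‖ < 1 / 2) : 1 - 2 * q ≠ 0 := by
  intro h
  have : ‖2 * q‖ = 1 := by rw [← sub_eq_zero.mp h, norm_one]
  rw [norm_mul] at this; norm_num at this; linarith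

lemma diff_inv_sub (a : ℂ) {r : ℝ} (hr : r ≤ ‖a‖) :
    DifferentiableOn ℂ (fun q : ℂ => 1 / (a - q)) (Metric.ball 0 r) := by
  intro q hq
  have hq : ‖q‖ < r := by simpa using hq
  have : a - q ≠ 0 := by
    intro h
    rw [sub_eq_zero.mp h] at hr; linarith
  exact ((differentiableAt_const _).div (by fun_prop) this).differentiableWithinAt

lemma cf_inv_sub (a : ℂ) (ha : a ≠ 0) (N : ℕ) : cf (fun q => 1 / (a - q)) N = a⁻¹ * a⁻¹ ^ N := by
  have hr : 0 < ‖a‖ := norm_pos_iff.mpr ha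
  refine cf_eq_of_hasSum (c := fun n => a⁻¹ * a⁻¹ ^ n) hr (diff_inv_sub a le_rfl) (fun q hq => ?_) N
  have h1 : ‖a⁻¹ * q‖ < 1 := by
    rw [norm_mul, norm_inv, inv_mul_lt_iff₀ hr]; simpa using hq
  have h := (hasSum_geometric_of_norm_lt_one h1).mul_left a⁻¹
  have e : 1 / (a - q) = a⁻¹ * (1 - a⁻¹ * q)⁻¹ := by
    rw [← mul_inv, mul_sub, mul_one, mul_inv_cancel_left₀ ha, one_div]
  rw [e]
  have e2 : (fun n => a⁻¹ * a⁻¹ ^ n * q ^ n) = fun n : ℕ => a⁻¹ * (a⁻¹ * q) ^ n := by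
    funext n
    rw [mul_pow]; ring
  rw [e2]; exact h

lemma diff_d1 : DifferentiableOn ℂ (fun q : ℂ => 1 / (1 - 2 * q)) (Metric.ball 0 (1 / 2)) := by
  intro q hq
  have hne := delta_ne (q := q) (by simpa using hq)
  have : DifferentiableAt ℂ (fun q : ℂ => 1 / (1 - 2 * q)) q := by fun_prop (disch := exact hne)
  exact this.differentiableWithinAt

lemma diff_d2 : DifferentiableOn ℂ (fun q : ℂ => 1 / (1 - 2 * q) ^ 2) (Metric.ball 0 (1 / 2)) := by
  intro q hq
  have hne := pow_ne_zero 2 (delta_ne (q := q) (by simpa using hq))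
  have : DifferentiableAt ℂ (fun q : ℂ => 1 / (1 - 2 * q) ^ 2) q := by fun_prop (disch := exact hne)
  exact this.differentiableWithinAt

lemma cf_d1 (N : ℕ) : cf (fun q => 1 / (1 - 2 * q)) N = 2 ^ N := by
  refine cf_eq_of_hasSum (c := fun n => (2 : ℂ) ^ n) (by norm_num) diff_d1 (fun q hq => ?_) N
  have h1 : ‖2 * q‖ < 1 := by rw [norm_mul]; norm_num; linarith
  simpa [mul_pow] using hasSum_geometric_of_norm_lt_one h1

lemma cf_d2 (N : ℕ) : cf (fun q => 1 / (1 - 2 * q) ^ 2) N = 2 ^ N * (N + 1) := by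
  refine cf_eq_of_hasSum (c := fun n => (2 : ℂ) ^ n * (n + 1)) (by norm_num) diff_d2
    (fun q hq => ?_) N
  have h1 : ‖2 * q‖ < 1 := by rw [norm_mul]; norm_num; linarith
  have h := hasSum_choose_mul_geometric_of_norm_lt_one 1 h1
  have e2 : (fun n : ℕ => (2 : ℂ) ^ n * (n + 1) * q ^ n) =
      fun n : ℕ => ((n + 1).choose 1 : ℂ) * (2 * q) ^ n := by
    funext n
    rw [mul_pow, Nat.choose_one_right]; push_cast; ring
  rw [e2]; exact h

lemma dslope_bound {f : ℂ → ℂ} {R ρ M : ℝ} {a : ℂ} (hρ : ρ < R) (ha : ‖a‖ ≤ ρ)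
    (hf : DifferentiableOn ℂ f (Metric.ball 0 R)) (hM : ∀ q : ℂ, ‖q‖ < R → ‖f q‖ ≤ M) :
    DifferentiableOn ℂ (dslope f a) (Metric.ball 0 R) ∧
      ∀ q : ℂ, ‖q‖ < R → ‖dslope f a q‖ ≤ 4 * M / (R - ρ) := by
  have hd : DifferentiableOn ℂ (dslope f a) (Metric.ball 0 R) := by
    rw [Complex.differentiableOn_dslope]
    · exact hf
    · exact Metric.isOpen_ball.mem_nhds (by simpa using ha.trans_lt hρ)
  refine ⟨hd, fun q hq => ?_⟩
  obtain ⟨r, hr1, hr2⟩ := exists_between (max_lt hq (show (R + ρ) / 2 < R by linarith))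
  have hq' := (le_max_left _ _).trans_lt hr1
  have hr' := (le_max_right _ _).trans_lt hr1
  have hρ0 : 0 ≤ ρ := (norm_nonneg a).trans ha
  have hr0 : 0 < r := by linarith
  refine Complex.norm_le_of_forall_mem_frontier_norm_le (U := Metric.ball 0 r) Metric.isBounded_ball
    ?_ ?_ (subset_closure (by simpa using hq'))
  · apply DifferentiableOn.diffContOnCl
    rw [closure_ball _ hr0.ne']
    exact hd.mono (Metric.closedBall_subset_ball hr2)
  · intro z hz
    rw [frontier_ball _ hr0.ne'] at hz
    have hz : ‖z‖ = r := by simpa using hz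
    have hza : (R - ρ) / 2 ≤ ‖z - a‖ := by
      have := norm_sub_norm_le z a
      linarith
    have hne : z ≠ a := by
      intro h; rw [h, sub_self, norm_zero] at hza; linarith
    rw [dslope_of_ne _ hne, slope_def_field, norm_div, div_le_iff₀ (by linarith)]
    have h1 : ‖f z - f a‖ ≤ 2 * M := by
      have := norm_sub_le (f z) (f a)
      have := hM z (by linarith)
      have := hM a (by linarith)
      linarith
    have hM0 : 0 ≤ M := (norm_nonneg _).trans (hM z (by linarith))
    calc _ ≤ 2 * M := h1
      _ = 4 * M / (R - ρ) * ((R - ρ) / 2) := by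
        have : R - ρ ≠ 0 := by linarith
        field_simp; ring
      _ ≤ _ := by
        gcongr

lemma dslope_eq (f : ℂ → ℂ) (a q : ℂ) : f q = f a + (q - a) * dslope f a q := by
  have := sub_smul_dslope f a q
  rw [smul_eq_mul] at this
  rw [this]; ring

/-- coefficient asymptotics of `g/(1-2q)^2`, uniform in `g`. -/
lemma coef_lem1 {R ρ : ℝ} (hρ : 1 / 2 < ρ) (hR : ρ < R) : ∃ K : ℝ, 0 < K ∧ ∀ (g : ℂ → ℂ) (M : ℝ),
    DifferentiableOn ℂ g (Metric.ball 0 R) → (∀ q : ℂ, ‖q‖ < R → ‖g q‖ ≤ M) → ∀ N : ℕ,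
    ‖cf (fun q => g q / (1 - 2 * q) ^ 2) N - 2 ^ N * (g (1 / 2) * (N + 1) - deriv g (1 / 2) / 2)‖
      ≤ K * M / ρ ^ N := by
  refine ⟨1 / 4 * (4 / (R - ρ)) ^ 2, by have : 0 < R - ρ := by linarith
                                        positivity, ?_⟩
  intro g M hg hM N
  have ha : ‖(1 / 2 : ℂ)‖ ≤ ρ := by norm_num; linarith
  obtain ⟨h1d, h1⟩ := dslope_bound hR ha hg hM
  obtain ⟨h2d, h2⟩ := dslope_bound hR ha h1d h1
  set g1 := dslope g (1 / 2) with hg1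
  set g2 := dslope g1 (1 / 2) with hg2
  have hhalf : (0 : ℝ) < 1 / 2 := by norm_num
  have hsub : Metric.ball (0 : ℂ) (1 / 2) ⊆ Metric.ball 0 R := Metric.ball_subset_ball (by linarith)
  have e : cf (fun q => g q / (1 - 2 * q) ^ 2) N = cf (fun q => g (1 / 2) * (1 / (1 - 2 * q) ^ 2)
      + (-deriv g (1 / 2) / 2 * (1 / (1 - 2 * q)) + 1 / 4 * g2 q)) N := by
    refine cf_congr hhalf (fun q hq => ?_) N
    have hne := delta_ne hq
    rw [dslope_eq g (1 / 2) q, ← hg1, dslope_eq g1 (1 / 2) q, ← hg2]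
    have : g1 (1 / 2) = deriv g (1 / 2) := by rw [hg1, dslope_same]
    rw [this]
    have e2 : (q - 1 / 2) = -(1 - 2 * q) / 2 := by ring
    rw [e2]
    field_simp
    ring
  rw [e, cf_lin3 hhalf diff_d2 diff_d1 (h2d.mono hsub), cf_d1, cf_d2]
  have e3 : g (1 / 2) * (2 ^ N * (↑N + 1)) + (-deriv g (1 / 2) / 2 * 2 ^ N + 1 / 4 * cf g2 N)
      - 2 ^ N * (g (1 / 2) * (↑N + 1) - deriv g (1 / 2) / 2) = 1 / 4 * cf g2 N := by ring
  rw [e3, norm_mul]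
  have := cf_bound (by linarith) hR h2d h2 N
  norm_num
  calc 1 / 4 * ‖cf g2 N‖ ≤ 1 / 4 * (4 * (4 * M / (R - ρ)) / (R - ρ) / ρ ^ N) := by gcongr
    _ = _ := by ring

lemma cf_inv_sub_d2 (a : ℂ) (ha : a ≠ 0) (ha2 : a ≠ 1 / 2) (N : ℕ) :
    cf (fun q => 1 / (a - q) / (1 - 2 * q) ^ 2) N =
      a⁻¹ / (1 - 2 * a) ^ 2 * a⁻¹ ^ N + 2 ^ N * ((a - 1 / 2)⁻¹ * (N + 1) - ((a - 1 / 2)⁻¹) ^ 2 / 2) := by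
  set r := min ‖a‖ (1 / 2) with hr
  have hr0 : 0 < r := lt_min (norm_pos_iff.mpr ha) (by norm_num)
  have s2 : Metric.ball (0 : ℂ) r ⊆ Metric.ball 0 (1 / 2) := Metric.ball_subset_ball (min_le_right _ _)
  have hd := diff_inv_sub a (r := r) (min_le_left _ _)
  have h2a : a - 1 / 2 ≠ 0 := sub_ne_zero.mpr ha2
  have h2a' : 1 - 2 * a ≠ 0 := by
    intro h; apply h2a; linear_combination -h / 2
  have e : cf (fun q => 1 / (a - q) / (1 - 2 * q) ^ 2) N =
      cf (fun q => 1 / (1 - 2 * a) ^ 2 * (1 / (a - q)) + ((a - 1 / 2)⁻¹ * (1 / (1 - 2 * q) ^ 2)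
        + (-((a - 1 / 2)⁻¹) ^ 2 / 2) * (1 / (1 - 2 * q)))) N := by
    refine cf_congr hr0 (fun q hq => ?_) N
    have h1 := delta_ne (hq.trans_le (min_le_right _ _))
    have h3 : a - q ≠ 0 := by
      intro h
      have := hq.trans_le (min_le_left _ _)
      rw [sub_eq_zero.mp h] at this; exact lt_irrefl _ this
    have e4 : (a - 1 / 2)⁻¹ = -2 / (1 - 2 * a) := by
      rw [show a - 1 / 2 = -(1 - 2 * a) / 2 by ring]
      field_simp
    rw [e4]
    have e5 : 1 / (1 - 2 * a) ^ 2 * (1 / (a - q)) + (-2 / (1 - 2 * a) * (1 / (1 - 2 * q) ^ 2)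
        + (-(-2 / (1 - 2 * a)) ^ 2 / 2) * (1 / (1 - 2 * q))) - 1 / (a - q) / (1 - 2 * q) ^ 2 = 0 := by
      have e6 : 2 * q = 2 * a - 2 * (a - q) := by ring
      generalize hX : a - q = X at *
      generalize hY : 1 - 2 * q = Y at *
      generalize hZ : 1 - 2 * a = Z at *
      have hYZ : X = (Y - Z) / 2 := by rw [← hX, ← hY, ← hZ]; ring
      field_simp
      rw [hYZ]; ring
    exact (sub_eq_zero.mp e5).symm
  rw [e, cf_lin3 hr0 hd (diff_d2.mono s2) (diff_d1.mono s2), cf_d1, cf_d2, cf_inv_sub a ha]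
  ring

/-- coefficient asymptotics of `f/((a-q)(1-2q)^2)`, uniform in `f` and `a`. -/
lemma coef_lem2 {R ρ : ℝ} (hρ : 1 / 2 < ρ) (hR : ρ < R) : ∃ K : ℝ, 0 < K ∧
    ∀ (f : ℂ → ℂ) (M : ℝ) (a : ℂ), a ≠ 0 → a ≠ 1 / 2 → ‖a‖ ≤ ρ →
    DifferentiableOn ℂ f (Metric.ball 0 R) → (∀ q : ℂ, ‖q‖ < R → ‖f q‖ ≤ M) → ∀ N : ℕ,
    ‖cf (fun q => f q / (a - q) / (1 - 2 * q) ^ 2) N -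
      (2 ^ N * (f (1 / 2) / (a - 1 / 2) * (N + 1) - deriv (fun q => f q / (a - q)) (1 / 2) / 2)
        + f a * a⁻¹ / (1 - 2 * a) ^ 2 * a⁻¹ ^ N)‖
      ≤ K * M / ρ ^ N := by
  obtain ⟨K, hK0, hK⟩ := coef_lem1 hρ hR
  have hRρ : 0 < R - ρ := by linarith
  refine ⟨K * (4 / (R - ρ)), by positivity, ?_⟩
  intro f M a ha ha2 haρ hf hM N
  obtain ⟨h1d, h1⟩ := dslope_bound hR haρ hf hM
  set f1 := dslope f a with hf1
  set r := min ‖a‖ (1 / 2) with hr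
  have hr0 : 0 < r := lt_min (norm_pos_iff.mpr ha) (by norm_num)
  have s2 : Metric.ball (0 : ℂ) r ⊆ Metric.ball 0 (1 / 2) := Metric.ball_subset_ball (min_le_right _ _)
  have s3 : Metric.ball (0 : ℂ) r ⊆ Metric.ball 0 R :=
    Metric.ball_subset_ball ((min_le_right _ _).trans (by linarith))
  have hd : DifferentiableOn ℂ (fun q => 1 / (a - q) / (1 - 2 * q) ^ 2) (Metric.ball 0 r) := by
    have := (diff_inv_sub a (r := r) (min_le_left _ _)).mul (diff_d2.mono s2)
    refine this.congr (fun q _ => ?_)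
    simp [div_eq_mul_inv]
  have hd1 : DifferentiableOn ℂ (fun q => f1 q / (1 - 2 * q) ^ 2) (Metric.ball 0 r) := by
    have := (h1d.mono s3).mul (diff_d2.mono s2)
    refine this.congr (fun q _ => ?_)
    simp [div_eq_mul_inv]
  have h2a : a - 1 / 2 ≠ 0 := sub_ne_zero.mpr ha2
  have hder : deriv (fun q => f q / (a - q)) (1 / 2) =
      f a * ((a - 1 / 2)⁻¹) ^ 2 - deriv f1 (1 / 2) := by
    have h12 : (1 / 2 : ℂ) ∈ Metric.ball (0 : ℂ) R := by
      simp only [Metric.mem_ball, dist_zero_right]; norm_num; linarith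
    have hD1 : HasDerivAt f1 (deriv f1 (1 / 2)) (1 / 2) :=
      (h1d.differentiableAt (Metric.isOpen_ball.mem_nhds h12)).hasDerivAt
    have hw : HasDerivAt (fun q : ℂ => f a * (a - q)⁻¹ - f1 q)
        (f a * (-(-1) / (a - 1 / 2) ^ 2) - deriv f1 (1 / 2)) (1 / 2) := by
      refine HasDerivAt.sub (HasDerivAt.const_mul _ (HasDerivAt.fun_inv ?_ h2a)) hD1
      simpa using (hasDerivAt_id (1 / 2 : ℂ)).const_sub a
    have hev : (fun q => f q / (a - q)) =ᶠ[𝓝 (1 / 2)] fun q : ℂ => f a * (a - q)⁻¹ - f1 q := by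
      filter_upwards [isOpen_ne.mem_nhds (Ne.symm ha2)] with q hq
      have : a - q ≠ 0 := sub_ne_zero.mpr (Ne.symm hq)
      rw [dslope_eq f a q, ← hf1]
      field_simp
      ring
    rw [hev.deriv_eq, hw.deriv]
    simp [div_eq_mul_inv]
  have e : cf (fun q => f q / (a - q) / (1 - 2 * q) ^ 2) N =
      cf (fun q => f a * (1 / (a - q) / (1 - 2 * q) ^ 2) + (-1) * (f1 q / (1 - 2 * q) ^ 2)) N := by
    refine cf_congr hr0 (fun q hq => ?_) N
    have h3 : a - q ≠ 0 := by
      intro h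
      have := hq.trans_le (min_le_left _ _)
      rw [sub_eq_zero.mp h] at this; exact lt_irrefl _ this
    have h4 := delta_ne (hq.trans_le (min_le_right _ _))
    rw [dslope_eq f a q, ← hf1]
    field_simp
    ring
  have hhalf : f (1 / 2) / (a - 1 / 2) = f a * (a - 1 / 2)⁻¹ - f1 (1 / 2) := by
    rw [dslope_eq f a (1 / 2), ← hf1]
    generalize hX : a - 1 / 2 = X at *
    rw [show (1 / 2 : ℂ) - a = -X by rw [← hX]; ring]
    field_simp
    ring
  rw [e, cf_add hr0 (hd.const_mul _) (hd1.const_mul _), cf_smul hr0 hd, cf_smul hr0 hd1,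
    cf_inv_sub_d2 a ha ha2, hder, hhalf]
  have := hK f1 _ h1d h1 N
  rw [← norm_neg]
  calc _ = ‖cf (fun q => f1 q / (1 - 2 * q) ^ 2) N -
        2 ^ N * (f1 (1 / 2) * (↑N + 1) - deriv f1 (1 / 2) / 2)‖ := by
        congr 1; ring
    _ ≤ _ := this
    _ = _ := by ring


/-! ### Part 4: extraction of coefficients of PA -/

def R1 : ℝ := 111 / 200

lemma R1_lt : R1 < R0 := by unfold R1 R0; norm_num

lemma mem_ball_R0 {q : ℂ} (hq : q ∈ Metric.ball (0 : ℂ) R0) : ‖q‖ < R0 := by simpa using hq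

lemma aF_diff : DifferentiableOn ℂ aF (Metric.ball 0 R0) := by
  intro q hq
  have h := quad_ne (mem_ball_R0 hq)
  have : DifferentiableAt ℂ aF q := by unfold aF; fun_prop (disch := exact h)
  exact this.differentiableWithinAt

lemma vF_diff : DifferentiableOn ℂ vF (Metric.ball 0 R0) := by
  intro q hq
  have h := one_sub_ne (mem_ball_R0 hq)
  have : DifferentiableAt ℂ vF q := by unfold vF; fun_prop (disch := exact h)
  exact this.differentiableWithinAt

lemma uF_diff : DifferentiableOn ℂ uF (Metric.ball 0 R0) := by
  intro q hq
  have h := one_sub_ne (mem_ball_R0 hq)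
  have : DifferentiableAt ℂ uF q := by unfold uF; fun_prop (disch := exact h)
  exact this.differentiableWithinAt

lemma Ct_diff : DifferentiableOn ℂ Ct (Metric.ball 0 R0) := by
  intro q hq
  have h := one_sub_ne (mem_ball_R0 hq)
  have : DifferentiableAt ℂ Ct q := by unfold Ct; fun_prop (disch := exact h)
  exact this.differentiableWithinAt

lemma BB_diff : DifferentiableOn ℂ BB (Metric.ball 0 R0) := by
  have h1 := qPI_differentiableOn (U := Metric.ball 0 R0) Metric.isOpen_ball
    (X := fun q => vF q * q) (Q := fun q => q) (C := 24 / 25) (ρ := R0)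
    (vF_diff.mul differentiableOn_id) differentiableOn_id
    (fun z hz => vq_le (mem_ball_R0 hz)) (fun z hz => (mem_ball_R0 hz).le) R0_lt
  have h2 := qPI_differentiableOn (U := Metric.ball 0 R0) Metric.isOpen_ball
    (X := fun q => uF q * q) (Q := fun q => q) (C := 3 / 4) (ρ := R0)
    (uF_diff.mul differentiableOn_id) differentiableOn_id
    (fun z hz => uq_le (mem_ball_R0 hz)) (fun z hz => (mem_ball_R0 hz).le) R0_lt
  have h3 : DifferentiableOn ℂ (fun q : ℂ => 2 * q ^ 5 * (1 - q)) (Metric.ball 0 R0) := by fun_prop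
  refine (h3.mul h1).div h2 (fun z hz => ?_)
  have hz := mem_ball_R0 hz
  exact qPI_ne_zero _ _ (hz.trans R0_lt) (uq_ne hz)

lemma qPF_diff {U : Set ℂ} {X : ℂ → ℂ} (hX : DifferentiableOn ℂ X U) (n : ℕ) :
    DifferentiableOn ℂ (fun q => qPF (X q) q n) U := by
  induction n with
  | zero => simp only [qPF_zero]; exact differentiableOn_const _
  | succ n ih =>
    simp only [qPF_succ]
    have h : DifferentiableOn ℂ (fun q : ℂ => q ^ n) U := by fun_prop
    exact ih.mul ((differentiableOn_const _).sub (hX.mul h))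

lemma tF_diff (n : ℕ) : DifferentiableOn ℂ (fun q => tF q n) (Metric.ball 0 R0) := by
  unfold tF tG
  refine (qPF_diff aF_diff n).div (qPF_diff differentiableOn_id n) (fun z hz => ?_)
  exact qPF_ne_zero _ _ (one_sub_qpow_ne z ((mem_ball_R0 hz).trans R0_lt)) n

lemma hF_diff (n : ℕ) : DifferentiableOn ℂ (hF n) (Metric.ball 0 R0) := by
  have h : DifferentiableOn ℂ (fun q => (vF q * q) ^ n) (Metric.ball 0 R0) :=
    (vF_diff.mul differentiableOn_id).pow n
  exact (BB_diff.mul (tF_diff n)).mul h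

lemma bdd_of_diff {f : ℂ → ℂ} (hf : DifferentiableOn ℂ f (Metric.ball 0 R0)) :
    ∃ C : ℝ, 0 < C ∧ ∀ q : ℂ, ‖q‖ ≤ R1 → ‖f q‖ ≤ C := by
  obtain ⟨C, hC⟩ := (isCompact_closedBall (0 : ℂ) R1).exists_bound_of_continuousOn
    (hf.continuousOn.mono (Metric.closedBall_subset_ball R1_lt))
  exact ⟨max C 1, by positivity, fun q hq => (hC q (by simpa using hq)).trans (le_max_left _ _)⟩

lemma hF_bound : ∃ C : ℝ, 0 < C ∧ ∀ q : ℂ, ‖q‖ ≤ R1 → ∀ n, ‖hF n q‖ ≤ C * (24 / 25) ^ n := by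
  obtain ⟨C1, h10, h1⟩ := bdd_of_diff BB_diff
  obtain ⟨C2, h20, h2⟩ := tF_bound
  refine ⟨C1 * C2, by positivity, fun q hq n => ?_⟩
  have hq' : ‖q‖ < R0 := hq.trans_lt R1_lt
  unfold hF
  rw [norm_mul, norm_mul, norm_pow]
  gcongr
  · exact h1 q hq
  · exact h2 q hq' n
  · exact vq_le hq'

lemma Dn_quarter {q : ℂ} (hq : ‖q‖ < 1 / 4) (n : ℕ) : 7 / 16 ≤ ‖Dn n q‖ := by
  unfold Dn
  have h1 : ‖(1 : ℂ)‖ - ‖2 * q - q ^ (n + 2)‖ ≤ ‖1 - (2 * q - q ^ (n + 2))‖ := norm_sub_norm_le _ _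
  have h2 : ‖2 * q - q ^ (n + 2)‖ ≤ ‖2 * q‖ + ‖q ^ (n + 2)‖ := norm_sub_le _ _
  rw [norm_mul, norm_pow] at h2
  rw [norm_one] at h1
  norm_num at h2
  have h3 : ‖q‖ ^ (n + 2) ≤ (1 / 4) ^ 2 := by
    calc ‖q‖ ^ (n + 2) ≤ ‖q‖ ^ 2 := pow_le_pow_of_le_one (norm_nonneg _) (by linarith) (by omega)
      _ ≤ _ := by gcongr
  rw [show 1 - 2 * q + q ^ (n + 2) = 1 - (2 * q - q ^ (n + 2)) by ring]
  linarith

lemma div_d2_diff {f : ℂ → ℂ} {r : ℝ} (hr : r ≤ 1 / 2) (hf : DifferentiableOn ℂ f (Metric.ball 0 r)) :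
    DifferentiableOn ℂ (fun q => f q / (1 - 2 * q) ^ 2) (Metric.ball 0 r) := by
  have := hf.mul (diff_d2.mono (Metric.ball_subset_ball hr))
  refine this.congr (fun q _ => ?_)
  simp [div_eq_mul_inv]

lemma Dn_diff (n : ℕ) : Differentiable ℂ (Dn n) := by unfold Dn; fun_prop

lemma pa_hasSum {pa : ℕ → ℂ} (hpa : ∃ r : ℝ, 0 < r ∧
          ∀ q : ℂ, ‖q‖ < r → HasSum (fun n => pa n * q ^ n) (PAseries q)) (N : ℕ) :
    HasSum (fun n => cf (fun q => pF n q / (1 - 2 * q) ^ 2) N)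
      (pa N - cf (fun q => Ct q / (1 - 2 * q) ^ 2) N) := by
  obtain ⟨r, hr, hpa⟩ := hpa
  obtain ⟨C, hC0, hC⟩ := hF_bound
  have hR0 : (1 / 4 : ℝ) ≤ R0 := by unfold R0; norm_num
  have hR1 : (1 / 4 : ℝ) ≤ R1 := by unfold R1; norm_num
  set G : ℕ → ℂ → ℂ := fun n q => pF n q / (1 - 2 * q) ^ 2 with hG
  have hGd : ∀ n, DifferentiableOn ℂ (G n) (Metric.ball 0 (1 / 4)) := by
    intro n
    refine div_d2_diff (by norm_num) ?_
    refine ((hF_diff n).mono (Metric.ball_subset_ball hR0)).div (Dn_diff n).differentiableOn ?_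
    intro z hz
    have := Dn_quarter (q := z) (by simpa using hz) n
    rw [← norm_pos_iff]; linarith
  have hGb : ∀ n, ∀ q : ℂ, ‖q‖ < 1 / 4 → ‖G n q‖ ≤ 10 * C * (24 / 25) ^ n := by
    intro n q hq
    have h1 := hC q (by linarith) n
    have h2 := Dn_quarter hq n
    have h3 : 1 / 2 ≤ ‖1 - 2 * q‖ := by
      have : ‖(1 : ℂ)‖ - ‖2 * q‖ ≤ ‖1 - 2 * q‖ := norm_sub_norm_le _ _
      rw [norm_one, norm_mul] at this
      norm_num at this
      linarith
    simp only [hG, pF]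
    rw [norm_div, norm_div, norm_pow, div_div, div_le_iff₀ (by positivity)]
    have h4 : 7 / 16 * (1 / 2) ^ 2 ≤ ‖Dn n q‖ * ‖1 - 2 * q‖ ^ 2 := by gcongr
    calc ‖hF n q‖ ≤ C * (24 / 25) ^ n := h1
      _ ≤ 10 * C * (24 / 25) ^ n * (7 / 16 * (1 / 2) ^ 2) := by
        have : 0 < C * (24 / 25) ^ n := by positivity
        nlinarith
      _ ≤ _ := by gcongr
  have hcb : ∀ n N, ‖cf (G n) N‖ ≤ 10 * C * (24 / 25) ^ n * 5 ^ N := by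
    intro n N
    have := cf_bound (ρ := 1 / 5) (r := 1 / 4) (by norm_num) (by norm_num) (hGd n) (hGb n) N
    calc _ ≤ _ := this
      _ = _ := by rw [one_div, inv_pow, div_inv_eq_mul]
  have hsN : ∀ N, Summable (fun n => cf (G n) N) := by
    intro N
    refine Summable.of_norm_bounded (g := fun n : ℕ => 10 * C * (24 / 25) ^ n * 5 ^ N) ?_
      (fun n => hcb n N)
    exact ((summable_geometric_of_lt_one (by norm_num) (by norm_num)).mul_left _).mul_right _
  have hCd := div_d2_diff (r := 1 / 4) (by norm_num) (Ct_diff.mono (Metric.ball_subset_ball hR0))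
  have key : pa = fun N => cf (fun q => Ct q / (1 - 2 * q) ^ 2) N + ∑' n, cf (G n) N := by
    refine coeff_unique (r := min r (1 / 5)) (by positivity) (fun q hq => ?_)
    have hq1 : ‖q‖ < r := hq.trans_le (min_le_left _ _)
    have hq2 : ‖q‖ < 1 / 5 := hq.trans_le (min_le_right _ _)
    have hq4 : ‖q‖ < 1 / 4 := by linarith
    refine ⟨_, hpa q hq1, ?_⟩
    have hs2 : Summable (fun p : ℕ × ℕ => cf (G p.1) p.2 * q ^ p.2) := by
      have s1 : Summable (fun p : ℕ × ℕ => (10 * C * (24 / 25 : ℝ) ^ p.1) * (5 * ‖q‖) ^ p.2) := by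
        apply Summable.mul_of_nonneg (f := fun n : ℕ => 10 * C * (24 / 25 : ℝ) ^ n)
          (g := fun n : ℕ => (5 * ‖q‖) ^ n)
        · exact (summable_geometric_of_lt_one (by norm_num) (by norm_num)).mul_left _
        · exact summable_geometric_of_lt_one (by positivity) (by linarith)
        · intro n; positivity
        · intro n; positivity
      refine Summable.of_norm_bounded s1 (fun p => ?_)
      rw [norm_mul, norm_pow, mul_pow, ← mul_assoc]
      gcongr
      exact hcb p.1 p.2
    have h1 := cf_hasSum hCd hq4
    have hG1 : ∀ n, HasSum (fun N => cf (G n) N * q ^ N) (G n q) := fun n => cf_hasSum (hGd n) hq4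
    have hs3 : Summable (fun p : ℕ × ℕ => cf (G p.2) p.1 * q ^ p.1) := by
      exact (Equiv.prodComm ℕ ℕ).summable_iff.mp hs2
    have h2 : HasSum (fun N => (∑' n, cf (G n) N) * q ^ N) (∑' n, G n q) := by
      have e1 : ∑' n, G n q = ∑' p : ℕ × ℕ, cf (G p.2) p.1 * q ^ p.1 := by
        rw [← (Equiv.prodComm ℕ ℕ).tsum_eq (fun p : ℕ × ℕ => cf (G p.2) p.1 * q ^ p.1)]
        rw [Summable.tsum_prod (f := fun c => _) ]
        · exact tsum_congr (fun n => (hG1 n).tsum_eq.symm)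
        · exact hs2
      rw [e1]
      refine hs3.hasSum.prod_fiberwise (fun N => ?_)
      exact (hsN N).hasSum.mul_right (q ^ N)
    have h3 := h1.add h2
    have e : PAseries q = Ct q / (1 - 2 * q) ^ 2 + ∑' n, G n q := by
      rw [PAseries_eq q hq4, add_div, hG]
      simp only [tsum_div_const]
    rw [e]
    refine h3.congr_fun ?_
    intro N
    simp only [add_mul]
  rw [key]
  simp only [add_sub_cancel_left]
  exact (hsN N).hasSum

def rhoN (a : ℕ → ℂ) (n : ℕ) : ℂ :=
  hF n (a n) / (2 - (n + 2) * (a n) ^ (n + 1)) * (a n)⁻¹ / (1 - 2 * a n) ^ 2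

def kF (n : ℕ) (a q : ℂ) : ℂ := 2 - ∑ i ∈ Finset.range (n + 2), q ^ i * a ^ (n + 2 - 1 - i)

lemma kF_diff (n : ℕ) (a : ℂ) : Differentiable ℂ (kF n a) := by unfold kF; fun_prop

lemma Dn_eq_kF {n : ℕ} {a : ℂ} (h : Dn n a = 0) (q : ℂ) : Dn n q = (a - q) * kF n a q := by
  have e := geom_sum₂_mul q a (n + 2)
  unfold kF
  have h2 : Dn n q = Dn n q - Dn n a := by rw [h, sub_zero]
  rw [h2]
  unfold Dn
  linear_combination -e

lemma kF_self (n : ℕ) (a : ℂ) : kF n a a = 2 - (n + 2) * a ^ (n + 1) := by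
  unfold kF
  congr 1
  rw [Finset.sum_congr rfl (g := fun _ => a ^ (n + 1))]
  · simp
  · intro i hi
    rw [← pow_add]
    congr 1
    have := Finset.mem_range.mp hi
    omega

lemma kF_ge {n : ℕ} {a q : ℂ} (ha : ‖a‖ ≤ R1) (hq : ‖q‖ ≤ R1)
    (hn : ((n : ℝ) + 2) * R1 ^ (n + 1) ≤ 1) : 1 ≤ ‖kF n a q‖ := by
  unfold kF
  have h1 := norm_sub_norm_le (2 : ℂ) (∑ i ∈ Finset.range (n + 2), q ^ i * a ^ (n + 2 - 1 - i))
  have h2 : ‖∑ i ∈ Finset.range (n + 2), q ^ i * a ^ (n + 2 - 1 - i)‖ ≤ 1 := by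
    refine (norm_sum_le_of_le (f := fun i => q ^ i * a ^ (n + 2 - 1 - i)) _
      (n := fun _ => R1 ^ (n + 1)) ?_).trans ?_
    · intro i hi
      have := Finset.mem_range.mp hi
      rw [norm_mul, norm_pow, norm_pow]
      calc ‖q‖ ^ i * ‖a‖ ^ (n + 2 - 1 - i) ≤ R1 ^ i * R1 ^ (n + 2 - 1 - i) := by
            gcongr
            unfold R1; norm_num
        _ = R1 ^ (n + 1) := by rw [← pow_add]; congr 1; omega
    · simp only [Finset.sum_const, Finset.card_range, nsmul_eq_mul]
      push_cast
      exact hn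
  rw [show ‖(2 : ℂ)‖ = 2 by norm_num] at h1
  linarith

lemma Dn_factor (n : ℕ) (q : ℂ) :
    Dn n q = (1 - q) * (1 - ∑ i ∈ Finset.range (n + 1), q ^ (i + 1)) := by
  have h : (∑ i ∈ Finset.range (n + 1), q ^ (i + 1)) * (1 - q) = q - q ^ (n + 2) := by
    induction n with
    | zero => simp; ring
    | succ n ih => rw [Finset.sum_range_succ, add_mul, ih]; ring
  unfold Dn
  linear_combination h

lemma geo_half (n : ℕ) : ∑ i ∈ Finset.range n, (1 / 2 : ℝ) ^ (i + 1) = 1 - (1 / 2) ^ n := by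
  induction n with
  | zero => simp
  | succ n ih => rw [Finset.sum_range_succ, ih]; ring

lemma small_r (n1 : ℕ) : ∃ r c : ℝ, 1 / 2 < r ∧ r ≤ R1 ∧ 0 < c ∧
    ∀ n < n1, ∀ q : ℂ, ‖q‖ < r → c ≤ ‖Dn n q‖ := by
  have hc : Continuous (fun r : ℝ => ∑ i ∈ Finset.range (n1 + 1), r ^ (i + 1)) := by fun_prop
  have h1 : ∑ i ∈ Finset.range (n1 + 1), (1 / 2 : ℝ) ^ (i + 1) < 1 := by
    rw [geo_half]
    have : (0 : ℝ) < (1 / 2) ^ (n1 + 1) := by positivity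
    linarith
  have h2 : ∀ᶠ r in 𝓝 (1 / 2 : ℝ), ∑ i ∈ Finset.range (n1 + 1), r ^ (i + 1) < 1 :=
    hc.continuousAt.eventually_lt continuousAt_const h1
  obtain ⟨ε, hε, hε'⟩ := Metric.eventually_nhds_iff.mp h2
  set r := min R1 (1 / 2 + ε / 2) with hr
  have hr1 : 1 / 2 < r := lt_min (by unfold R1; norm_num) (by linarith)
  have hr2 : r ≤ 1 / 2 + ε / 2 := min_le_right _ _
  have hrR : r ≤ R1 := min_le_left _ _
  have h3 := hε' (y := r) (by rw [Real.dist_eq, abs_of_pos (by linarith)]; linarith)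
  have hR : R1 = 111 / 200 := rfl
  refine ⟨r, (1 - R1) * (1 - ∑ i ∈ Finset.range (n1 + 1), r ^ (i + 1)), hr1, hrR,
    mul_pos (by rw [hR]; norm_num) (by linarith), ?_⟩
  intro n hn q hq
  rw [Dn_factor, norm_mul]
  have h4 := norm_sub_norm_le (1 : ℂ) q
  have h5 := norm_sub_norm_le (1 : ℂ) (∑ i ∈ Finset.range (n + 1), q ^ (i + 1))
  rw [norm_one] at h4 h5
  have h6 : ‖∑ i ∈ Finset.range (n + 1), q ^ (i + 1)‖ ≤
      ∑ i ∈ Finset.range (n1 + 1), r ^ (i + 1) := by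
    refine (norm_sum_le _ _).trans ?_
    calc ∑ i ∈ Finset.range (n + 1), ‖q ^ (i + 1)‖
        ≤ ∑ i ∈ Finset.range (n + 1), r ^ (i + 1) := by
          refine Finset.sum_le_sum (fun i _ => ?_)
          rw [norm_pow]; gcongr
      _ ≤ _ := by
          refine Finset.sum_le_sum_of_subset_of_nonneg ?_ (fun i _ _ => by positivity)
          intro i hi; simp only [Finset.mem_range] at hi ⊢; omega
  apply mul_le_mul <;> linarith [norm_nonneg (1 - q)]

lemma pow_theta {r θ : ℝ} (hr : 1 / 2 < r) (hθ : 1 / (2 * r) ≤ θ) {x K : ℝ} {N : ℕ} (hK : 0 ≤ K)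
    (h : x ≤ K / r ^ N) : x / 2 ^ N ≤ K * θ ^ N := by
  have h0 : (0 : ℝ) < 2 ^ N := by positivity
  have hr0 : 0 < r := by linarith
  calc x / 2 ^ N ≤ K / r ^ N / 2 ^ N := by gcongr
    _ = K * (1 / (2 * r)) ^ N := by
      rw [one_div, inv_pow, mul_pow]; field_simp
    _ ≤ _ := by gcongr

theorem extraction (n1 : ℕ) (a : ℕ → ℂ) (ha : ∀ n, n1 ≤ n → Dn n (a n) = 0)
    (ha' : ∀ n, n1 ≤ n → ‖a n‖ ≤ 11 / 20) (hk : ∀ n : ℕ, n1 ≤ n → ((n : ℝ) + 2) * R1 ^ (n + 1) ≤ 1) :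
    ∃ C θ : ℝ, 0 < C ∧ 0 < θ ∧ θ < 1 ∧ ∀ pa : ℕ → ℂ, (∃ r : ℝ, 0 < r ∧
          ∀ q : ℂ, ‖q‖ < r → HasSum (fun n => pa n * q ^ n) (PAseries q)) →
      ∃ e : ℕ → ℂ, ∀ N : ℕ, ‖e N‖ ≤ C * θ ^ N ∧
        Tendsto (fun M : ℕ => (Ct (1 / 2) + ∑ n ∈ Finset.range M, pF n (1 / 2)) * (N + 1)
          - (deriv Ct (1 / 2) + ∑ n ∈ Finset.range M, deriv (pF n) (1 / 2)) / 2
          + ∑ n ∈ Finset.range M, if n1 ≤ n then rhoN a n * (2 * a n)⁻¹ ^ N else 0) atTop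
          (𝓝 (pa N / 2 ^ N - e N)) := by
  obtain ⟨C, hC0, hC⟩ := hF_bound
  obtain ⟨Cc, hCc0, hCc⟩ := bdd_of_diff Ct_diff
  obtain ⟨r, c, hr1, hrR, hc0, hc⟩ := small_r n1
  have hR : R1 = 111 / 200 := rfl
  have hρ1 : (1 / 2 : ℝ) < 11 / 20 := by norm_num
  have hρ2 : (11 / 20 : ℝ) < R1 := by rw [hR]; norm_num
  obtain ⟨K1, hK10, hK1⟩ := coef_lem1 hρ1 hρ2
  obtain ⟨K2, hK20, hK2⟩ := coef_lem2 hρ1 hρ2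
  obtain ⟨r', hr'1, hr'2⟩ := exists_between hr1
  obtain ⟨K3, hK30, hK3⟩ := coef_lem1 hr'1 hr'2
  set θ : ℝ := max (1 / (2 * (11 / 20))) (1 / (2 * r')) with hθ
  have hθ0 : 0 < θ := lt_max_of_lt_left (by norm_num)
  have hθ1 : θ < 1 := by
    apply max_lt
    · norm_num
    · rw [div_lt_one (by linarith)]; linarith
  set main : ℕ → ℕ → ℂ := fun n N => pF n (1 / 2) * (N + 1) - deriv (pF n) (1 / 2) / 2
    + if n1 ≤ n then rhoN a n * (2 * a n)⁻¹ ^ N else 0 with hmain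
  set κ : ℝ := 24 / 25 with hκ
  have hκ0 : 0 < κ := by norm_num
  set C' : ℝ := K2 * C + K3 * (C / c) with hC'
  have hC'0 : 0 < C' := by positivity
  have hsubR : Metric.ball (0 : ℂ) R1 ⊆ Metric.ball 0 R0 := Metric.ball_subset_ball R1_lt.le
  -- the per-term error
  have herr : ∀ n N, ‖cf (fun q => pF n q / (1 - 2 * q) ^ 2) N / 2 ^ N - main n N‖
      ≤ C' * κ ^ n * θ ^ N := by
    intro n N
    have h2N : (2 : ℂ) ^ N ≠ 0 := pow_ne_zero N two_ne_zero
    by_cases hn : n1 ≤ n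
    · have ha0 : a n ≠ 0 := by
        intro h; have := ha n hn; rw [h] at this; simp [Dn] at this
      have ha2 : a n ≠ 1 / 2 := by
        intro h; have := ha n hn; rw [h] at this; simp [Dn] at this
      have haR : ‖a n‖ ≤ R1 := (ha' n hn).trans hρ2.le
      have hkne : ∀ q : ℂ, ‖q‖ ≤ R1 → kF n (a n) q ≠ 0 := fun q hq => by
        have := kF_ge haR hq (hk n hn)
        rw [← norm_pos_iff]; linarith
      have hfd : DifferentiableOn ℂ (fun q => hF n q / kF n (a n) q) (Metric.ball 0 R1) := by
        refine ((hF_diff n).mono hsubR).div (kF_diff n _).differentiableOn (fun z hz => hkne z ?_)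
        have : ‖z‖ < R1 := by simpa using hz
        exact this.le
      have hfb : ∀ q : ℂ, ‖q‖ < R1 → ‖hF n q / kF n (a n) q‖ ≤ C * κ ^ n := by
        intro q hq
        have h1 := hC q hq.le n
        have h2 := kF_ge haR hq.le (hk n hn)
        rw [norm_div, div_le_iff₀ (by linarith)]
        calc _ ≤ _ := h1
          _ = C * κ ^ n * 1 := by ring
          _ ≤ _ := by gcongr
      have h := hK2 _ _ (a n) ha0 ha2 (ha' n hn) hfd hfb N
      have ep : ∀ q, pF n q = hF n q / kF n (a n) q / (a n - q) := by
        intro q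
        unfold pF
        rw [Dn_eq_kF (ha n hn), div_div, mul_comm]
      have ep' : (fun q => hF n q / kF n (a n) q / (a n - q)) = pF n := by
        funext q; rw [ep]
      have ep2 : (fun q => hF n q / kF n (a n) q / (a n - q) / (1 - 2 * q) ^ 2)
          = fun q => pF n q / (1 - 2 * q) ^ 2 := by
        funext q; rw [ep]
      rw [ep', ep2, ← ep, kF_self] at h
      have e : cf (fun q => pF n q / (1 - 2 * q) ^ 2) N / 2 ^ N - main n N =
          (cf (fun q => pF n q / (1 - 2 * q) ^ 2) N - (2 ^ N * (pF n (1 / 2) * (↑N + 1)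
            - deriv (pF n) (1 / 2) / 2) + hF n (a n) / (2 - (n + 2) * (a n) ^ (n + 1)) * (a n)⁻¹
              / (1 - 2 * a n) ^ 2 * (a n)⁻¹ ^ N)) / 2 ^ N := by
        simp only [hmain, if_pos hn, rhoN, mul_inv, mul_pow]
        rw [inv_pow 2 N]
        generalize (2 : ℂ) ^ N = X at *
        field_simp
      rw [e, norm_div, norm_pow]
      have h3 := pow_theta (θ := θ) hρ1 (le_max_left _ _) (by positivity) h
      rw [show ‖(2 : ℂ)‖ = 2 by norm_num]
      refine h3.trans ?_
      have : 0 < K3 * (C / c) * κ ^ n * θ ^ N := by positivity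
      rw [hC']
      linarith
    · have hn' : n < n1 := by omega
      have hpd : DifferentiableOn ℂ (pF n) (Metric.ball 0 r) := by
        refine ((hF_diff n).mono ((Metric.ball_subset_ball hrR).trans hsubR)).div
          (Dn_diff n).differentiableOn (fun z hz => ?_)
        have := hc n hn' z (by simpa using hz)
        rw [← norm_pos_iff]; linarith
      have hpb : ∀ q : ℂ, ‖q‖ < r → ‖pF n q‖ ≤ C / c * κ ^ n := by
        intro q hq
        have h1 := hC q (by linarith) n
        have h2 := hc n hn' q hq
        unfold pF
        rw [norm_div, div_le_iff₀ (by linarith)]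
        calc _ ≤ _ := h1
          _ = C / c * κ ^ n * c := by field_simp
          _ ≤ _ := by gcongr
      have h := hK3 _ _ hpd hpb N
      have e : cf (fun q => pF n q / (1 - 2 * q) ^ 2) N / 2 ^ N - main n N =
          (cf (fun q => pF n q / (1 - 2 * q) ^ 2) N - 2 ^ N * (pF n (1 / 2) * (↑N + 1)
            - deriv (pF n) (1 / 2) / 2)) / 2 ^ N := by
        simp only [hmain, if_neg hn]
        generalize (2 : ℂ) ^ N = X at *
        field_simp
        ring
      rw [e, norm_div, norm_pow]
      have h3 := pow_theta (θ := θ) hr'1 (le_max_right _ _) (by positivity) h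
      rw [show ‖(2 : ℂ)‖ = 2 by norm_num]
      refine h3.trans ?_
      have : 0 < K2 * C * κ ^ n * θ ^ N := by positivity
      rw [hC']
      linarith
  have hgs : Summable (fun n : ℕ => κ ^ n) :=
    summable_geometric_of_lt_one (by norm_num) (by norm_num)
  refine ⟨C' * (1 - κ)⁻¹ + K1 * Cc, θ, by have : 0 < 1 - κ := by norm_num
                                          positivity, hθ0, hθ1, ?_⟩
  intro pa hpa
  set err : ℕ → ℕ → ℂ := fun n N => cf (fun q => pF n q / (1 - 2 * q) ^ 2) N / 2 ^ N - main n N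
    with herrdef
  set errC : ℕ → ℂ := fun N => cf (fun q => Ct q / (1 - 2 * q) ^ 2) N / 2 ^ N -
    (Ct (1 / 2) * (N + 1) - deriv Ct (1 / 2) / 2) with herrC
  have hbd : ∀ N, Summable (fun n : ℕ => C' * κ ^ n * θ ^ N) := fun N =>
    (hgs.mul_left _).mul_right _
  have hes : ∀ N, Summable (fun n => err n N) := fun N =>
    Summable.of_norm_bounded (hbd N) (fun n => herr n N)
  refine ⟨fun N => ∑' n, err n N + errC N, fun N => ⟨?_, ?_⟩⟩
  · have h1 : ‖∑' n, err n N‖ ≤ C' * (1 - κ)⁻¹ * θ ^ N := by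
      refine tsum_of_norm_bounded (g := fun n : ℕ => C' * κ ^ n * θ ^ N) ?_ (fun n => herr n N)
      exact ((hasSum_geometric_of_lt_one (by norm_num) (by norm_num)).mul_left _).mul_right _
    have h2 : ‖errC N‖ ≤ K1 * Cc * θ ^ N := by
      have h := hK1 Ct Cc (Ct_diff.mono hsubR) (fun q hq => hCc q hq.le) N
      have h2N : (2 : ℂ) ^ N ≠ 0 := pow_ne_zero N two_ne_zero
      have e : errC N = (cf (fun q => Ct q / (1 - 2 * q) ^ 2) N - 2 ^ N * (Ct (1 / 2) * (↑N + 1)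
            - deriv Ct (1 / 2) / 2)) / 2 ^ N := by
        simp only [herrC]
        rw [sub_div, mul_div_cancel_left₀ _ h2N]
      rw [e, norm_div, norm_pow, show ‖(2 : ℂ)‖ = 2 by norm_num]
      exact pow_theta (θ := θ) hρ1 (le_max_left _ _) (by positivity) h
    calc _ ≤ ‖∑' n, err n N‖ + ‖errC N‖ := norm_add_le _ _
      _ ≤ _ := by rw [add_mul]; exact add_le_add h1 h2
  · have h1 := ((pa_hasSum hpa N).div_const (2 ^ N)).sub (hes N).hasSum
    have h2 := h1.tendsto_sum_nat.const_add (Ct (1 / 2) * (N + 1) - deriv Ct (1 / 2) / 2)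
    have e1 : pa N / 2 ^ N - (∑' n, err n N + errC N) =
        (Ct (1 / 2) * (N + 1) - deriv Ct (1 / 2) / 2) +
          ((pa N - cf (fun q => Ct q / (1 - 2 * q) ^ 2) N) / 2 ^ N - ∑' n, err n N) := by
      simp only [herrC]
      ring
    rw [e1]
    refine h2.congr (fun M => ?_)
    simp only [herrdef, sub_sub_cancel, hmain]
    rw [Finset.sum_add_distrib, Finset.sum_sub_distrib, ← Finset.sum_mul, ← Finset.sum_div]
    ring


/-! ### Part 5: the roots -/

def LL (e : ℂ) : ℂ := dslope (fun e : ℂ => Complex.log (1 + e)) 0 e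

def qe (e : ℂ) : ℂ := (1 + e) / 2

def WW (e : ℂ) : ℂ := 4 * (vF (qe e) * qe e) / 3

def L2 (e : ℂ) : ℂ := dslope (fun e : ℂ => Complex.log (WW e)) 0 e

lemma analyticAt_dslope {f : ℂ → ℂ} {a : ℂ} (hf : AnalyticAt ℂ f a) : AnalyticAt ℂ (dslope f a) a := by
  obtain ⟨p, hp⟩ := hf
  exact ⟨_, hp.has_fpower_series_dslope_fslope⟩

lemma LL_an : AnalyticAt ℂ LL 0 := by
  apply analyticAt_dslope
  have h : (1 + (0 : ℂ)) ∈ Complex.slitPlane := by simp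
  fun_prop (disch := exact h)

lemma LL_mul (e : ℂ) : e * LL e = Complex.log (1 + e) := by
  have := sub_smul_dslope (fun e : ℂ => Complex.log (1 + e)) 0 e
  simpa [LL] using this

lemma LL_zero : LL 0 = 1 := by
  unfold LL
  rw [dslope_same]
  have h : HasDerivAt (fun e : ℂ => Complex.log (1 + e)) (1 / (1 + 0)) 0 := by
    refine HasDerivAt.clog ?_ (by simp)
    simpa using (hasDerivAt_id (0 : ℂ)).const_add 1
  rw [h.deriv]; simp

lemma qe_an (e : ℂ) : AnalyticAt ℂ qe e := by unfold qe; fun_prop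

lemma qe_zero : qe 0 = 1 / 2 := by unfold qe; norm_num

lemma half_mem : (1 / 2 : ℂ) ∈ Metric.ball (0 : ℂ) R0 := by
  simp only [Metric.mem_ball, dist_zero_right]
  unfold R0; norm_num

lemma an_half {f : ℂ → ℂ} (hf : DifferentiableOn ℂ f (Metric.ball 0 R0)) : AnalyticAt ℂ f (1 / 2) :=
  hf.analyticAt (Metric.isOpen_ball.mem_nhds half_mem)

lemma an_qe {f : ℂ → ℂ} (hf : DifferentiableOn ℂ f (Metric.ball 0 R0)) :
    AnalyticAt ℂ (fun e => f (qe e)) 0 := by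
  refine AnalyticAt.fun_comp ?_ (qe_an 0)
  rw [qe_zero]; exact an_half hf

lemma vF_half : vF (1 / 2) = 3 / 2 := by unfold vF; norm_num
lemma aF_half : aF (1 / 2) = 1 / 3 := by unfold aF; norm_num
lemma uF_half : uF (1 / 2) = 1 := by unfold uF; norm_num

lemma WW_an : AnalyticAt ℂ WW 0 := by
  have h1 := an_qe vF_diff
  have h2 := qe_an 0
  unfold WW
  fun_prop

lemma WW_zero : WW 0 = 1 := by
  unfold WW; rw [qe_zero, vF_half]; norm_num

lemma L2_an : AnalyticAt ℂ L2 0 := by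
  apply analyticAt_dslope
  exact WW_an.clog (by rw [WW_zero]; simp)

lemma L2_mul (e : ℂ) : e * L2 e = Complex.log (WW e) := by
  have := sub_smul_dslope (fun e : ℂ => Complex.log (WW e)) 0 e
  simpa [L2, WW_zero] using this

/-- the exponential factor -/
def eF (p : ℂ × ℂ) : ℂ := Complex.exp (-(p.2 * LL p.1))

lemma fst_an {f : ℂ → ℂ} (hf : AnalyticAt ℂ f 0) :
    AnalyticAt ℂ (fun p : ℂ × ℂ => f p.1) (0 : ℂ × ℂ) :=
  AnalyticAt.fun_comp (g := f) (f := fun p : ℂ × ℂ => p.1) (by simpa using hf) analyticAt_fst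

lemma eF_an : AnalyticAt ℂ eF 0 := by
  have hf1 : AnalyticAt ℂ (fun p : ℂ × ℂ => p.1) 0 := analyticAt_fst
  have hf2 : AnalyticAt ℂ (fun p : ℂ × ℂ => p.2) 0 := analyticAt_snd
  have h := fst_an LL_an
  exact (hf2.fun_mul h).fun_neg.cexp

lemma eF_zero : eF 0 = 1 := by simp [eF]

lemma exists_inv : ∃ Ψ : ℂ × ℂ → ℂ × ℂ, AnalyticAt ℂ Ψ 0 ∧ Ψ 0 = 0 ∧
    ∀ᶠ p in 𝓝 (0 : ℂ × ℂ), eF (Ψ p) • Ψ p = p := by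
  set Φ : ℂ × ℂ → ℂ × ℂ := fun p => eF p • p with hΦ
  have hΦan : AnalyticAt ℂ Φ 0 := eF_an.smul analyticAt_id
  have hd : HasStrictFDerivAt Φ (ContinuousLinearEquiv.refl ℂ (ℂ × ℂ) : (ℂ × ℂ) →L[ℂ] (ℂ × ℂ)) 0 := by
    have h := eF_an.hasStrictFDerivAt.smul (hasStrictFDerivAt_id (𝕜 := ℂ) (0 : ℂ × ℂ))
    have e : eF 0 • ContinuousLinearMap.id ℂ (ℂ × ℂ) + (fderiv ℂ eF 0).smulRight (id (0 : ℂ × ℂ)) =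
      (ContinuousLinearEquiv.refl ℂ (ℂ × ℂ) : (ℂ × ℂ) →L[ℂ] (ℂ × ℂ)) := by
      ext <;> simp [eF_zero]
    rw [← e]; exact h
  have hΦ0 : Φ 0 = 0 := by simp [hΦ]
  set H := hd.toOpenPartialHomeomorph Φ with hH
  have hcoe : (H : ℂ × ℂ → ℂ × ℂ) = Φ := hd.toOpenPartialHomeomorph_coe
  have hs : (0 : ℂ × ℂ) ∈ H.source := hd.mem_toOpenPartialHomeomorph_source
  have hH0 : H 0 = 0 := by rw [hcoe, hΦ0]
  refine ⟨H.symm, ?_, ?_, ?_⟩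
  · have := H.analyticAt_symm' (𝕜 := ℂ) (a := 0) (i := ContinuousLinearEquiv.refl ℂ (ℂ × ℂ)) hs
      (by rw [hcoe]; exact hΦan) (by rw [hcoe]; exact hd.hasFDerivAt.fderiv)
    rwa [hH0] at this
  · have := H.left_inv hs
    rwa [hH0] at this
  · have ht : H.target ∈ 𝓝 (0 : ℂ × ℂ) := by
      have := H.map_source hs
      rw [hH0] at this
      exact H.open_target.mem_nhds this
    filter_upwards [ht] with p hp
    have := H.right_inv hp
    rw [hcoe] at this
    exact this

/-- `t_n(q_n)` as a function of `ε` -/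
def GG (e : ℂ) : ℂ := qPI (aF (qe e)) (qe e) * qPI (qe e * (e / qe e ^ 2)) (qe e) /
  (qPI (aF (qe e) * (e / qe e ^ 2)) (qe e) * qPI (qe e) (qe e))

lemma qPI_an {X : ℂ → ℂ} (hX : AnalyticAt ℂ X 0) :
    AnalyticAt ℂ (fun e => qPI (X e) (qe e)) 0 := by
  have h1 : ∀ᶠ e in 𝓝 (0 : ℂ), AnalyticAt ℂ X e := hX.eventually_analyticAt
  have h2 : ∀ᶠ e in 𝓝 (0 : ℂ), ‖X e‖ < ‖X 0‖ + 1 :=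
    hX.continuousAt.norm.eventually_lt continuousAt_const (by simp)
  have h3 : ∀ᶠ e in 𝓝 (0 : ℂ), ‖qe e‖ < 3 / 4 := by
    refine (qe_an 0).continuousAt.norm.eventually_lt continuousAt_const ?_
    rw [qe_zero]; norm_num
  obtain ⟨r, hr, h⟩ := Metric.eventually_nhds_iff_ball.mp (h1.and (h2.and h3))
  have := qPI_differentiableOn (U := Metric.ball 0 r) Metric.isOpen_ball
    (X := X) (Q := qe) (C := ‖X 0‖ + 1) (ρ := 3 / 4)
    (fun z hz => (h z hz).1.differentiableAt.differentiableWithinAt)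
    (fun z _ => (qe_an z).differentiableAt.differentiableWithinAt)
    (fun z hz => (h z hz).2.1.le) (fun z hz => (h z hz).2.2.le) (by norm_num)
  exact this.analyticAt (Metric.ball_mem_nhds 0 hr)

lemma yq_an : AnalyticAt ℂ (fun e : ℂ => e / qe e ^ 2) 0 := by
  have h := qe_an 0
  have h2 : qe 0 ^ 2 ≠ 0 := by rw [qe_zero]; norm_num
  exact analyticAt_id.div (h.pow 2) h2

lemma qh_ne : qPI (1 / 2) (1 / 2) ≠ 0 :=
  qPI_ne_zero _ _ (by norm_num) (one_sub_qpow_ne _ (by norm_num))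

lemma GG_an : AnalyticAt ℂ GG 0 := by
  have h1 := qPI_an (an_qe aF_diff)
  have h2 := qPI_an ((qe_an 0).mul yq_an)
  have h3 := qPI_an ((an_qe aF_diff).mul yq_an)
  have h4 := qPI_an (qe_an 0)
  refine (h1.mul h2).div (h3.mul h4) ?_
  simp only [Pi.mul_apply, zero_div, mul_zero, qPI_zero, one_mul, qe_zero]
  exact qh_ne

lemma GG_zero : GG 0 = qPI (1 / 3) (1 / 2) / qPI (1 / 2) (1 / 2) := by
  unfold GG
  simp only [zero_div, mul_zero, qPI_zero, one_mul, mul_one, qe_zero, aF_half]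

def Rf (p : ℂ × ℂ) : ℂ :=
  16 * BB (qe p.1) * GG p.1 * Complex.exp ((p.2 - 2 * p.1) * L2 p.1 - 2 * (p.2 * LL p.1)) /
    (1 + p.1 - p.2)

lemma Rf_an : AnalyticAt ℂ Rf 0 := by
  have h1 := fst_an (an_qe BB_diff)
  have h2 := fst_an GG_an
  have h3 := fst_an L2_an
  have hf1 : AnalyticAt ℂ (fun p : ℂ × ℂ => p.1) 0 := analyticAt_fst
  have hf2 : AnalyticAt ℂ (fun p : ℂ × ℂ => p.2) 0 := analyticAt_snd
  have h4 := fst_an LL_an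
  have c2 : AnalyticAt ℂ (fun _ : ℂ × ℂ => (2:ℂ)) 0 := analyticAt_const
  have c1 : AnalyticAt ℂ (fun _ : ℂ × ℂ => (1:ℂ)) 0 := analyticAt_const
  have c16 : AnalyticAt ℂ (fun _ : ℂ × ℂ => (16:ℂ)) 0 := analyticAt_const
  exact (((c16.fun_mul h1).fun_mul h2).fun_mul (((hf2.fun_sub (c2.fun_mul hf1)).fun_mul h3).fun_sub
    (c2.fun_mul (hf2.fun_mul h4))).cexp).fun_div ((c1.fun_add hf1).fun_sub hf2) (by simp)

def Kf (p : ℂ × ℂ) : ℂ := LL p.1 * Complex.exp (p.2 * LL p.1) - 1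

lemma Kf_an : AnalyticAt ℂ Kf 0 := by
  have hf1 : AnalyticAt ℂ (fun p : ℂ × ℂ => p.1) 0 := analyticAt_fst
  have hf2 : AnalyticAt ℂ (fun p : ℂ × ℂ => p.2) 0 := analyticAt_snd
  have h4 := fst_an LL_an
  exact (h4.fun_mul (hf2.fun_mul h4).cexp).fun_sub analyticAt_const

lemma Kf_zero : Kf 0 = 0 := by simp [Kf, LL_zero]

/-- the (negative of the) product in `kappa0`. -/
def PiC : ℂ := qPI (1 / 3) (1 / 2) * qPI (3 / 2) (1 / 2) / qPI (1 / 2) (1 / 2) ^ 2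

lemma Rf_zero : Rf 0 = -PiC := by
  unfold Rf PiC
  simp only [Prod.fst_zero, Prod.snd_zero, qe_zero, GG_zero]
  unfold BB
  rw [vF_half, uF_half, qPI_split (3 / 2) (1 / 2) (by norm_num) 1]
  have : qPF (3 / 2) (1 / 2) 1 = -1 / 2 := by
    simp [qPF]; norm_num
  rw [this]
  have h := qh_ne
  norm_num at h ⊢
  field_simp
  ring


/-! ### Part 6: the roots theorem -/

/-- the small parameter point `(2^{-m}, m 2^{-m})` -/
def ppt (m : ℕ) : ℂ × ℂ := ((1 / 2 : ℂ) ^ m, (m : ℂ) * (1 / 2 : ℂ) ^ m)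

lemma ppt_tendsto : Tendsto ppt atTop (𝓝 0) := by
  have h1 : Tendsto (fun m : ℕ => (1 / 2 : ℂ) ^ m) atTop (𝓝 0) :=
    tendsto_pow_atTop_nhds_zero_of_norm_lt_one (by norm_num)
  have h2 : Tendsto (fun m : ℕ => (m : ℂ) * (1 / 2 : ℂ) ^ m) atTop (𝓝 0) := by
    have h3 : Tendsto (fun m : ℕ => (m : ℝ) * (1 / 2 : ℝ) ^ m) atTop (𝓝 0) :=
      tendsto_self_mul_const_pow_of_lt_one (by norm_num) (by norm_num)
    have h4 := (Complex.continuous_ofReal.tendsto 0).comp h3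
    simp only [Complex.ofReal_zero] at h4
    refine h4.congr (fun m => ?_)
    simp
  exact h1.prodMk_nhds h2

lemma root_alg {e t : ℂ} {m : ℕ} (h : eF (e, t) • (e, t) = ppt m) :
    t = m * e ∧ e * Complex.exp (-(t * LL e)) = (1 / 2 : ℂ) ^ m := by
  have h1 := congrArg Prod.fst h
  have h2 := congrArg Prod.snd h
  simp only [eF, ppt, Prod.smul_mk, smul_eq_mul] at h1 h2
  refine ⟨?_, by rw [mul_comm]; exact h1⟩
  have hne := Complex.exp_ne_zero (-(t * LL e))
  apply mul_left_cancel₀ hne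
  rw [h2, ← h1]; ring

lemma tF_eq_GG {e : ℂ} {n : ℕ} (hq : ‖qe e‖ < 1) (hqe : qe e ≠ 0) (hp : qe e ^ (n + 2) = e)
    (hn : qPI (aF (qe e) * (e / qe e ^ 2)) (qe e) ≠ 0) : tF (qe e) n = GG e := by
  have hy : e / qe e ^ 2 = qe e ^ n := by
    field_simp
    rw [← pow_add, add_comm 2 n, hp]
  unfold GG tF tG
  rw [hy] at hn ⊢
  have h1 := qPI_split (aF (qe e)) (qe e) hq n
  have h2 := qPI_split (qe e) (qe e) hq n
  have h3 : qPI (qe e) (qe e) ≠ 0 := qPI_ne_zero _ _ hq (one_sub_qpow_ne _ hq)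
  rw [h1, h2]
  rw [h2] at h3
  have h4 := left_ne_zero_of_mul h3
  have h5 := right_ne_zero_of_mul h3
  generalize qPI (aF (qe e) * qe e ^ n) (qe e) = A at *
  generalize qPI (qe e * qe e ^ n) (qe e) = B at *
  field_simp

lemma rho_alg {e t : ℂ} {n : ℕ} (h : eF (e, t) • (e, t) = ppt (n + 2)) (hq : ‖qe e‖ < 1)
    (hqe : qe e ≠ 0) (hn : qPI (aF (qe e) * (e / qe e ^ 2)) (qe e) ≠ 0) (hW : WW e ≠ 0)
    (a : ℕ → ℂ) (ha : a n = qe e) :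
    Dn n (a n) = 0 ∧ ∀ N : ℕ, rhoN a n * (2 * a n)⁻¹ ^ N =
      3 ^ n * Rf (e, t) * Complex.exp (-(N * (1 / 2 : ℂ) ^ (n + 2) * (1 + Kf (e, t)))) := by
  obtain ⟨h1, h2⟩ := root_alg h
  have h1e : 1 + e ≠ 0 := by
    intro h0; apply hqe; unfold qe; rw [h0]; simp
  have hexp : Complex.exp (e * LL e) = 1 + e := by
    rw [LL_mul, Complex.exp_log h1e]
  have hexp2 : Complex.exp (e * L2 e) = WW e := by
    rw [L2_mul, Complex.exp_log hW]
  have he2 : Complex.exp (t * LL e) = (1 + e) ^ (n + 2) := by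
    rw [← hexp, ← Complex.exp_nat_mul, h1]; push_cast; ring_nf
  have hne : Complex.exp (t * LL e) ≠ 0 := Complex.exp_ne_zero _
  have he3 : e = (1 / 2 : ℂ) ^ (n + 2) * Complex.exp (t * LL e) := by
    rw [← h2, Complex.exp_neg]; field_simp
  have hpow : qe e ^ (n + 2) = e := by
    conv_rhs => rw [he3, he2]
    rw [← mul_pow]; unfold qe; ring
  have hD : Dn n (a n) = 0 := by
    rw [ha]; unfold Dn; rw [hpow]; unfold qe; ring
  refine ⟨hD, fun N => ?_⟩
  have hx : ((1 / 2 : ℂ) ^ (n + 2)) ≠ 0 := pow_ne_zero _ (by norm_num)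
  have he0 : e ≠ 0 := by rw [he3]; exact mul_ne_zero hx hne
  have hN : (2 * a n)⁻¹ ^ N =
      Complex.exp (-(N * (1 / 2 : ℂ) ^ (n + 2) * (1 + Kf (e, t)))) := by
    have : 2 * a n = Complex.exp (e * LL e) := by rw [hexp, ha]; unfold qe; ring
    rw [this, ← Complex.exp_neg, ← Complex.exp_nat_mul]
    congr 1
    unfold Kf
    simp only
    nth_rewrite 1 [he3]
    ring
  rw [hN]
  congr 1
  have hden : (2 - ((n : ℂ) + 2) * qe e ^ (n + 1)) * qe e = 1 + e - t := by
    have : (2 - ((n : ℂ) + 2) * qe e ^ (n + 1)) * qe e = 2 * qe e - (n + 2) * qe e ^ (n + 2) := by ring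
    rw [this, hpow, h1]; unfold qe; push_cast; ring
  have hr1 : rhoN a n = hF n (qe e) / ((1 + e - t) * e ^ 2) := by
    unfold rhoN
    rw [ha, ← hden, show 1 - 2 * qe e = -e by unfold qe; ring]
    simp only [div_eq_mul_inv, mul_inv]
    rw [neg_sq]; ring
  have hva : (vF (qe e) * qe e) ^ n = (3 / 4 : ℂ) ^ n * Complex.exp ((t - 2 * e) * L2 e) := by
    have h3 : (t - 2 * e) * L2 e = (n : ℂ) * (e * L2 e) := by rw [h1]; push_cast; ring
    rw [h3, Complex.exp_nat_mul, hexp2, ← mul_pow]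
    congr 1; unfold WW; ring
  have he4 : (e ^ 2)⁻¹ = 16 * 4 ^ n * Complex.exp (-(2 * (t * LL e))) := by
    rw [Complex.exp_neg, show 2 * (t * LL e) = ((2 : ℕ) : ℂ) * (t * LL e) by push_cast; ring, Complex.exp_nat_mul]
    rw [he3, mul_pow, mul_inv]
    rw [← he3]
    congr 1
    rw [← pow_mul, one_div, inv_pow, inv_inv, mul_comm (n + 2) 2, pow_mul, pow_add]
    norm_num
    ring
  rw [hr1]
  unfold hF
  rw [hva, tF_eq_GG hq hqe hpow hn, div_eq_mul_inv, mul_inv, he4]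
  unfold Rf
  simp only
  rw [sub_eq_add_neg ((t - 2 * e) * L2 e), Complex.exp_add, div_eq_mul_inv _ (1 + e - t), div_pow]
  have h4 : (4 : ℂ) ^ n ≠ 0 := pow_ne_zero _ (by norm_num)
  generalize (1 + e - t)⁻¹ = A
  field_simp

theorem roots : ∃ Rt Kt : ℂ × ℂ → ℂ, AnalyticAt ℂ Rt 0 ∧ AnalyticAt ℂ Kt 0 ∧ Kt 0 = 0 ∧
    Rt 0 = -PiC ∧ ∃ (n1 : ℕ) (a : ℕ → ℂ), (∀ n, n1 ≤ n → Dn n (a n) = 0) ∧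
    (∀ n, n1 ≤ n → ‖a n‖ ≤ 11 / 20) ∧ (∀ n : ℕ, n1 ≤ n → ((n : ℝ) + 2) * R1 ^ (n + 1) ≤ 1) ∧
    ∀ n, n1 ≤ n → ∀ N : ℕ, rhoN a n * (2 * a n)⁻¹ ^ N =
      3 ^ n * Rt (ppt (n + 2)) *
        Complex.exp (-(N * (1 / 2 : ℂ) ^ (n + 2) * (1 + Kt (ppt (n + 2))))) := by
  obtain ⟨Ψ, hΨ, hΨ0, hΨe⟩ := exists_inv
  have hR : AnalyticAt ℂ Rf (Ψ 0) := by rw [hΨ0]; exact Rf_an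
  have hK : AnalyticAt ℂ Kf (Ψ 0) := by rw [hΨ0]; exact Kf_an
  refine ⟨fun p => Rf (Ψ p), fun p => Kf (Ψ p), hR.fun_comp hΨ, hK.fun_comp hΨ,
    by simp only [hΨ0, Kf_zero], by simp only [hΨ0, Rf_zero], ?_⟩
  have hpp : Tendsto (fun n : ℕ => ppt (n + 2)) atTop (𝓝 0) :=
    ppt_tendsto.comp (tendsto_add_atTop_nat 2)
  have hΨt : Tendsto (fun n : ℕ => (Ψ (ppt (n + 2))).1) atTop (𝓝 0) := by
    have h1 : Tendsto Ψ (𝓝 0) (𝓝 0) := by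
      have := hΨ.continuousAt.tendsto; rwa [hΨ0] at this
    have h2 : Tendsto (Prod.fst : ℂ × ℂ → ℂ) (𝓝 0) (𝓝 0) := continuous_fst.tendsto 0
    exact h2.comp (h1.comp hpp)
  have e1 := hpp.eventually hΨe
  have e2 : ∀ᶠ e in 𝓝 (0 : ℂ), ‖qe e‖ < 11 / 20 := by
    refine (qe_an 0).continuousAt.norm.eventually_lt continuousAt_const ?_
    rw [qe_zero]; norm_num
  have e3 : ∀ᶠ e in 𝓝 (0 : ℂ), qe e ≠ 0 :=
    (qe_an 0).continuousAt.eventually_ne (by rw [qe_zero]; norm_num)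
  have e4 : ∀ᶠ e in 𝓝 (0 : ℂ), WW e ≠ 0 :=
    WW_an.continuousAt.eventually_ne (by rw [WW_zero]; norm_num)
  have e5 : ∀ᶠ e in 𝓝 (0 : ℂ), qPI (aF (qe e) * (e / qe e ^ 2)) (qe e) ≠ 0 := by
    refine (qPI_an ((an_qe aF_diff).mul yq_an)).continuousAt.eventually_ne ?_
    simp [qPI_zero]
  have e6 : ∀ᶠ n : ℕ in atTop, ((n : ℝ) + 2) * R1 ^ (n + 1) ≤ 1 := by
    have h1 : Tendsto (fun n : ℕ => ((n : ℝ)) * R1 ^ n) atTop (𝓝 0) :=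
      tendsto_self_mul_const_pow_of_lt_one (by unfold R1; norm_num) (by unfold R1; norm_num)
    have h2 := (h1.comp (tendsto_add_atTop_nat 2)).eventually (gt_mem_nhds (show (0:ℝ) < R1 by unfold R1; norm_num))
    filter_upwards [h2] with n hn
    simp only [Function.comp_apply] at hn
    push_cast at hn
    have hR : (0 : ℝ) < R1 := by unfold R1; norm_num
    rw [show R1 ^ (n + 2) = R1 ^ (n + 1) * R1 by ring, ← mul_assoc] at hn
    nlinarith
  obtain ⟨n1, hn1⟩ := eventually_atTop.mp (e1.and ((hΨt.eventually (e2.and (e3.and (e4.and e5)))).and e6))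
  refine ⟨n1, fun n => qe (Ψ (ppt (n + 2))).1, fun n hn => ?_, fun n hn => ?_, fun n hn => ?_, fun n hn => ?_⟩
  · obtain ⟨g1, ⟨g2, g3, g4, g5⟩, g6⟩ := hn1 n hn
    exact (rho_alg g1 (by linarith) g3 g5 g4 (fun n => qe (Ψ (ppt (n + 2))).1) rfl).1
  · exact (hn1 n hn).2.1.1.le
  · exact (hn1 n hn).2.2
  · obtain ⟨g1, ⟨g2, g3, g4, g5⟩, g6⟩ := hn1 n hn
    exact (rho_alg g1 (by linarith) g3 g5 g4 (fun n => qe (Ψ (ppt (n + 2))).1) rfl).2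


/-! ### Part 7: regularised constants -/

/-- `s M = c + (combination of 3^M, (3/2)^M, M (3/2)^M) + o(1)` -/
def Adm (c : ℂ) (s : ℕ → ℂ) : Prop := ∃ p0 p1 p2 : ℂ,
  Tendsto (fun M : ℕ => s M - (p0 * 3 ^ M + (p1 + p2 * M) * (3 / 2) ^ M)) atTop (𝓝 c)

lemma Adm.add {c d : ℂ} {s t : ℕ → ℂ} (h1 : Adm c s) (h2 : Adm d t) :
    Adm (c + d) (fun M => s M + t M) := by
  obtain ⟨a0, a1, a2, h1⟩ := h1
  obtain ⟨b0, b1, b2, h2⟩ := h2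
  refine ⟨a0 + b0, a1 + b1, a2 + b2, (h1.add h2).congr (fun M => ?_)⟩
  ring

lemma Adm.const_mul {c : ℂ} {s : ℕ → ℂ} (h : Adm c s) (k : ℂ) : Adm (k * c) (fun M => k * s M) := by
  obtain ⟨a0, a1, a2, h1⟩ := h
  refine ⟨k * a0, k * a1, k * a2, (h1.const_mul k).congr (fun M => ?_)⟩
  ring

lemma Adm.of_tendsto {c : ℂ} {s : ℕ → ℂ} (h : Tendsto s atTop (𝓝 c)) : Adm c s :=
  ⟨0, 0, 0, h.congr (fun M => by ring)⟩

lemma Adm.of_eq (p0 p1 p2 : ℂ) :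
    Adm 0 (fun M : ℕ => p0 * 3 ^ M + (p1 + p2 * M) * (3 / 2) ^ M) :=
  ⟨p0, p1, p2, tendsto_const_nhds.congr (fun M => by ring)⟩

lemma Adm.congr {c : ℂ} {s t : ℕ → ℂ} (h : Adm c s) (e : ∀ M, s M = t M) : Adm c t := by
  have : s = t := funext e
  rwa [← this]

lemma Adm.limit {c L : ℂ} {s : ℕ → ℂ} (h : Adm c s) (hs : Tendsto s atTop (𝓝 L)) : L = c := by
  obtain ⟨p0, p1, p2, h⟩ := h
  have h1 : Tendsto (fun M : ℕ => p0 * 3 ^ M + (p1 + p2 * M) * (3 / 2) ^ M) atTop (𝓝 (L - c)) :=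
    (hs.sub h).congr (fun M => by ring)
  have z1 : Tendsto (fun M : ℕ => (1 / 3 : ℂ) ^ M) atTop (𝓝 0) :=
    tendsto_pow_atTop_nhds_zero_of_norm_lt_one (by norm_num)
  have z2 : Tendsto (fun M : ℕ => (1 / 2 : ℂ) ^ M) atTop (𝓝 0) :=
    tendsto_pow_atTop_nhds_zero_of_norm_lt_one (by norm_num)
  have z2' : Tendsto (fun M : ℕ => (M : ℂ) * (1 / 2 : ℂ) ^ M) atTop (𝓝 0) :=
    (continuous_snd.tendsto _).comp ppt_tendsto
  have z3 : Tendsto (fun M : ℕ => (2 / 3 : ℂ) ^ M) atTop (𝓝 0) :=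
    tendsto_pow_atTop_nhds_zero_of_norm_lt_one (by norm_num)
  have hp0 : p0 = 0 := by
    have e1 := h1.mul z1
    have e2 : Tendsto (fun M : ℕ => p0 + p1 * (1 / 2 : ℂ) ^ M + p2 * ((M : ℂ) * (1 / 2 : ℂ) ^ M)) atTop
        (𝓝 (p0 + p1 * 0 + p2 * 0)) :=
      (tendsto_const_nhds.add (z2.const_mul p1)).add (z2'.const_mul p2)
    have e3 := tendsto_nhds_unique (e1.congr (fun M => ?_)) e2
    · simpa using e3.symm
    · have a1 : (3 : ℂ) ^ M * (1 / 3) ^ M = 1 := by rw [← mul_pow]; norm_num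
      have a2 : (3 / 2 : ℂ) ^ M * (1 / 3) ^ M = (1 / 2) ^ M := by rw [← mul_pow]; norm_num
      linear_combination p0 * a1 + (p1 + p2 * M) * a2
  subst hp0
  have h2 : Tendsto (fun M : ℕ => p1 + p2 * M) atTop (𝓝 0) := by
    have e1 := h1.mul z3
    rw [mul_zero] at e1
    refine e1.congr (fun M => ?_)
    have a2 : (3 / 2 : ℂ) ^ M * (2 / 3) ^ M = 1 := by rw [← mul_pow]; norm_num
    linear_combination (p1 + p2 * M) * a2
  have hp2 : p2 = 0 := by
    have e1 := (h2.comp (tendsto_add_atTop_nat 1)).sub h2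
    have e3 := tendsto_nhds_unique (e1.congr (fun M => ?_)) (tendsto_const_nhds (x := p2))
    · simpa using e3.symm
    · simp only [Function.comp_apply]; push_cast; ring
  subst hp2
  have hp1 : p1 = 0 := by
    have := tendsto_nhds_unique (h2.congr (fun M => ?_)) (tendsto_const_nhds (x := p1))
    · exact this.symm
    · ring
  subst hp1
  have := tendsto_nhds_unique (h1.congr (fun M => ?_)) (tendsto_const_nhds (x := (0 : ℂ)))
  · exact sub_eq_zero.mp this
  · ring

lemma tF_sub {q : ℂ} (hq : ‖q‖ < R0) (n : ℕ) :
    tF q (n + 1) - tF q n = tF q n * q ^ n * (q - aF q) / (1 - q ^ (n + 1)) := by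
  have h := tG_succ (aF q) q (hq.trans R0_lt) n
  have h2 : 1 - q ^ (n + 1) ≠ 0 := by
    have := one_sub_qpow_ne q (hq.trans R0_lt) n
    rwa [pow_succ']
  unfold tF
  rw [eq_div_iff h2]
  linear_combination h

lemma one_sub_pow_ge {q : ℂ} (hq : ‖q‖ < R0) (n : ℕ) : 11 / 25 ≤ ‖1 - q ^ (n + 1)‖ := by
  refine one_sub_ge (q := q ^ (n + 1)) ?_
  rw [norm_pow]
  refine lt_of_le_of_lt ?_ hq
  exact pow_le_of_le_one (norm_nonneg _) (hq.trans R0_lt).le (by omega)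

lemma tF_sub_bound : ∃ C : ℝ, 0 < C ∧ ∀ q : ℂ, ‖q‖ < R0 → ∀ n,
    ‖tF q (n + 1) - tF q n‖ ≤ C * ‖q‖ ^ n := by
  obtain ⟨C, hC, h⟩ := tF_bound
  refine ⟨C * 10, by positivity, fun q hq n => ?_⟩
  rw [tF_sub hq n, norm_div, div_le_iff₀ (by linarith [one_sub_pow_ge hq n]), norm_mul, norm_mul, norm_pow]
  have h1 : ‖q - aF q‖ ≤ 4 := by
    have := norm_sub_le q (aF q)
    have h3 := aF_le hq
    have := R0_lt
    linarith
  have h2 := one_sub_pow_ge hq n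
  have h3 := h q hq n
  have h4 : ‖tF q n‖ * ‖q‖ ^ n * ‖q - aF q‖ ≤ C * ‖q‖ ^ n * 4 := by gcongr
  have h5 : C * 10 * ‖q‖ ^ n * (11 / 25) ≤ C * 10 * ‖q‖ ^ n * ‖1 - q ^ (n + 1)‖ := by gcongr
  have h6 : 0 ≤ C * ‖q‖ ^ n := by positivity
  linarith

/-- the limit of `t_n` -/
def TT (q : ℂ) : ℂ := tF q 0 + ∑' n, (tF q (n + 1) - tF q n)

lemma TT_diff : DifferentiableOn ℂ TT (Metric.ball 0 R0) := by
  obtain ⟨C, hC, h⟩ := tF_sub_bound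
  refine (tF_diff 0).add ?_
  refine differentiableOn_tsum_of_summable_norm (u := fun n => C * R0 ^ n) ?_ (fun n => ?_)
    Metric.isOpen_ball (fun n q hq => ?_)
  · exact (summable_geometric_of_lt_one (by unfold R0; norm_num) R0_lt).mul_left C
  · exact (tF_diff (n + 1)).sub (tF_diff n)
  · have hq' := mem_ball_zero_iff.mp hq
    refine (h q hq' n).trans ?_
    gcongr

lemma TT_tendsto {q : ℂ} (hq : ‖q‖ < R0) : Tendsto (fun n => tF q n) atTop (𝓝 (TT q)) := by
  obtain ⟨C, hC, h⟩ := tF_sub_bound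
  have hs : Summable (fun n => tF q (n + 1) - tF q n) := by
    apply Summable.of_norm
    refine Summable.of_nonneg_of_le (fun _ => norm_nonneg _) (h q hq)
      ((summable_geometric_of_lt_one (norm_nonneg q) (hq.trans R0_lt)).mul_left C)
  have h1 := hs.hasSum.tendsto_sum_nat
  have h2 := h1.const_add (tF q 0)
  refine h2.congr (fun M => ?_)
  rw [Finset.sum_range_sub]; ring

lemma TT_bound : ∃ C : ℝ, 0 < C ∧ ∀ q : ℂ, ‖q‖ < R0 → ∀ n, ‖tF q n - TT q‖ ≤ C * ‖q‖ ^ n := by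
  obtain ⟨C, hC, h⟩ := tF_sub_bound
  refine ⟨C * 10, by positivity, fun q hq n => ?_⟩
  have := dist_le_of_le_geometric_of_tendsto ‖q‖ C (hq.trans R0_lt) (f := fun n => tF q n)
    (fun n => by rw [dist_eq_norm, norm_sub_rev]; exact h q hq n) (TT_tendsto hq) n
  rw [dist_eq_norm] at this
  refine this.trans ?_
  have hq2 : ‖q‖ < 14 / 25 := hq
  rw [div_le_iff₀ (by linarith)]
  have h6 : 0 ≤ C * ‖q‖ ^ n := by positivity
  nlinarith

/-- second order expansion of `t_n(1/2)` -/
lemma tF_half : ∃ c C : ℂ, ∃ K : ℝ, ∀ n : ℕ, ‖tF (1 / 2) n - C - c * (1 / 2) ^ n‖ ≤ K * (1 / 4) ^ n := by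
  have hh : ‖(1 / 2 : ℂ)‖ < R0 := mem_ball_zero_iff.mp half_mem
  obtain ⟨C, hC, h⟩ := TT_bound
  obtain ⟨C1, hC1, hb⟩ := tF_bound
  have hq := h _ hh
  have hb' := hb _ hh
  have ht := TT_tendsto hh
  set T := TT (1 / 2) with hT
  have z2 : Tendsto (fun M : ℕ => (1 / 2 : ℂ) ^ M) atTop (𝓝 0) :=
    tendsto_pow_atTop_nhds_zero_of_norm_lt_one (by norm_num)
  have hlim : Tendsto (fun n : ℕ => tF (1 / 2) n - T - (-(T / 3)) * (1 / 2) ^ n) atTop (𝓝 0) := by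
    have := (ht.sub_const T).sub (z2.const_mul (-(T / 3)))
    simpa using this
  refine ⟨-(T / 3), T, (C + C1) / (1 - 1 / 4), fun n => ?_⟩
  have := dist_le_of_le_geometric_of_tendsto (1 / 4 : ℝ) (C + C1) (by norm_num)
    (f := fun n : ℕ => tF (1 / 2) n - T - (-(T / 3)) * (1 / 2) ^ n) ?_ hlim n
  · rw [dist_zero_right] at this
    refine this.trans (le_of_eq (by ring))
  · intro n
    rw [dist_eq_norm, norm_sub_rev]
    have hs := tF_sub hh n
    have hne : (1 : ℂ) - (1 / 2) ^ (n + 1) ≠ 0 := by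
      have := one_sub_pow_ge hh n
      rw [← norm_pos_iff]; linarith
    have e1 : (tF (1 / 2) (n + 1) - T - (-(T / 3)) * (1 / 2) ^ (n + 1)) -
        (tF (1 / 2) n - T - (-(T / 3)) * (1 / 2) ^ n) =
        (1 / 6) * (1 / 2) ^ n * (tF (1 / 2) n - T) +
        (1 / 12) * tF (1 / 2) n * (1 / 4) ^ n / (1 - (1 / 2) ^ (n + 1)) := by
      have hs' : tF (1 / 2) (n + 1) = tF (1 / 2) n +
        tF (1 / 2) n * (1 / 2) ^ n * (1 / 2 - aF (1 / 2)) / (1 - (1 / 2) ^ (n + 1)) := by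
        rw [← hs]; ring
      rw [hs', aF_half, show (1 / 4 : ℂ) ^ n = (1 / 2) ^ n * (1 / 2) ^ n by rw [← mul_pow]; norm_num]
      rw [pow_succ] at hne ⊢
      generalize (1 / 2 : ℂ) ^ n = y at *
      have hne2 : 2 - y ≠ 0 := by
        intro h0; apply hne; linear_combination h0 / 2
      field_simp
      ring
    rw [e1]
    refine (norm_add_le _ _).trans ?_
    have n1 : ‖(1 / 2 : ℂ)‖ = 1 / 2 := by norm_num
    have n2 : ‖(1 / 4 : ℂ)‖ = 1 / 4 := by norm_num
    have n3 : ‖(1 / 6 : ℂ)‖ = 1 / 6 := by norm_num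
    have n4 : ‖(1 / 12 : ℂ)‖ = 1 / 12 := by norm_num
    rw [norm_div, norm_mul, norm_mul, norm_mul, norm_mul, norm_pow, norm_pow, n1, n2, n3, n4]
    have a1 := hq n
    rw [n1] at a1
    have a2 := hb' n
    have a3 := one_sub_pow_ge hh n
    have b1 : (1 / 6 : ℝ) * (1 / 2) ^ n * ‖tF (1 / 2) n - T‖ ≤ 1 * (1 / 2) ^ n * (C * (1 / 2) ^ n) := by
      gcongr; norm_num
    have b2 : (1 / 12 : ℝ) * ‖tF (1 / 2) n‖ * (1 / 4) ^ n / ‖1 - (1 / 2 : ℂ) ^ (n + 1)‖ ≤ C1 * (1 / 4) ^ n := by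
      rw [div_le_iff₀ (by linarith)]
      have c1 : (1 / 12 : ℝ) * ‖tF (1 / 2) n‖ * (1 / 4) ^ n ≤ (1 / 12 : ℝ) * C1 * (1 / 4) ^ n := by gcongr
      have c2 : C1 * (1 / 4) ^ n * (11 / 25) ≤ C1 * (1 / 4) ^ n * ‖1 - (1 / 2 : ℂ) ^ (n + 1)‖ := by gcongr
      have : 0 ≤ C1 * (1 / 4 : ℝ) ^ n := by positivity
      linarith
    have b3 : (1 / 2 : ℝ) ^ n * (1 / 2) ^ n = (1 / 4) ^ n := by rw [← mul_pow]; norm_num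
    nlinarith


/-! ### Part 8: regularised constants, continued -/

def kS (n : ℕ) (q : ℂ) : ℂ := BB q * tF q n * vF q ^ n / q ^ 2
def SM (M : ℕ) (q : ℂ) : ℂ := Ct q + ∑ n ∈ Finset.range M, kS n q
def Sinf (q : ℂ) : ℂ := 2 * q * (2 - 3 * q) * (1 - 2 * q) / (1 - q)
def GV (q : ℂ) : ℂ := BB q * (1 - q) / q ^ 4 * TT q
def errM (M : ℕ) (q : ℂ) : ℂ := SM M q - Sinf q - GV q * vF q ^ M

lemma U_sub : Metric.ball (1 / 2 : ℂ) (1 / 20) ⊆ Metric.ball 0 R0 := by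
  refine Metric.ball_subset_ball' ?_
  rw [dist_zero_right]; unfold R0; norm_num

lemma U_ge {q : ℂ} (hq : q ∈ Metric.ball (1 / 2 : ℂ) (1 / 20)) : 9 / 20 ≤ ‖q‖ := by
  rw [Metric.mem_ball, dist_eq_norm] at hq
  have := norm_sub_norm_le (1 / 2 : ℂ) q
  rw [norm_sub_rev, show ‖(1 / 2 : ℂ)‖ = 1 / 2 by norm_num] at this
  linarith

lemma tail_bound : ∃ C : ℝ, 0 < C ∧ ∀ q : ℂ, ‖q‖ < R0 → ∀ M : ℕ,
    ‖(∑ n ∈ Finset.range M, tF q n * (vF q * q) ^ n) -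
      qPI (aF q * (vF q * q)) q / qPI (vF q * q) q‖ ≤ C * (24 / 25) ^ M := by
  obtain ⟨C, hC, h⟩ := tF_bound
  refine ⟨C * 25, by positivity, fun q hq M => ?_⟩
  have hvq := vq_le hq
  have hs := tG_summable (aF q) q (vF q * q) (hq.trans R0_lt) (by linarith)
  have ht := hs.hasSum.tendsto_sum_nat
  rw [qbinom _ _ _ (hq.trans R0_lt) (by linarith)] at ht
  have := dist_le_of_le_geometric_of_tendsto (24 / 25 : ℝ) C (by norm_num)
    (f := fun M => ∑ n ∈ Finset.range M, tF q n * (vF q * q) ^ n) (fun n => ?_) ht M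
  · rw [dist_eq_norm] at this
    refine this.trans (le_of_eq ?_)
    ring
  · rw [dist_eq_norm, Finset.sum_range_succ, norm_sub_rev, add_sub_cancel_left, norm_mul, norm_pow]
    have := h q hq n
    gcongr

lemma errM_eq {q : ℂ} (hq : ‖q‖ < R0) (hq0 : q ≠ 0) (M : ℕ) :
    errM M q = -(BB q * (1 - q - q ^ 2) / q ^ 4) *
      ((∑ n ∈ Finset.range M, tF q n * (vF q * q) ^ n) -
      qPI (aF q * (vF q * q)) q / qPI (vF q * q) q) +
      BB q * (1 - q) / q ^ 4 * (vF q ^ M * (tF q M * (1 - q ^ M) - TT q)) := by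
  have h1 := fM_func (aF q) q (vF q) (hq.trans R0_lt) M
  have h0 := one_sub_ne hq
  have e1 : 1 - vF q = -(q ^ 2 / (1 - q)) := by unfold vF; field_simp; ring
  have e2 : 1 - aF q * vF q = (1 - q - q ^ 2) / (1 - q) := by
    rw [av_eq hq]; unfold uF; field_simp
  have e3 : BB q * (1 - q - q ^ 2) * (qPI (aF q * (vF q * q)) q / qPI (vF q * q) q) =
      2 * q ^ 5 * (1 - q) ^ 2 := by
    have hU : qPI (uF q * q) q ≠ 0 := qPI_ne_zero _ _ (hq.trans R0_lt) (uq_ne hq)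
    have hV : qPI (vF q * q) q ≠ 0 := qPI_ne_zero _ _ (hq.trans R0_lt) (vq_ne hq)
    have hsp := qPI_split (uF q * q) q (hq.trans R0_lt) 1
    have : qPF (uF q * q) q 1 = (1 - q - q ^ 2) / (1 - q) := by
      rw [← e2, av_eq hq]; simp [qPF]
    rw [this, pow_one] at hsp
    rw [← mul_assoc, av_eq hq]
    unfold BB
    have h5 : qPI (uF q * q * q) q * (1 - q - q ^ 2) = qPI (uF q * q) q * (1 - q) := by
      rw [hsp]; field_simp
    generalize qPI (uF q * q * q) q = A at *
    generalize qPI (uF q * q) q = B at *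
    generalize qPI (vF q * q) q = D at *
    field_simp
    linear_combination h5
  have e4 : ∑ n ∈ Finset.range M, kS n q = BB q / q ^ 2 * ∑ n ∈ Finset.range M, tG (aF q) q n * vF q ^ n := by
    rw [Finset.mul_sum]; refine Finset.sum_congr rfl (fun n _ => ?_)
    unfold kS tF; ring
  rw [e1, e2, mul_comm q (vF q)] at h1
  unfold errM SM
  rw [e4]
  change _ = -(BB q * (1 - q - q ^ 2) / q ^ 4) *
      ((∑ n ∈ Finset.range M, tG (aF q) q n * (vF q * q) ^ n) - _) + BB q * (1 - q) / q ^ 4 * (vF q ^ M * (tG (aF q) q M * (1 - q ^ M) - TT q))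
  unfold GV Ct Sinf
  generalize ∑ n ∈ Finset.range M, tG (aF q) q n * vF q ^ n = F1 at *
  generalize ∑ n ∈ Finset.range M, tG (aF q) q n * (vF q * q) ^ n = F2 at *
  generalize qPI (aF q * (vF q * q)) q / qPI (vF q * q) q = P at *
  generalize vF q ^ M = vM at *
  generalize tG (aF q) q M = tM at *
  have h2 : q ^ 2 * F1 = -((1 - q - q ^ 2) * F2) + (1 - q) * (vM * tM * (1 - q ^ M)) := by
    field_simp at h1
    linear_combination -h1
  have h3 : F1 = (-((1 - q - q ^ 2) * F2) + (1 - q) * (vM * tM * (1 - q ^ M))) / q ^ 2 := by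
    rw [eq_div_iff (pow_ne_zero 2 hq0), ← h2]; ring
  rw [h3]
  field_simp
  linear_combination (-(1-q)) * e3

lemma errM_bound : ∃ C : ℝ, 0 < C ∧ ∀ q ∈ Metric.ball (1 / 2 : ℂ) (1 / 20), ∀ M : ℕ,
    ‖errM M q‖ ≤ C * (24 / 25) ^ M := by
  obtain ⟨C1, hC1, h1⟩ := tail_bound
  obtain ⟨C2, hC2, h2⟩ := TT_bound
  obtain ⟨C3, hC3, h3⟩ := tF_bound
  obtain ⟨C4, hC4, h4⟩ := bdd_of_diff BB_diff
  refine ⟨C4 * 75 * C1 + C4 * 75 * (C2 + C3), by positivity, fun q hqU M => ?_⟩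
  have hq : ‖q‖ < R0 := mem_ball_zero_iff.mp (U_sub hqU)
  have hge := U_ge hqU
  have hq0 : q ≠ 0 := by rw [← norm_pos_iff]; linarith
  have hqR1 : ‖q‖ ≤ R1 := by
    rw [Metric.mem_ball, dist_eq_norm] at hqU
    have := norm_sub_norm_le q (1 / 2 : ℂ)
    rw [show ‖(1 / 2 : ℂ)‖ = 1 / 2 by norm_num] at this
    unfold R1; linarith
  rw [errM_eq hq hq0 M]
  have hB := h4 q hqR1
  have hR : ‖q‖ ≤ 1 := by unfold R1 at hqR1; linarith
  have a1 : ‖1 - q - q ^ 2‖ ≤ 3 := by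
    refine (norm_sub_le _ _).trans ?_
    have := norm_sub_le 1 q
    rw [norm_one] at this
    rw [norm_pow]
    have : ‖q‖ ^ 2 ≤ 1 := pow_le_one₀ (norm_nonneg _) hR
    linarith
  have a2 : ‖1 - q‖ ≤ 3 := by
    have := norm_sub_le 1 q
    rw [norm_one] at this
    linarith
  have a3 : 1 / 25 ≤ ‖q ^ 4‖ := by
    rw [norm_pow]
    calc (1 / 25 : ℝ) ≤ (9 / 20) ^ 4 := by norm_num
      _ ≤ ‖q‖ ^ 4 := by gcongr
  have a4 : ∀ X : ℂ, ‖X‖ ≤ 3 → ‖BB q * X / q ^ 4‖ ≤ C4 * 75 := by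
    intro X hX
    rw [norm_div, norm_mul, div_le_iff₀ (by linarith)]
    calc ‖BB q‖ * ‖X‖ ≤ C4 * 3 := by gcongr
      _ = C4 * 75 * (1 / 25) := by ring
      _ ≤ _ := by gcongr
  refine (norm_add_le _ _).trans ?_
  rw [add_mul]
  refine add_le_add ?_ ?_
  · rw [norm_mul, norm_neg, mul_assoc (C4 * 75)]
    exact mul_le_mul (a4 _ a1) (h1 q hq M) (norm_nonneg _) (by positivity)
  · rw [norm_mul, mul_assoc (C4 * 75)]
    refine mul_le_mul (a4 _ a2) ?_ (norm_nonneg _) (by positivity)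
    have e : tF q M * (1 - q ^ M) - TT q = (tF q M - TT q) - tF q M * q ^ M := by ring
    have : ‖tF q M * (1 - q ^ M) - TT q‖ ≤ (C2 + C3) * ‖q‖ ^ M := by
      rw [e, add_mul]
      refine (norm_sub_le _ _).trans (add_le_add (h2 q hq M) ?_)
      rw [norm_mul, norm_pow]
      have := h3 q hq M
      gcongr
    rw [norm_mul, norm_pow]
    calc ‖vF q‖ ^ M * ‖tF q M * (1 - q ^ M) - TT q‖ ≤ ‖vF q‖ ^ M * ((C2 + C3) * ‖q‖ ^ M) := by gcongr
      _ = (C2 + C3) * ‖vF q * q‖ ^ M := by rw [norm_mul, mul_pow]; ring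
      _ ≤ _ := by have := vq_le hq; gcongr

lemma kS_diff (n : ℕ) : DifferentiableOn ℂ (kS n) (Metric.ball (1 / 2 : ℂ) (1 / 20)) := by
  have h1 := BB_diff.mono U_sub
  have h2 := (tF_diff n).mono U_sub
  have h3 := vF_diff.mono U_sub
  refine DifferentiableOn.div ((h1.mul h2).mul (h3.pow n)) (by fun_prop) (fun q hq => ?_)
  have := U_ge hq
  exact pow_ne_zero _ (by rw [← norm_pos_iff]; linarith)

lemma SM_diff (M : ℕ) : DifferentiableOn ℂ (SM M) (Metric.ball (1 / 2 : ℂ) (1 / 20)) := by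
  refine (Ct_diff.mono U_sub).add (DifferentiableOn.fun_sum (fun n _ => kS_diff n))

lemma GV_diff : DifferentiableOn ℂ GV (Metric.ball (1 / 2 : ℂ) (1 / 20)) := by
  have h1 := BB_diff.mono U_sub
  have h2 := TT_diff.mono U_sub
  refine DifferentiableOn.mul (DifferentiableOn.div (h1.mul (by fun_prop)) (by fun_prop) (fun q hq => ?_)) h2
  have := U_ge hq
  exact pow_ne_zero _ (by rw [← norm_pos_iff]; linarith)

lemma Sinf_diff : DifferentiableOn ℂ Sinf (Metric.ball (1 / 2 : ℂ) (1 / 20)) := by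
  refine DifferentiableOn.div (by fun_prop) (by fun_prop) (fun q hq => ?_)
  exact one_sub_ne (mem_ball_zero_iff.mp (U_sub hq))

lemma errM_diff (M : ℕ) : DifferentiableOn ℂ (errM M) (Metric.ball (1 / 2 : ℂ) (1 / 20)) :=
  ((SM_diff M).sub Sinf_diff).sub (GV_diff.mul ((vF_diff.mono U_sub).pow M))

lemma U_nhds : Metric.ball (1 / 2 : ℂ) (1 / 20) ∈ 𝓝 (1 / 2 : ℂ) := Metric.ball_mem_nhds _ (by norm_num)

lemma pow2425 : Tendsto (fun M : ℕ => ((24 / 25 : ℝ)) ^ M) atTop (𝓝 0) :=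
  tendsto_pow_atTop_nhds_zero_of_lt_one (by norm_num) (by norm_num)

lemma errM_tendsto : Tendsto (fun M => errM M (1 / 2)) atTop (𝓝 0) := by
  obtain ⟨C, hC, h⟩ := errM_bound
  refine squeeze_zero_norm (fun M => h _ (mem_of_mem_nhds U_nhds) M) ?_
  simpa using pow2425.const_mul C

lemma errM_deriv_tendsto : Tendsto (fun M => deriv (errM M) (1 / 2)) atTop (𝓝 0) := by
  obtain ⟨C, hC, h⟩ := errM_bound
  refine squeeze_zero_norm (a := fun M => C * (24 / 25) ^ M / (1 / 40)) (fun M => ?_) ?_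
  · refine Complex.norm_deriv_le_of_forall_mem_sphere_norm_le (by norm_num) ?_ (fun z hz => ?_)
    · refine DifferentiableOn.diffContOnCl ((errM_diff M).mono ?_)
      rw [closure_ball _ (by norm_num)]
      exact Metric.closedBall_subset_ball (by norm_num)
    · exact h z (Metric.sphere_subset_ball (by norm_num) hz) M
  · simpa using (pow2425.const_mul C).div_const (1 / 40)

lemma pF_half (n : ℕ) : pF n (1 / 2) = kS n (1 / 2) := by
  unfold pF kS hF Dn
  have : (1 : ℂ) - 2 * (1 / 2) + (1 / 2) ^ (n + 2) = (1 / 2) ^ n * (1 / 2) ^ 2 := by ring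
  rw [this, mul_pow]
  have h2 : (1 / 2 : ℂ) ^ n ≠ 0 := pow_ne_zero _ (by norm_num)
  generalize (1 / 2 : ℂ) ^ n = y at *
  field_simp

lemma pF_deriv_half (n : ℕ) :
    deriv (pF n) (1 / 2) = deriv (kS n) (1 / 2) + 32 * BB (1 / 2) * (tF (1 / 2) n * 3 ^ n) := by
  have hk : HasDerivAt (kS n) (deriv (kS n) (1 / 2)) (1 / 2) :=
    ((kS_diff n).differentiableAt U_nhds).hasDerivAt
  have hp : HasDerivAt (fun q : ℂ => q ^ (n + 2)) ((n + 2 : ℕ) * (1 / 2 : ℂ) ^ (n + 1)) (1 / 2) := by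
    simpa using hasDerivAt_pow (n + 2) (1 / 2 : ℂ)
  have hD : HasDerivAt (Dn n) (-2 + (n + 2 : ℕ) * (1 / 2 : ℂ) ^ (n + 1)) (1 / 2) := by
    have h1 : HasDerivAt (fun q : ℂ => 1 - 2 * q) (-2) (1 / 2) := by
      simpa using ((hasDerivAt_id (1 / 2 : ℂ)).const_mul 2).const_sub 1
    exact h1.add hp
  have hDv : Dn n (1 / 2) = (1 / 2) ^ n * (1 / 4) := by unfold Dn; ring
  have hy : (1 / 2 : ℂ) ^ n ≠ 0 := pow_ne_zero _ (by norm_num)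
  have hDne : Dn n (1 / 2) ≠ 0 := by rw [hDv]; exact mul_ne_zero hy (by norm_num)
  have hev : pF n =ᶠ[𝓝 (1 / 2)] fun q => kS n q * q ^ (n + 2) / Dn n q := by
    filter_upwards [U_nhds] with q hq
    have : q ≠ 0 := by have := U_ge hq; rw [← norm_pos_iff]; linarith
    unfold pF kS hF
    congr 1
    field_simp
    ring
  have hd := (hk.fun_mul hp).fun_div hD hDne
  rw [hev.deriv_eq, hd.deriv, hDv, pow_add, pow_add]
  have h34 : (vF (1 / 2)) ^ n = 3 ^ n * (1 / 2) ^ n := by rw [vF_half, ← mul_pow]; norm_num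
  have hkv : kS n (1 / 2) = 4 * BB (1 / 2) * tF (1 / 2) n * (3 ^ n * (1 / 2) ^ n) := by
    unfold kS; rw [h34]; ring
  rw [hkv]
  generalize (1 / 2 : ℂ) ^ n = y at *
  generalize deriv (kS n) (1 / 2) = dk
  push_cast
  field_simp
  ring

theorem const_V : Adm 0 (fun M => Ct (1 / 2) + ∑ n ∈ Finset.range M, pF n (1 / 2)) := by
  have h := (Adm.of_tendsto errM_tendsto).add (Adm.of_eq 0 (GV (1 / 2)) 0)
  rw [add_zero] at h
  refine h.congr (fun M => ?_)
  simp only [pF_half]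
  have : Sinf (1 / 2) = 0 := by unfold Sinf; norm_num
  unfold errM
  rw [this, vF_half]
  unfold SM
  ring

lemma f3_half (M : ℕ) : ∑ n ∈ Finset.range M, tF (1 / 2) n * 3 ^ n =
    1 / 2 * (3 ^ M * tF (1 / 2) M * (1 - (1 / 2) ^ M)) := by
  have h := fM_func (aF (1 / 2)) (1 / 2) 3 (by norm_num) M
  rw [aF_half] at h
  unfold tF
  rw [aF_half]
  linear_combination (-1 / 2) * h

lemma const_f3 : Adm 0 (fun M => ∑ n ∈ Finset.range M, tF (1 / 2) n * 3 ^ n) := by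
  obtain ⟨c, T, K, h⟩ := tF_half
  have z : Tendsto (fun M : ℕ => (3 / 4 : ℝ) ^ M) atTop (𝓝 0) :=
    tendsto_pow_atTop_nhds_zero_of_lt_one (by norm_num) (by norm_num)
  have z' : Tendsto (fun M : ℕ => (3 / 4 : ℂ) ^ M) atTop (𝓝 0) :=
    tendsto_pow_atTop_nhds_zero_of_norm_lt_one (by norm_num)
  have h1 : Tendsto (fun M : ℕ => 3 ^ M * (tF (1 / 2) M - T - c * (1 / 2) ^ M)) atTop (𝓝 0) := by
    refine squeeze_zero_norm (a := fun M => K * (3 / 4) ^ M) (fun M => ?_) (by simpa using z.const_mul K)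
    rw [norm_mul, norm_pow, show ‖(3 : ℂ)‖ = 3 by norm_num]
    calc (3 : ℝ) ^ M * ‖tF (1 / 2) M - T - c * (1 / 2) ^ M‖ ≤ 3 ^ M * (K * (1 / 4) ^ M) := by
          gcongr; exact h M
      _ = K * (3 ^ M * (1 / 4) ^ M) := by ring
      _ = _ := by rw [← mul_pow]; norm_num
  have z2 : Tendsto (fun M : ℕ => (1 / 2 : ℂ) ^ M) atTop (𝓝 0) :=
    tendsto_pow_atTop_nhds_zero_of_norm_lt_one (by norm_num)
  have h2 : Tendsto (fun M : ℕ => 1 / 2 * (3 ^ M * (tF (1 / 2) M - T - c * (1 / 2) ^ M) * (1 - (1 / 2) ^ M)) -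
      1 / 2 * c * (3 / 4) ^ M) atTop (𝓝 0) := by
    have := ((h1.mul (z2.const_sub 1)).const_mul (1 / 2)).sub (z'.const_mul (1 / 2 * c))
    simpa using this
  have := (Adm.of_tendsto h2).add (Adm.of_eq (1 / 2 * T) (1 / 2 * (c - T)) 0)
  rw [add_zero] at this
  refine this.congr (fun M => ?_)
  rw [f3_half]
  have e1 : (3 / 4 : ℂ) ^ M = 3 ^ M * (1 / 2) ^ M * (1 / 2) ^ M := by
    rw [← mul_pow, ← mul_pow]; norm_num
  have e2 : (3 / 2 : ℂ) ^ M = 3 ^ M * (1 / 2) ^ M := by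
    rw [← mul_pow]; norm_num
  rw [e1, e2]
  ring

theorem const_W : Adm (-2)
    (fun M => deriv Ct (1 / 2) + ∑ n ∈ Finset.range M, deriv (pF n) (1 / 2)) := by
  have hG : HasDerivAt GV (deriv GV (1 / 2)) (1 / 2) :=
    (GV_diff.differentiableAt U_nhds).hasDerivAt
  have hv : HasDerivAt vF (deriv vF (1 / 2)) (1 / 2) :=
    ((vF_diff.mono U_sub).differentiableAt U_nhds).hasDerivAt
  have hS : HasDerivAt Sinf (-2) (1 / 2) := by
    have h1 : HasDerivAt (fun q : ℂ => 1 - 2 * q) (-2) (1 / 2) := by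
      simpa using ((hasDerivAt_id (1 / 2 : ℂ)).const_mul 2).const_sub 1
    have h2 : DifferentiableAt ℂ (fun q : ℂ => 2 * q * (2 - 3 * q) / (1 - q)) (1 / 2) :=
      DifferentiableAt.fun_div (by fun_prop) (by fun_prop) (by norm_num)
    have h3 := h2.hasDerivAt.fun_mul h1
    have e : Sinf = fun q => 2 * q * (2 - 3 * q) / (1 - q) * (1 - 2 * q) := by
      funext q; unfold Sinf; ring
    rw [e]
    refine h3.congr_deriv ?_
    norm_num
  have h := (((Adm.of_tendsto errM_deriv_tendsto).add
    (Adm.of_eq 0 (deriv GV (1 / 2)) (GV (1 / 2) * deriv vF (1 / 2) * (2 / 3)))).add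
    (Adm.of_tendsto (tendsto_const_nhds (x := (-2 : ℂ))))).add (const_f3.const_mul (32 * BB (1 / 2)))
  simp only [zero_add, mul_zero, add_zero] at h
  refine h.congr (fun M => ?_)
  simp only [pF_deriv_half]
  have hSM : HasDerivAt (SM M) (deriv Ct (1 / 2) + ∑ n ∈ Finset.range M, deriv (kS n) (1 / 2)) (1 / 2) := by
    have h1 : HasDerivAt Ct (deriv Ct (1 / 2)) (1 / 2) :=
      ((Ct_diff.mono U_sub).differentiableAt U_nhds).hasDerivAt
    exact h1.fun_add (HasDerivAt.fun_sum (fun n _ => ((kS_diff n).differentiableAt U_nhds).hasDerivAt))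
  have he : HasDerivAt (errM M) _ (1 / 2) := (hSM.fun_sub hS).fun_sub (hG.fun_mul (hv.fun_pow M))
  rw [he.deriv, Finset.sum_add_distrib, ← Finset.mul_sum, vF_half]
  rcases M with _ | M
  · simp
  · simp only [Nat.add_sub_cancel, pow_succ]
    push_cast
    ring


/-! ### Part 9: two-variable Taylor expansion -/

lemma multilin_poly {j : ℕ} (f : ContinuousMultilinearMap ℂ (fun _ : Fin j => ℂ × ℂ) ℂ) :
    ∃ c : ℕ → ℂ, ∀ x t : ℂ, f (fun _ => (x, t * x)) = x ^ j * ∑ l ∈ Finset.range (j + 1), c l * t ^ l := by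
  classical
  let v : Finset (Fin j) → (Fin j → ℂ × ℂ) := fun s => s.piecewise (fun _ => (0, 1)) (fun _ => (1, 0))
  refine ⟨fun l => ∑ s ∈ Finset.univ.filter (fun s : Finset (Fin j) => s.card = l), f (v s), fun x t => ?_⟩
  have h1 : (fun _ : Fin j => (x, t * x)) = fun i => (fun _ => x) i • (fun _ : Fin j => ((1 : ℂ), t)) i := by
    funext i; ext <;> simp [mul_comm]
  rw [h1, f.map_smul_univ]
  simp only [Finset.prod_const, Finset.card_univ, Fintype.card_fin, smul_eq_mul]
  congr 1
  have h2 : (fun _ : Fin j => ((1 : ℂ), t)) = (fun _ => t • ((0 : ℂ), (1 : ℂ))) + (fun _ => ((1 : ℂ), (0 : ℂ))) := by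
    funext i; ext <;> simp
  rw [h2, f.map_add_univ]
  have h3 : ∀ s : Finset (Fin j), f (s.piecewise (fun _ => t • ((0 : ℂ), (1 : ℂ))) (fun _ => ((1 : ℂ), (0 : ℂ)))) =
      f (v s) * t ^ s.card := by
    intro s
    have : s.piecewise (fun _ => t • ((0 : ℂ), (1 : ℂ))) (fun _ => ((1 : ℂ), (0 : ℂ))) =
        s.piecewise (fun i => (fun _ => t) i • v s i) (v s) := by
      funext i
      by_cases hi : i ∈ s <;> simp [v, hi]
    rw [this, f.map_piecewise_smul]
    simp [mul_comm]
  rw [Finset.sum_congr rfl (fun s _ => h3 s)]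
  rw [← Finset.sum_fiberwise_of_maps_to (s := Finset.univ) (t := Finset.range (j + 1))
    (g := fun s : Finset (Fin j) => s.card) (fun s _ => by
      have := Finset.card_le_univ s
      simp at this ⊢; omega)]
  refine Finset.sum_congr rfl (fun l _ => ?_)
  rw [Finset.sum_mul]
  refine Finset.sum_congr rfl (fun s hs => ?_)
  rw [(Finset.mem_filter.mp hs).2]

lemma norm_ppt {m : ℕ} (hm : 1 ≤ m) : ‖ppt m‖ = m * (1 / 2 : ℝ) ^ m := by
  unfold ppt
  rw [Prod.norm_def]
  simp only [norm_mul, norm_pow, Complex.norm_natCast]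
  rw [show ‖(1 / 2 : ℂ)‖ = 1 / 2 by norm_num]
  apply max_eq_right
  have : (1 : ℝ) ≤ m := by exact_mod_cast hm
  nlinarith [pow_pos (show (0 : ℝ) < 1 / 2 by norm_num) m]

/-- eventual bounds become global bounds -/
lemma ev_to_all {u w : ℕ → ℝ} (hw : ∀ m, 1 ≤ m → 0 < w m) {C : ℝ} (h : ∀ᶠ m in atTop, u m ≤ C * w m) :
    ∃ C' : ℝ, 0 < C' ∧ ∀ m, 1 ≤ m → u m ≤ C' * w m := by
  obtain ⟨M, hM⟩ := eventually_atTop.mp h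
  refine ⟨|C| + 1 + ∑ m ∈ Finset.range M, |u m| / |w m|, ?_, fun m hm => ?_⟩
  · have : 0 ≤ ∑ m ∈ Finset.range M, |u m| / |w m| := Finset.sum_nonneg (fun _ _ => by positivity)
    positivity
  · have hs : 0 ≤ ∑ m ∈ Finset.range M, |u m| / |w m| := Finset.sum_nonneg (fun _ _ => by positivity)
    have hwm := hw m hm
    rcases lt_or_ge m M with h1 | h1
    · have h2 : |u m| / |w m| ≤ ∑ m ∈ Finset.range M, |u m| / |w m| :=
        Finset.single_le_sum (f := fun m => |u m| / |w m|) (fun _ _ => by positivity) (Finset.mem_range.mpr h1)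
      rw [div_le_iff₀ (by positivity), abs_of_pos hwm] at h2
      have := le_abs_self (u m)
      have : 0 ≤ (|C| + 1) * w m := by positivity
      nlinarith
    · refine (hM m h1).trans ?_
      have := le_abs_self C
      gcongr
      linarith

lemma taylor2 (F : ℂ × ℂ → ℂ) (hF : AnalyticAt ℂ F 0) (i : ℕ) (hO : F =O[𝓝 0] fun p => ‖p‖ ^ i) :
    ∃ f : ℕ → ℕ → ℂ, (i = 0 → f 0 0 = F 0) ∧ (∀ j < i, ∀ l, f j l = 0) ∧
      ∀ J : ℕ, ∃ C : ℝ, 0 < C ∧ ∀ m : ℕ, 1 ≤ m →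
        ‖F (ppt m) - ∑ j ∈ Finset.range J, ((1 / 2 : ℂ) ^ m) ^ j *
          ∑ l ∈ Finset.range (j + 1), f j l * (m : ℂ) ^ l‖ ≤ C * (m * (1 / 2 : ℝ) ^ m) ^ J := by
  obtain ⟨p, hp⟩ := hF
  choose c hc using fun j => multilin_poly (p j)
  have hbig : ∀ n, (fun y => F y - p.partialSum n y) =O[𝓝 0] fun y => ‖y‖ ^ n := by
    intro n
    simpa using hp.isBigO_sub_partialSum_pow n
  have hvan : ∀ j < i, ∀ y, p j (fun _ => y) = 0 := by
    intro j
    induction j using Nat.strong_induction_on with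
    | _ j ih =>
      intro hj
      apply Asymptotics.IsBigO.continuousMultilinearMap_apply_eq_zero
      have h1 : F =O[𝓝 0] fun y => ‖y‖ ^ (j + 1) := by
        refine hO.trans (IsBigO.of_bound 1 ?_)
        have : ∀ᶠ y : ℂ × ℂ in 𝓝 0, ‖y‖ < 1 := by
          have := continuous_norm.tendsto (0 : ℂ × ℂ)
          rw [norm_zero] at this
          exact this.eventually (gt_mem_nhds one_pos)
        filter_upwards [this] with y hy
        rw [one_mul, norm_pow, norm_pow, norm_norm]
        exact pow_le_pow_of_le_one (norm_nonneg _) hy.le (by omega)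
      have h2 := h1.sub (hbig (j + 1))
      refine h2.congr_left (fun y => ?_)
      rw [sub_sub_cancel, FormalMultilinearSeries.partialSum, Finset.sum_range_succ]
      rw [Finset.sum_eq_zero, zero_add]
      intro k hk
      have hk' := Finset.mem_range.mp hk
      exact ih k hk' (hk'.trans hj) y
  refine ⟨fun j l => if j < i then 0 else c j l, ?_, ?_, fun J => ?_⟩
  · rintro rfl
    have h1 := hc 0 0 0
    simp at h1
    simp only [Nat.not_lt_zero, if_false]
    rw [← h1]
    exact hp.coeff_zero _
  · intro j hj l; simp [hj]
  · obtain ⟨C, hC⟩ := ((hbig J).bound)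
    refine ev_to_all (u := fun m : ℕ => ‖F (ppt m) - ∑ j ∈ Finset.range J, ((1 / 2 : ℂ) ^ m) ^ j *
          ∑ l ∈ Finset.range (j + 1), (if j < i then 0 else c j l) * (m : ℂ) ^ l‖)
          (w := fun m : ℕ => (m * (1 / 2 : ℝ) ^ m) ^ J) (C := C) ?_ ?_
    · intro m hm
      have : (1 : ℝ) ≤ m := by exact_mod_cast hm
      positivity
    · filter_upwards [ppt_tendsto.eventually hC, eventually_ge_atTop 1] with m hm hm1
      rw [norm_ppt hm1, norm_pow, Real.norm_of_nonneg (by positivity)] at hm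
      refine le_trans (le_of_eq ?_) hm
      congr 2
      unfold FormalMultilinearSeries.partialSum
      refine Finset.sum_congr rfl (fun j _ => ?_)
      have h1 := hc j ((1 / 2 : ℂ) ^ m) m
      by_cases hj : j < i
      · simp only [hj, if_true, zero_mul, Finset.sum_const_zero, mul_zero]
        exact (hvan j hj _).symm
      · simp only [hj, if_false]
        exact h1.symm


/-! ### Part 10: expansion of a single term -/

lemma fac_an {Rt Kt : ℂ × ℂ → ℂ} (hR : AnalyticAt ℂ Rt 0) (hK : AnalyticAt ℂ Kt 0) (i : ℕ) :
    AnalyticAt ℂ (fun p => Rt p * (-Kt p) ^ i / (i.factorial : ℂ)) 0 :=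
  (hR.fun_mul (hK.fun_neg.fun_pow i)).div_const

lemma K_isBigO {Kt : ℂ × ℂ → ℂ} (hK : AnalyticAt ℂ Kt 0) (h0 : Kt 0 = 0) :
    Kt =O[𝓝 0] fun p => ‖p‖ := by
  have := hK.differentiableAt.hasFDerivAt.isBigO_sub
  simpa [h0] using this.norm_right

theorem E_expand {Rt Kt : ℂ × ℂ → ℂ} (hR : AnalyticAt ℂ Rt 0) (hK : AnalyticAt ℂ Kt 0)
    (h0 : Kt 0 = 0) : ∃ f : ℕ → ℕ → ℕ → ℂ, f 0 0 0 = Rt 0 ∧ (∀ i j l, j < i → f i j l = 0) ∧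
    ∃ m0 : ℕ, 1 ≤ m0 ∧ ∀ J : ℕ, ∃ C : ℝ, 0 < C ∧ ∀ m : ℕ, m0 ≤ m → ∀ T : ℝ, 0 ≤ T →
      ‖Rt (ppt m) * Complex.exp (-(T * (1 + Kt (ppt m)))) -
        ∑ j ∈ Finset.range J, ((1 / 2 : ℂ) ^ m) ^ j * ∑ l ∈ Finset.range (j + 1), (m : ℂ) ^ l *
          ∑ i ∈ Finset.range (j + 1), f i j l * ((T : ℂ) ^ i * Complex.exp (-T))‖ ≤
      C * (m * (1 / 2 : ℝ) ^ m) ^ J * ((1 + T) ^ J * Real.exp (-T / 2)) := by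
  have hKO := K_isBigO hK h0
  have hFO : ∀ i : ℕ, (fun p => Rt p * (-Kt p) ^ i / (i.factorial : ℂ)) =O[𝓝 0] fun p => ‖p‖ ^ i := by
    intro i
    have h1 : Rt =O[𝓝 0] fun _ => (1 : ℝ) := hR.continuousAt.isBigO_one ℝ
    have h2 := (h1.mul (hKO.neg_left.pow i)).const_mul_left ((i.factorial : ℂ)⁻¹)
    refine (h2.congr_left (fun p => ?_)).congr_right (fun p => by simp)
    rw [div_eq_mul_inv, mul_comm]
  choose f hf0 hfv hfT using fun i => taylor2 _ (fac_an hR hK i) i (hFO i)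
  obtain ⟨fK, -, hKv, hKT⟩ := taylor2 Kt hK 1 (by simpa using hKO)
  obtain ⟨fR, -, -, hRT⟩ := taylor2 Rt hR 0 (by simpa using hR.continuousAt.isBigO_one ℝ)
  obtain ⟨CR, hCR, hRb⟩ := hRT 0
  obtain ⟨CK, hCK, hKb⟩ := hKT 1
  have hKev : ∀ᶠ m in atTop, ‖Kt (ppt m)‖ < 1 / 2 := by
    have := hK.continuousAt.norm.tendsto
    rw [h0, norm_zero] at this
    have h2 : ∀ᶠ p in 𝓝 (0 : ℂ × ℂ), ‖Kt p‖ < 1 / 2 :=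
      this.eventually (gt_mem_nhds (by norm_num))
    exact ppt_tendsto.eventually h2
  obtain ⟨M, hM⟩ := eventually_atTop.mp hKev
  refine ⟨f, by simpa using hf0 0 rfl, fun i j l hj => hfv i j hj l, M + 1, by omega, fun J => ?_⟩
  choose CF hCF hF using fun i => hfT i J
  refine ⟨CR * CK ^ J + ∑ i ∈ Finset.range J, CF i,
    by have := Finset.sum_nonneg (fun i (_ : i ∈ Finset.range J) => (hCF i).le); positivity, fun m hm T hT => ?_⟩
  have hm1 : 1 ≤ m := by omega
  set K := Kt (ppt m) with hKdef
  set R := Rt (ppt m) with hRdef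
  set x : ℂ := (1 / 2 : ℂ) ^ m with hx
  set η : ℝ := m * (1 / 2 : ℝ) ^ m with hη
  have hη0 : 0 ≤ η := by positivity
  have hRb' : ‖R‖ ≤ CR := by simpa using hRb m hm1
  have hKb' : ‖K‖ ≤ CK * η := by
    have := hKb m hm1
    simpa [hKv 0 one_pos, hη, hKdef] using this
  have hKh : ‖K‖ ≤ 1 / 2 := (hM m (by omega)).le
  have hsplit : Complex.exp (-(T * (1 + K))) = Complex.exp (-T) * Complex.exp (-(T * K)) := by
    rw [← Complex.exp_add]; congr 1; ring
  have hre : ∑ j ∈ Finset.range J, x ^ j * ∑ l ∈ Finset.range (j + 1), (m : ℂ) ^ l *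
          ∑ i ∈ Finset.range (j + 1), f i j l * ((T : ℂ) ^ i * Complex.exp (-T)) =
      ∑ i ∈ Finset.range J, ((T : ℂ) ^ i * Complex.exp (-T)) *
        ∑ j ∈ Finset.range J, x ^ j * ∑ l ∈ Finset.range (j + 1), f i j l * (m : ℂ) ^ l := by
    simp only [Finset.mul_sum]
    rw [Finset.sum_comm (s := Finset.range J) (t := Finset.range J)]
    refine Finset.sum_congr rfl (fun j hj => ?_)
    have hj' := Finset.mem_range.mp hj
    rw [Finset.sum_comm (s := Finset.range J) (t := Finset.range (j + 1))]
    refine Finset.sum_congr rfl (fun l hl => ?_)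
    rw [← Finset.sum_subset (s₁ := Finset.range (j + 1)) (s₂ := Finset.range J)]
    · refine Finset.sum_congr rfl (fun i _ => by ring)
    · intro i hi
      have := Finset.mem_range.mp hi
      exact Finset.mem_range.mpr (by omega)
    · intro i _ hi
      have : j < i := by
        have := mt Finset.mem_range.mpr hi
        omega
      rw [hfv i j this l]; ring
  have hmain : R * Complex.exp (-(T * (1 + K))) -
      ∑ i ∈ Finset.range J, ((T : ℂ) ^ i * Complex.exp (-T)) *
        ∑ j ∈ Finset.range J, x ^ j * ∑ l ∈ Finset.range (j + 1), f i j l * (m : ℂ) ^ l =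
      R * Complex.exp (-T) * (Complex.exp (-(T * K)) -
        ∑ i ∈ Finset.range J, (-(T * K)) ^ i / (i.factorial : ℂ)) +
      ∑ i ∈ Finset.range J, ((T : ℂ) ^ i * Complex.exp (-T)) * (R * (-K) ^ i / (i.factorial : ℂ) -
        ∑ j ∈ Finset.range J, x ^ j * ∑ l ∈ Finset.range (j + 1), f i j l * (m : ℂ) ^ l) := by
    simp only [mul_sub, Finset.sum_sub_distrib]
    have : R * Complex.exp (-T) * ∑ i ∈ Finset.range J, (-(T * K)) ^ i / (i.factorial : ℂ) =
      ∑ i ∈ Finset.range J, ((T : ℂ) ^ i * Complex.exp (-T)) * (R * (-K) ^ i / (i.factorial : ℂ)) := by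
      rw [Finset.mul_sum]
      refine Finset.sum_congr rfl (fun i _ => ?_)
      rw [show -((T : ℂ) * K) = T * (-K) by ring, mul_pow]; ring
    rw [this, hsplit]; ring
  rw [hre, hmain]
  refine (norm_add_le _ _).trans ?_
  have hexpT : ‖Complex.exp (-(T : ℂ))‖ = Real.exp (-T) := by
    rw [Complex.norm_exp]; simp
  have hTn : ‖(T : ℂ)‖ = T := by rw [Complex.norm_real, Real.norm_of_nonneg hT]
  rw [add_mul, add_mul]
  refine add_le_add ?_ ?_
  · rw [norm_mul, norm_mul, hexpT]
    have h1 := Complex.norm_exp_sub_sum_le_norm_mul_exp (-(T * K)) J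
    have h2 : ‖-((T : ℂ) * K)‖ = T * ‖K‖ := by rw [norm_neg, norm_mul, hTn]
    rw [h2] at h1
    have h3 : (T * ‖K‖) ^ J ≤ ((1 + T) * (CK * η)) ^ J := by gcongr; linarith
    have h4 : Real.exp (T * ‖K‖) ≤ Real.exp (T / 2) := by
      apply Real.exp_le_exp.mpr; nlinarith
    calc ‖R‖ * Real.exp (-T) * ‖Complex.exp (-(T * K)) - ∑ i ∈ Finset.range J, (-(T * K)) ^ i / (i.factorial : ℂ)‖
        ≤ CR * Real.exp (-T) * (((1 + T) * (CK * η)) ^ J * Real.exp (T / 2)) := by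
          gcongr
          exact h1.trans (mul_le_mul h3 h4 (Real.exp_pos _).le (by positivity))
      _ = CR * CK ^ J * η ^ J * ((1 + T) ^ J * (Real.exp (-T) * Real.exp (T / 2))) := by
          rw [mul_pow, mul_pow]; ring
      _ = _ := by rw [← Real.exp_add]; ring_nf
  · refine (norm_sum_le _ _).trans ?_
    rw [Finset.sum_mul, Finset.sum_mul]
    refine Finset.sum_le_sum (fun i hi => ?_)
    have hi' := Finset.mem_range.mp hi
    rw [norm_mul, norm_mul, norm_pow, hTn, hexpT]
    have h1 := hF i m hm1
    have h2 : T ^ i ≤ (1 + T) ^ J :=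
      calc T ^ i ≤ (1 + T) ^ i := by gcongr; linarith
        _ ≤ (1 + T) ^ J := pow_le_pow_right₀ (by linarith) hi'.le
    have h3 : Real.exp (-T) ≤ Real.exp (-T / 2) := Real.exp_le_exp.mpr (by linarith)
    calc _ ≤ (1 + T) ^ J * Real.exp (-T / 2) * (CF i * η ^ J) :=
          mul_le_mul (mul_le_mul h2 h3 (Real.exp_pos _).le (by positivity)) h1 (norm_nonneg _) (by positivity)
      _ = _ := by ring


/-! ### Part 11: exponentially decaying functions -/

/-- exponential decay at both ends -/
def Dec (φ : ℝ → ℂ) : Prop := ∃ C c : ℝ, 0 < C ∧ 0 < c ∧ ∀ y, ‖φ y‖ ≤ C * Real.exp (-c * |y|)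

lemma Dec.add {φ ψ : ℝ → ℂ} (h1 : Dec φ) (h2 : Dec ψ) : Dec (fun y => φ y + ψ y) := by
  obtain ⟨C, c, hC, hc, h⟩ := h1
  obtain ⟨D, d, hD, hd, h'⟩ := h2
  refine ⟨C + D, min c d, by positivity, lt_min hc hd, fun y => ?_⟩
  have e1 : Real.exp (-c * |y|) ≤ Real.exp (-(min c d) * |y|) := by
    apply Real.exp_le_exp.mpr
    have := abs_nonneg y
    have := min_le_left c d
    nlinarith
  have e2 : Real.exp (-d * |y|) ≤ Real.exp (-(min c d) * |y|) := by
    apply Real.exp_le_exp.mpr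
    have := abs_nonneg y
    have := min_le_right c d
    nlinarith
  calc _ ≤ ‖φ y‖ + ‖ψ y‖ := norm_add_le _ _
    _ ≤ C * Real.exp (-(min c d) * |y|) + D * Real.exp (-(min c d) * |y|) :=
        add_le_add ((h y).trans (by gcongr)) ((h' y).trans (by gcongr))
    _ = _ := by ring

lemma Dec.const_mul {φ : ℝ → ℂ} (h1 : Dec φ) (k : ℂ) : Dec (fun y => k * φ y) := by
  obtain ⟨C, c, hC, hc, h⟩ := h1
  refine ⟨(‖k‖ + 1) * C, c, by positivity, hc, fun y => ?_⟩
  rw [norm_mul, mul_assoc]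
  exact mul_le_mul (by linarith) (h y) (norm_nonneg _) (by positivity)

lemma Dec.mul_y {φ : ℝ → ℂ} (h1 : Dec φ) : Dec (fun y => (y : ℂ) * φ y) := by
  obtain ⟨C, c, hC, hc, h⟩ := h1
  refine ⟨C * (2 / c), c / 2, by positivity, by positivity, fun y => ?_⟩
  rw [norm_mul, Complex.norm_real, Real.norm_eq_abs]
  have h2 : c / 2 * |y| ≤ Real.exp (c / 2 * |y|) := by
    have := Real.add_one_le_exp (c / 2 * |y|)
    linarith
  have h3 : |y| ≤ 2 / c * Real.exp (c / 2 * |y|) := by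
    have : |y| = 2 / c * (c / 2 * |y|) := by field_simp
    calc |y| = 2 / c * (c / 2 * |y|) := this
      _ ≤ 2 / c * Real.exp (c / 2 * |y|) := by gcongr
  calc |y| * ‖φ y‖ ≤ (2 / c * Real.exp (c / 2 * |y|)) * (C * Real.exp (-c * |y|)) :=
        mul_le_mul h3 (h y) (norm_nonneg _) (by positivity)
    _ = C * (2 / c) * (Real.exp (c / 2 * |y|) * Real.exp (-c * |y|)) := by ring
    _ = _ := by rw [← Real.exp_add]; ring_nf

lemma Dec.mono {φ ψ : ℝ → ℂ} (h1 : Dec φ) (h : ∀ y, ‖ψ y‖ ≤ ‖φ y‖) : Dec ψ := by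
  obtain ⟨C, c, hC, hc, h'⟩ := h1
  exact ⟨C, c, hC, hc, fun y => (h y).trans (h' y)⟩

lemma Dec.of_two {φ : ℝ → ℂ} (C p q : ℝ) (hC : 0 < C) (hp : 0 < p) (hq : 0 < q)
    (h1 : ∀ y, ‖φ y‖ ≤ C * Real.exp (p * y)) (h2 : ∀ y, ‖φ y‖ ≤ C * Real.exp (-(q * y))) :
    Dec φ := by
  refine ⟨C, min p q, hC, lt_min hp hq, fun y => ?_⟩
  have e1 := min_le_left p q
  have e2 := min_le_right p q
  rcases le_total 0 y with hy | hy
  · refine (h2 y).trans ?_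
    rw [abs_of_nonneg hy]
    gcongr
    nlinarith
  · refine (h1 y).trans ?_
    rw [abs_of_nonpos hy]
    have : p * y ≤ -min p q * -y := by nlinarith
    gcongr

lemma exp_exp_bound (a : ℝ) (ha : 0 ≤ a) : ∃ C : ℝ, 0 < C ∧ ∀ y : ℝ,
    Real.exp (a * y) * Real.exp (-Real.exp y / 2) ≤ C := by
  obtain ⟨n, hn⟩ := exists_nat_ge a
  refine ⟨2 ^ n * n.factorial + 1, by positivity, fun y => ?_⟩
  have hE : Real.exp (-Real.exp y / 2) ≤ 1 := by
    apply Real.exp_le_one_iff.mpr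
    have := Real.exp_pos y
    linarith
  rcases le_total 0 y with hy | hy
  · have h1 : Real.exp (a * y) ≤ Real.exp y ^ n := by
      rw [← Real.exp_nat_mul]
      apply Real.exp_le_exp.mpr
      nlinarith
    have h2 := Real.pow_div_factorial_le_exp (Real.exp y / 2) (by positivity) n
    have h3 : Real.exp y ^ n ≤ 2 ^ n * n.factorial * Real.exp (Real.exp y / 2) := by
      rw [div_pow, div_div, div_le_iff₀ (by positivity)] at h2
      linarith
    calc _ ≤ 2 ^ n * n.factorial * Real.exp (Real.exp y / 2) * Real.exp (-Real.exp y / 2) := by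
          gcongr; exact h1.trans h3
      _ = 2 ^ n * n.factorial := by
          rw [mul_assoc, ← Real.exp_add]
          rw [show Real.exp y / 2 + -Real.exp y / 2 = 0 by ring, Real.exp_zero, mul_one]
      _ ≤ _ := by linarith
  · have h1 : Real.exp (a * y) ≤ 1 := Real.exp_le_one_iff.mpr (by nlinarith)
    have : 0 < (2 : ℝ) ^ n * n.factorial := by positivity
    calc _ ≤ (1 : ℝ) * 1 := by gcongr
      _ ≤ _ := by linarith

/-- natural log of two -/
def LR : ℝ := Real.log 2

lemma LR_pos : 0 < LR := Real.log_pos (by norm_num)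

def b0 (a y : ℝ) : ℂ := ((Real.exp (a * (LR * y)) * Real.exp (-Real.exp (LR * y)) : ℝ) : ℂ)
def b1 (a y : ℝ) : ℂ := ((Real.exp (a * (LR * y)) * (Real.exp (-Real.exp (LR * y)) - 1) : ℝ) : ℂ)
def b2 (a y : ℝ) : ℂ := ((Real.exp (a * (LR * y)) *
  (Real.exp (-Real.exp (LR * y)) - 1 + Real.exp (LR * y)) : ℝ) : ℂ)

lemma dec_half (a : ℝ) (ha : 0 < a) :
    Dec (fun y => ((Real.exp (a * (LR * y)) * Real.exp (-Real.exp (LR * y) / 2) : ℝ) : ℂ)) := by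
  obtain ⟨C, hC, h⟩ := exp_exp_bound (2 * a) (by linarith)
  have hL := LR_pos
  refine Dec.of_two (C + 1) (a * LR) (a * LR) (by positivity) (by positivity) (by positivity)
    (fun y => ?_) (fun y => ?_)
  · rw [Complex.norm_real, Real.norm_of_nonneg (by positivity)]
    have : Real.exp (-Real.exp (LR * y) / 2) ≤ 1 := by
      apply Real.exp_le_one_iff.mpr
      have := Real.exp_pos (LR * y)
      linarith
    rw [mul_comm, mul_assoc a]
    gcongr
    linarith
  · rw [Complex.norm_real, Real.norm_of_nonneg (by positivity)]
    have e : Real.exp (a * (LR * y)) * Real.exp (-Real.exp (LR * y) / 2) =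
      (Real.exp (2 * a * (LR * y)) * Real.exp (-Real.exp (LR * y) / 2)) * Real.exp (-(a * LR * y)) := by
      simp only [← Real.exp_add]; congr 1; ring
    rw [e]
    gcongr
    exact (h _).trans (by linarith)

lemma dec_b0 (a : ℝ) (ha : 0 < a) : Dec (b0 a) := by
  refine (dec_half a ha).mono (fun y => ?_)
  rw [b0, Complex.norm_real, Real.norm_of_nonneg (by positivity), Complex.norm_real,
    Real.norm_of_nonneg (by positivity)]
  gcongr
  have := Real.exp_pos (LR * y)
  linarith

lemma dec_b1 (a : ℝ) (ha : -1 < a) (ha' : a < 0) : Dec (b1 a) := by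
  have hL := LR_pos
  have hn : ∀ y, ‖b1 a y‖ = Real.exp (a * (LR * y)) * (1 - Real.exp (-Real.exp (LR * y))) := by
    intro y
    rw [b1, Complex.norm_real, norm_mul, Real.norm_of_nonneg (Real.exp_pos _).le,
      Real.norm_of_nonpos, neg_sub]
    have := Real.exp_le_one_iff.mpr (neg_nonpos.mpr (Real.exp_pos (LR * y)).le)
    linarith
  refine Dec.of_two 1 ((a + 1) * LR) (-a * LR) one_pos (mul_pos (by linarith) hL) (mul_pos (by linarith) hL)
    (fun y => ?_) (fun y => ?_)
  · rw [hn]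
    have := Real.one_sub_le_exp_neg (Real.exp (LR * y))
    calc _ ≤ Real.exp (a * (LR * y)) * Real.exp (LR * y) := by gcongr; linarith
      _ = _ := by rw [← Real.exp_add]; ring_nf
  · rw [hn]
    have := Real.exp_pos (-Real.exp (LR * y))
    calc _ ≤ Real.exp (a * (LR * y)) * 1 := by gcongr; linarith
      _ = _ := by ring_nf

lemma dec_b2 (a : ℝ) (ha : -2 < a) (ha' : a < -1) : Dec (b2 a) := by
  have hL := LR_pos
  have hn : ∀ y, ‖b2 a y‖ = Real.exp (a * (LR * y)) * (Real.exp (-Real.exp (LR * y)) - 1 + Real.exp (LR * y)) := by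
    intro y
    rw [b2, Complex.norm_real, norm_mul, Real.norm_of_nonneg (Real.exp_pos _).le,
      Real.norm_of_nonneg]
    have := Real.one_sub_le_exp_neg (Real.exp (LR * y))
    linarith
  refine Dec.of_two 1 ((a + 2) * LR) (-(a + 1) * LR) one_pos (mul_pos (by linarith) hL) (mul_pos (by linarith) hL)
    (fun y => ?_) (fun y => ?_)
  · rw [hn]
    set t := Real.exp (LR * y) with ht
    have ht0 : 0 < t := Real.exp_pos _
    have h1 : Real.exp (-t) ≤ 1 - t + t ^ 2 := by
      rcases le_total t 1 with h | h
      · have := Real.abs_exp_sub_one_sub_id_le (x := -t) (by rw [abs_neg, abs_of_pos ht0]; exact h)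
        have := (abs_le.mp this).2
        nlinarith
      · have := Real.exp_le_one_iff.mpr (neg_nonpos.mpr ht0.le)
        nlinarith
    calc _ ≤ Real.exp (a * (LR * y)) * t ^ 2 := by gcongr; linarith
      _ = _ := by rw [ht, ← Real.exp_nat_mul, ← Real.exp_add]; push_cast; ring_nf
  · rw [hn]
    have := Real.exp_le_one_iff.mpr (neg_nonpos.mpr (Real.exp_pos (LR * y)).le)
    calc _ ≤ Real.exp (a * (LR * y)) * Real.exp (LR * y) := by gcongr; linarith
      _ = _ := by rw [← Real.exp_add]; ring_nf

lemma hd_b0 (a y : ℝ) : HasDerivAt (b0 a) (LR * a * b0 a y + (-LR) * b0 (a + 1) y) y := by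
  have h1 : HasDerivAt (fun y : ℝ => LR * y) LR y := by simpa using (hasDerivAt_id y).const_mul LR
  have h2 := (h1.const_mul a).exp.fun_mul (h1.exp.fun_neg.exp)
  have h3 := h2.ofReal_comp
  refine HasDerivAt.congr_deriv h3 ?_
  simp only [b0]
  norm_cast
  rw [add_mul, Real.exp_add, one_mul]
  ring

lemma hd_b1 (a y : ℝ) : HasDerivAt (b1 a) (LR * a * b1 a y + (-LR) * b0 (a + 1) y) y := by
  have h1 : HasDerivAt (fun y : ℝ => LR * y) LR y := by simpa using (hasDerivAt_id y).const_mul LR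
  have h2 := (h1.const_mul a).exp.fun_mul (h1.exp.fun_neg.exp.sub_const 1)
  have h3 := h2.ofReal_comp
  refine HasDerivAt.congr_deriv h3 ?_
  simp only [b0, b1]
  norm_cast
  rw [add_mul, Real.exp_add, one_mul]
  ring

lemma hd_b2 (a y : ℝ) : HasDerivAt (b2 a) (LR * a * b2 a y + (-LR) * b1 (a + 1) y) y := by
  have h1 : HasDerivAt (fun y : ℝ => LR * y) LR y := by simpa using (hasDerivAt_id y).const_mul LR
  have h2 := (h1.const_mul a).exp.fun_mul ((h1.exp.fun_neg.exp.sub_const 1).fun_add h1.exp)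
  have h3 := h2.ofReal_comp
  refine HasDerivAt.congr_deriv h3 ?_
  simp only [b1, b2]
  norm_cast
  rw [add_mul, Real.exp_add, one_mul]
  ring

/-- `k` times differentiable with decaying derivatives -/
def DD : ℕ → (ℝ → ℂ) → Prop
  | 0, φ => Continuous φ ∧ Dec φ
  | k + 1, φ => Dec φ ∧ ∃ φ' : ℝ → ℂ, (∀ y, HasDerivAt φ (φ' y) y) ∧ DD k φ'

lemma DD.dec {k : ℕ} {φ : ℝ → ℂ} (h : DD k φ) : Dec φ := by
  cases k with
  | zero => exact h.2
  | succ k => exact h.1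

lemma DD.cont {k : ℕ} {φ : ℝ → ℂ} (h : DD k φ) : Continuous φ := by
  cases k with
  | zero => exact h.1
  | succ k =>
    obtain ⟨_, φ', h', _⟩ := h
    exact continuous_iff_continuousAt.mpr (fun y => (h' y).continuousAt)

lemma DD.pred {k : ℕ} : ∀ {φ : ℝ → ℂ}, DD (k + 1) φ → DD k φ := by
  induction k with
  | zero => intro φ h; exact ⟨h.cont, h.dec⟩
  | succ k ih =>
    intro φ h
    obtain ⟨h1, φ', h2, h3⟩ := h
    exact ⟨h1, φ', h2, ih h3⟩

lemma DD.add {k : ℕ} : ∀ {φ ψ : ℝ → ℂ}, DD k φ → DD k ψ → DD k (fun y => φ y + ψ y) := by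
  induction k with
  | zero => intro φ ψ h h'; exact ⟨h.1.add h'.1, h.2.add h'.2⟩
  | succ k ih =>
    intro φ ψ h h'
    obtain ⟨h1, φ', h2, h3⟩ := h
    obtain ⟨h1', ψ', h2', h3'⟩ := h'
    exact ⟨h1.add h1', _, fun y => (h2 y).add (h2' y), ih h3 h3'⟩

lemma DD.const_mul {k : ℕ} (z : ℂ) : ∀ {φ : ℝ → ℂ}, DD k φ → DD k (fun y => z * φ y) := by
  induction k with
  | zero => intro φ h; exact ⟨h.1.const_mul z, h.2.const_mul z⟩
  | succ k ih =>
    intro φ h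
    obtain ⟨h1, φ', h2, h3⟩ := h
    exact ⟨h1.const_mul z, _, fun y => (h2 y).const_mul z, ih h3⟩

lemma DD.mul_y {k : ℕ} : ∀ {φ : ℝ → ℂ}, DD k φ → DD k (fun y => (y : ℂ) * φ y) := by
  induction k with
  | zero => intro φ h; exact ⟨Complex.continuous_ofReal.mul h.1, h.2.mul_y⟩
  | succ k ih =>
    intro φ h
    have h0 := h.pred
    obtain ⟨h1, φ', h2, h3⟩ := h
    refine ⟨h1.mul_y, fun y => 1 * φ y + (y : ℂ) * φ' y, fun y => ?_, (h0.const_mul 1).add (ih h3)⟩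
    have : HasDerivAt (fun y : ℝ => (y : ℂ)) 1 y := by
      simpa using (hasDerivAt_id y).ofReal_comp
    exact this.mul (h2 y)

lemma DD_b0 (k : ℕ) : ∀ a : ℝ, 0 < a → DD k (b0 a) := by
  induction k with
  | zero =>
    intro a ha
    exact ⟨continuous_iff_continuousAt.mpr (fun y => (hd_b0 a y).continuousAt), dec_b0 a ha⟩
  | succ k ih =>
    intro a ha
    exact ⟨dec_b0 a ha, _, hd_b0 a, ((ih a ha).const_mul _).add ((ih (a + 1) (by linarith)).const_mul _)⟩

lemma DD_b1 (k : ℕ) (a : ℝ) (ha : -1 < a) (ha' : a < 0) : DD k (b1 a) := by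
  induction k with
  | zero =>
    exact ⟨continuous_iff_continuousAt.mpr (fun y => (hd_b1 a y).continuousAt), dec_b1 a ha ha'⟩
  | succ k ih =>
    exact ⟨dec_b1 a ha ha', _, hd_b1 a, (ih.const_mul _).add ((DD_b0 k (a + 1) (by linarith)).const_mul _)⟩

lemma DD_b2 (k : ℕ) (a : ℝ) (ha : -2 < a) (ha' : a < -1) : DD k (b2 a) := by
  induction k with
  | zero =>
    exact ⟨continuous_iff_continuousAt.mpr (fun y => (hd_b2 a y).continuousAt), dec_b2 a ha ha'⟩
  | succ k ih =>
    exact ⟨dec_b2 a ha ha', _, hd_b2 a,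
      (ih.const_mul _).add ((DD_b1 k (a + 1) (by linarith) (by linarith)).const_mul _)⟩

lemma shift_sum (c : ℝ) (hc : 0 < c) : ∃ C : ℝ, 0 < C ∧ ∀ u : ℝ,
    Summable (fun m : ℤ => Real.exp (-c * |u - m|)) ∧ ∑' m : ℤ, Real.exp (-c * |u - m|) ≤ C := by
  have hs : Summable (fun k : ℤ => Real.exp (-c * |(k : ℝ)|)) := by
    have h1 : Summable (fun n : ℕ => Real.exp (-c) ^ n) :=
      summable_geometric_of_lt_one (Real.exp_pos _).le (by rw [← Real.exp_zero]; exact Real.exp_lt_exp.mpr (by linarith))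
    refine Summable.of_nat_of_neg ?_ ?_
    · refine h1.congr (fun n => ?_)
      rw [← Real.exp_nat_mul]; simp; ring
    · refine h1.congr (fun n => ?_)
      rw [← Real.exp_nat_mul]; simp; ring
  have hb : ∀ (u : ℝ) (m : ℤ), Real.exp (-c * |u - m|) ≤ Real.exp c * Real.exp (-c * |((m - ⌊u⌋ : ℤ) : ℝ)|) := by
    intro u m
    rw [← Real.exp_add]
    apply Real.exp_le_exp.mpr
    have h1 := Int.floor_le u
    have h2 := Int.lt_floor_add_one u
    have : |((m - ⌊u⌋ : ℤ) : ℝ)| ≤ |u - m| + 1 := by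
      push_cast
      rw [abs_le]
      have h3 := neg_abs_le (u - m)
      have h4 := le_abs_self (u - m)
      constructor <;> linarith
    nlinarith
  have hs2 : ∀ u : ℝ, Summable (fun m : ℤ => Real.exp c * Real.exp (-c * |((m - ⌊u⌋ : ℤ) : ℝ)|)) := by
    intro u
    exact ((Equiv.subRight ⌊u⌋).summable_iff.mpr hs).mul_left _
  refine ⟨Real.exp c * ∑' k : ℤ, Real.exp (-c * |(k : ℝ)|) + 1, ?_, fun u => ⟨?_, ?_⟩⟩
  · have : 0 ≤ ∑' k : ℤ, Real.exp (-c * |(k : ℝ)|) := tsum_nonneg (fun _ => (Real.exp_pos _).le)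
    positivity
  · exact Summable.of_nonneg_of_le (fun _ => (Real.exp_pos _).le) (hb u) (hs2 u)
  · have h1 := Summable.tsum_le_tsum (hb u)
      (Summable.of_nonneg_of_le (fun _ => (Real.exp_pos _).le) (hb u) (hs2 u)) (hs2 u)
    rw [tsum_mul_left] at h1
    have h2 : ∑' m : ℤ, Real.exp (-c * |((m - ⌊u⌋ : ℤ) : ℝ)|) = ∑' k : ℤ, Real.exp (-c * |(k : ℝ)|) :=
      (Equiv.subRight ⌊u⌋).tsum_eq (fun k : ℤ => Real.exp (-c * |(k : ℝ)|))
    rw [h2] at h1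
    linarith

lemma Dec.shift {φ : ℝ → ℂ} (h : Dec φ) : ∃ C : ℝ, 0 < C ∧ ∀ u : ℝ,
    Summable (fun m : ℤ => ‖φ (u - m)‖) ∧ ∑' m : ℤ, ‖φ (u - m)‖ ≤ C := by
  obtain ⟨C, c, hC, hc, h⟩ := h
  obtain ⟨D, hD, hs⟩ := shift_sum c hc
  refine ⟨C * D, by positivity, fun u => ?_⟩
  have h1 : Summable (fun m : ℤ => ‖φ (u - m)‖) :=
    Summable.of_nonneg_of_le (fun _ => norm_nonneg _) (fun m => h _) ((hs u).1.mul_left C)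
  refine ⟨h1, (Summable.tsum_le_tsum (fun m => h _) h1 ((hs u).1.mul_left C)).trans ?_⟩
  rw [tsum_mul_left]
  exact mul_le_mul_of_nonneg_left (hs u).2 hC.le


/-! ### Part 12: Fourier transforms and Poisson summation -/

open FourierTransform in
/-- Fourier transform on the real line -/
def FT (φ : ℝ → ℂ) (w : ℝ) : ℂ := 𝓕 φ w

lemma exp_neg_abs_le_rpow (c : ℝ) (hc : 0 < c) :
    (fun y : ℝ => Real.exp (-c * |y|)) =O[cocompact ℝ] (fun y : ℝ => |y| ^ (-2 : ℝ)) := by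
  have h := (isLittleO_exp_neg_mul_rpow_atTop hc (-2)).isBigO
  have ht : Tendsto (fun y : ℝ => |y|) (cocompact ℝ) atTop :=
    tendsto_norm_cocompact_atTop (E := ℝ)
  exact h.comp_tendsto ht

lemma Dec.isBigO {φ : ℝ → ℂ} (h : Dec φ) : φ =O[cocompact ℝ] (fun y : ℝ => |y| ^ (-2 : ℝ)) := by
  obtain ⟨C, c, hC, hc, h⟩ := h
  refine IsBigO.trans (IsBigO.of_bound C (Eventually.of_forall fun y => ?_)) (exp_neg_abs_le_rpow c hc)
  rw [Real.norm_of_nonneg (Real.exp_pos _).le]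
  exact h y

lemma Dec.integrable {φ : ℝ → ℂ} (h : Dec φ) (hc : Continuous φ) : MeasureTheory.Integrable φ := by
  obtain ⟨C, c, hC, hcp, h⟩ := h
  have h1 : MeasureTheory.Integrable (fun y : ℝ => (1 + ‖y‖) ^ (-2 : ℝ)) :=
    integrable_one_add_norm (by simp)
  set d := min 1 (c / 2) with hd
  have hd0 : 0 < d := lt_min one_pos (by positivity)
  have hd1 : d ≤ 1 := min_le_left _ _
  have hd2 : d ≤ c / 2 := min_le_right _ _
  refine (h1.const_mul (C / d ^ 2)).mono' hc.aestronglyMeasurable (Eventually.of_forall fun y => ?_)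
  refine (h y).trans ?_
  have hy := abs_nonneg y
  have e : (1 + ‖y‖) ^ (-2 : ℝ) = ((1 + |y|) ^ 2)⁻¹ := by
    rw [Real.norm_eq_abs, Real.rpow_neg (by positivity)]; norm_cast
  have h2 : (d * (1 + |y|)) ^ 2 ≤ Real.exp (c * |y|) := by
    have h3 : d * (1 + |y|) ≤ Real.exp (c / 2 * |y|) := by
      have := Real.add_one_le_exp (c / 2 * |y|)
      nlinarith
    calc _ ≤ Real.exp (c / 2 * |y|) ^ 2 := by gcongr
      _ = _ := by rw [← Real.exp_nat_mul]; push_cast; ring_nf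
  have h4 : C / d ^ 2 * ((1 + |y|) ^ 2)⁻¹ = C * ((d * (1 + |y|)) ^ 2)⁻¹ := by
    rw [mul_pow, mul_inv]; ring
  rw [e, h4, show -c * |y| = -(c * |y|) by ring, Real.exp_neg]
  gcongr

lemma FT_deriv {φ φ' : ℝ → ℂ} (h : DD 0 φ) (h1 : ∀ y, HasDerivAt φ (φ' y) y) (h2 : DD 0 φ') (w : ℝ) :
    FT φ' w = 2 * Real.pi * I * w * FT φ w := by
  have hd : deriv φ = φ' := funext fun y => (h1 y).deriv
  have := Real.fourier_deriv (h.dec.integrable h.cont) (fun y => (h1 y).differentiableAt)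
    (by rw [hd]; exact h2.dec.integrable h2.cont)
  rw [hd] at this
  exact congrFun this w

lemma FT_norm_le (φ : ℝ → ℂ) (w : ℝ) : ‖FT φ w‖ ≤ ∫ y, ‖φ y‖ :=
  VectorFourier.norm_fourierIntegral_le_integral_norm _ _ _ _ _

lemma FT_bound {φ : ℝ → ℂ} (h : DD 2 φ) : ∃ C : ℝ, ∀ w : ℝ, w ^ 2 * ‖FT φ w‖ ≤ C := by
  have h0 := h.pred.pred
  obtain ⟨-, φ1, h1, h2⟩ := h
  have h20 := h2.pred
  obtain ⟨-, φ2, h3, h4⟩ := h2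
  refine ⟨∫ y, ‖φ2 y‖, fun w => le_trans ?_ (FT_norm_le φ2 w)⟩
  rw [FT_deriv h20 h3 h4, FT_deriv h0 h1 h20]
  have hn : ‖(2 * Real.pi * I * w : ℂ)‖ = 2 * Real.pi * |w| := by
    simp [abs_of_pos Real.pi_pos]
  rw [norm_mul (2 * Real.pi * I * w : ℂ) (2 * Real.pi * I * w * FT φ w),
    norm_mul (2 * Real.pi * I * w : ℂ) (FT φ w), hn, ← mul_assoc]
  gcongr
  have := Real.pi_gt_three
  have e : 2 * Real.pi * |w| * (2 * Real.pi * |w|) = (2 * Real.pi) ^ 2 * w ^ 2 := by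
    rw [← sq_abs w]; ring
  rw [e]
  have : 1 ≤ (2 * Real.pi) ^ 2 := by nlinarith
  nlinarith [sq_nonneg w]

lemma FT_summable {φ : ℝ → ℂ} (h : DD 2 φ) : Summable (fun k : ℤ => ‖FT φ k‖) := by
  obtain ⟨C, hC⟩ := FT_bound h
  have h1 : Summable (fun k : ℤ => 1 / |(k : ℝ)| ^ (2 : ℝ)) :=
    (Real.summable_abs_int_rpow (b := 2) (by norm_num)).congr (fun k => by
      rw [Real.rpow_neg (abs_nonneg _), one_div])
  have h2 : ∀ k : ℤ, k ≠ 0 → ‖FT φ k‖ ≤ C * (1 / |(k : ℝ)| ^ (2 : ℝ)) := by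
    intro k hk
    have hk' : (0 : ℝ) < (k : ℝ) ^ 2 := by positivity
    have e : |(k : ℝ)| ^ (2 : ℝ) = (k : ℝ) ^ 2 := by
      rw [← sq_abs]; norm_cast
    rw [e, mul_one_div, le_div_iff₀ hk', mul_comm]
    exact hC k
  refine summable_of_isBigO h1 (IsBigO.of_bound C ?_)
  have : ∀ᶠ k : ℤ in cofinite, k ≠ 0 := by
    simpa using (Set.finite_singleton (0 : ℤ)).compl_mem_cofinite
  filter_upwards [this] with k hk
  rw [norm_norm, Real.norm_of_nonneg (by positivity)]
  exact h2 k hk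

lemma poisson {φ : ℝ → ℂ} (h : DD 2 φ) (u : ℝ) :
    ∑' m : ℤ, φ (u - m) = ∑' k : ℤ, FT φ k * Complex.exp (2 * (Real.pi : ℂ) * I * (k : ℂ) * (u : ℂ)) := by
  have h1 := Real.tsum_eq_tsum_fourier_of_rpow_decay_of_summable h.cont (b := 2) (by norm_num)
    h.dec.isBigO (FT_summable h).of_norm u
  have h2 : ∑' m : ℤ, φ (u - m) = ∑' m : ℤ, φ (u + m) := by
    rw [← (Equiv.neg ℤ).tsum_eq (fun m : ℤ => φ (u + m))]
    refine tsum_congr (fun m => ?_)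
    simp [sub_eq_add_neg]
  rw [h2, h1]
  refine tsum_congr (fun k => ?_)
  rw [fourier_coe_apply]
  simp [FT]

lemma FT_b0 (a : ℝ) (ha : 0 < a) (w : ℝ) :
    FT (b0 a) w = Complex.Gamma (a - 2 * Real.pi * I * w / LR) / LR := by
  have hL := LR_pos
  set s : ℂ := (a : ℂ) - 2 * Real.pi * I * w / LR with hs
  have hsr : s.re = a := by
    have : s = ((a : ℝ) : ℂ) + ((-(2 * Real.pi * w / LR) : ℝ) : ℂ) * I := by
      rw [hs]; push_cast; ring
    rw [this]; simp
  have hsi : s.im = -(2 * Real.pi * w / LR) := by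
    have : s = ((a : ℝ) : ℂ) + ((-(2 * Real.pi * w / LR) : ℝ) : ℂ) * I := by
      rw [hs]; push_cast; ring
    rw [this]; simp
  have h1 : Complex.Gamma s = FT (fun u : ℝ => ((Real.exp (-a * u) * Real.exp (-Real.exp (-u)) : ℝ) : ℂ))
      (-w / LR) := by
    rw [Complex.Gamma_eq_integral (by rw [hsr]; exact ha), Complex.GammaIntegral_eq_mellin,
      mellin_eq_fourier, hsr, hsi, FT]
    have e1 : (fun u : ℝ => Real.exp (-a * u) • ((Real.exp (-Real.exp (-u)) : ℝ) : ℂ)) =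
        fun u : ℝ => ((Real.exp (-a * u) * Real.exp (-Real.exp (-u)) : ℝ) : ℂ) := by
      funext u
      rw [Complex.real_smul, ← Complex.ofReal_mul]
    have e2 : -(2 * Real.pi * w / LR) / (2 * Real.pi) = -w / LR := by
      have := Real.pi_pos
      field_simp
    rw [e1, e2]
  rw [h1, FT, FT, Real.fourier_real_eq, Real.fourier_real_eq]
  have h2 := MeasureTheory.Measure.integral_comp_mul_left
    (fun v : ℝ => Real.fourierChar (-(v * (-w / LR))) • ((Real.exp (-a * v) * Real.exp (-Real.exp (-v)) : ℝ) : ℂ)) (-LR)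
  have h3 : ∀ v : ℝ, Real.fourierChar (-(v * w)) • b0 a v = (fun v : ℝ => Real.fourierChar (-(v * (-w / LR))) • ((Real.exp (-a * v) * Real.exp (-Real.exp (-v)) : ℝ) : ℂ)) (-LR * v) := by
    intro v
    simp only [b0]
    have e1 : -(-LR * v * (-w / LR)) = -(v * w) := by field_simp
    have e2 : -a * (-LR * v) = a * (LR * v) := by ring
    have e3 : -(-LR * v) = LR * v := by ring
    rw [e1, e2, e3]
  rw [MeasureTheory.integral_congr_ae (Eventually.of_forall h3), h2]
  rw [abs_inv, abs_neg, abs_of_pos hL, Complex.real_smul, Complex.ofReal_inv, mul_comm, ← div_eq_mul_inv]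

lemma ne_aux (a : ℝ) (ha : a ≠ 0) (w : ℝ) : ((a : ℂ) - 2 * Real.pi * I * w / LR) ≠ 0 := by
  intro h
  have h2 := congrArg Complex.re h
  have : (a : ℂ) - 2 * Real.pi * I * w / LR = ((a : ℝ) : ℂ) + ((-(2 * Real.pi * w / LR) : ℝ) : ℂ) * I := by
    push_cast; ring
  rw [this] at h2
  simp at h2
  exact ha h2

lemma char_int {φ : ℝ → ℂ} (h : DD 0 φ) (w : ℝ) :
    MeasureTheory.Integrable (fun v : ℝ => Real.fourierChar (-(v * w)) • φ v) := by
  refine (h.dec.integrable h.cont).mono ?_ (Eventually.of_forall fun v => by rw [Circle.norm_smul])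
  refine Continuous.aestronglyMeasurable ?_
  have := h.cont
  exact (Real.continuous_fourierChar.comp (by fun_prop)).smul this

lemma FT_lin {φ ψ : ℝ → ℂ} (h1 : DD 0 φ) (h2 : DD 0 ψ) (p q : ℂ) (w : ℝ) :
    FT (fun y => p * φ y + q * ψ y) w = p * FT φ w + q * FT ψ w := by
  rw [FT, FT, FT, Real.fourier_real_eq, Real.fourier_real_eq, Real.fourier_real_eq,
    ← MeasureTheory.integral_const_mul, ← MeasureTheory.integral_const_mul, ← MeasureTheory.integral_add]
  · congr 1
    funext v
    simp only [Circle.smul_def, smul_eq_mul]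
    ring
  · exact (char_int h1 w).const_mul p
  · exact (char_int h2 w).const_mul q

lemma FT_rec {φ ψ : ℝ → ℂ} (a : ℝ) (ha : a ≠ 0) (h1 : DD 0 φ) (h2 : DD 0 ψ)
    (h : ∀ y, HasDerivAt φ (LR * a * φ y + (-LR) * ψ y) y) (w : ℝ)
    (hψ : FT ψ w = Complex.Gamma ((a + 1 : ℝ) - 2 * Real.pi * I * w / LR) / LR) :
    FT φ w = Complex.Gamma (a - 2 * Real.pi * I * w / LR) / LR := by
  have hL : (LR : ℂ) ≠ 0 := by exact_mod_cast LR_pos.ne'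
  have e1 := FT_deriv h1 h ((h1.const_mul _).add (h2.const_mul _)) w
  rw [FT_lin h1 h2, hψ] at e1
  have hne := ne_aux a ha w
  have e2 : (((a + 1 : ℝ) : ℂ) - 2 * Real.pi * I * w / LR) = (a - 2 * Real.pi * I * w / LR) + 1 := by
    push_cast; ring
  rw [e2, Complex.Gamma_add_one _ hne] at e1
  generalize Complex.Gamma (a - 2 * Real.pi * I * w / LR) = G at e1 ⊢
  generalize FT φ w = F at e1 ⊢
  have e3 : ((a : ℂ) - 2 * Real.pi * I * w / LR) * (F - G / LR) = 0 := by
    have : LR * (((a : ℂ) - 2 * Real.pi * I * w / LR) * (F - G / LR)) = 0 := by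
      have e4 : LR * ((a : ℂ) - 2 * Real.pi * I * w / LR) = LR * a - 2 * Real.pi * I * w := by
        field_simp
      have e5 : LR * (((a : ℂ) - 2 * Real.pi * I * w / LR) * (F - G / LR)) =
        LR * a * F + -LR * (((a : ℂ) - 2 * Real.pi * I * w / LR) * G / LR) - 2 * Real.pi * I * w * F := by
        linear_combination F * e4
      rw [e5, e1]; ring
    exact (mul_eq_zero.mp this).resolve_left hL
  exact sub_eq_zero.mp ((mul_eq_zero.mp e3).resolve_left hne)

lemma FT_b1 (a : ℝ) (ha : -1 < a) (ha' : a < 0) (w : ℝ) :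
    FT (b1 a) w = Complex.Gamma (a - 2 * Real.pi * I * w / LR) / LR :=
  FT_rec a ha'.ne (DD_b1 0 a ha ha') (DD_b0 0 (a + 1) (by linarith)) (hd_b1 a) w
    (FT_b0 (a + 1) (by linarith) w)

lemma FT_b2 (a : ℝ) (ha : -2 < a) (ha' : a < -1) (w : ℝ) :
    FT (b2 a) w = Complex.Gamma (a - 2 * Real.pi * I * w / LR) / LR :=
  FT_rec a (by linarith) (DD_b2 0 a ha ha') (DD_b1 0 (a + 1) (by linarith) (by linarith)) (hd_b2 a) w
    (FT_b1 (a + 1) (by linarith) (by linarith) w)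


/-! ### Part 13: scaling identities and bounds -/

lemma gExp_LR : gExp * LR = Real.log 3 := by
  unfold gExp LR Real.logb
  have := LR_pos
  unfold LR at this
  field_simp

lemma gExp_gt : 1 < gExp := by
  unfold gExp
  rw [Real.lt_logb_iff_rpow_lt (by norm_num) (by norm_num)]
  norm_num

lemma gExp_lt : gExp < 2 := by
  unfold gExp
  rw [Real.logb_lt_iff_lt_rpow (by norm_num) (by norm_num)]
  norm_num

/-- base functions -/
def bs : ℕ → ℝ → ℂ
  | 0 => b2 (0 - gExp)
  | 1 => b1 (1 - gExp)
  | s + 2 => b0 (((s + 2 : ℕ) : ℝ) - gExp)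

lemma DD_bs (k s : ℕ) : DD k (bs s) := by
  have h1 := gExp_gt
  have h2 := gExp_lt
  match s with
  | 0 => exact DD_b2 k _ (by linarith) (by linarith)
  | 1 => exact DD_b1 k _ (by linarith) (by linarith)
  | s + 2 =>
    refine DD_b0 k _ ?_
    push_cast
    have : (0 : ℝ) ≤ s := by positivity
    linarith

/-- `T = N 2^{-m}` -/
def TT2 (N : ℕ) (m : ℤ) : ℝ := N * (1 / 2 : ℝ) ^ m

/-- `log₂ N` -/
def uN (N : ℕ) : ℝ := Real.logb 2 N

lemma LR_uN (N : ℕ) : LR * uN N = Real.log N := by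
  unfold uN LR Real.logb
  have := LR_pos
  unfold LR at this
  field_simp

lemma half_zpow (m : ℤ) : (1 / 2 : ℝ) ^ m = Real.exp (-(LR * m)) := by
  have : (1 / 2 : ℝ) = Real.exp (-LR) := by
    rw [Real.exp_neg, LR, Real.exp_log (by norm_num)]; norm_num
  rw [this, ← Real.rpow_intCast, ← Real.exp_mul]; ring_nf

lemma three_zpow (m : ℤ) : (3 : ℝ) ^ m = Real.exp (gExp * (LR * m)) := by
  have : (3 : ℝ) = Real.exp (gExp * LR) := by
    rw [gExp_LR, Real.exp_log (by norm_num)]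
  rw [this, ← Real.rpow_intCast, ← Real.exp_mul]; ring_nf

lemma TT2_eq (N : ℕ) (hN : 1 ≤ N) (m : ℤ) : TT2 N m = Real.exp (LR * (uN N - m)) := by
  have : (0 : ℝ) < N := by exact_mod_cast hN
  rw [TT2, half_zpow, mul_sub, LR_uN, Real.exp_sub, Real.exp_log this, Real.exp_neg]; rfl

lemma TT2_pos (N : ℕ) (hN : 1 ≤ N) (m : ℤ) : 0 < TT2 N m := by
  rw [TT2_eq N hN]; exact Real.exp_pos _

lemma scale_eq (N : ℕ) (hN : 1 ≤ N) (m : ℤ) (j : ℕ) :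
    (3 : ℝ) ^ m * ((1 / 2 : ℝ) ^ m) ^ j =
      (N : ℝ) ^ (gExp - j) * Real.exp ((j - gExp) * (LR * (uN N - m))) := by
  have : (0 : ℝ) < N := by exact_mod_cast hN
  rw [Real.rpow_def_of_pos this, ← LR_uN, half_zpow, three_zpow, ← Real.exp_nat_mul, ← Real.exp_add,
    ← Real.exp_add]
  congr 1; ring

/-- subtraction terms -/
def sterm (N : ℕ) (m : ℤ) : ℕ → ℕ → ℂ
  | 0, 0 => 1 - (TT2 N m : ℂ)
  | 0, 1 => 1
  | _, _ => 0

lemma bs_eq (N : ℕ) (hN : 1 ≤ N) (m : ℤ) (i j : ℕ) (hij : i ≤ j) :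
    (((N : ℝ) ^ (gExp - j) : ℝ) : ℂ) * bs (i + j) (uN N - m) =
      (3 : ℂ) ^ m * ((1 / 2 : ℂ) ^ m) ^ j *
        ((TT2 N m : ℂ) ^ i * Complex.exp (-(TT2 N m : ℂ)) - sterm N m i j) := by
  have hsc := scale_eq N hN m j
  have hsc' : (3 : ℂ) ^ m * ((1 / 2 : ℂ) ^ m) ^ j =
      (((N : ℝ) ^ (gExp - j) * Real.exp ((j - gExp) * (LR * (uN N - m))) : ℝ) : ℂ) := by
    rw [← hsc]; push_cast; rfl
  rw [hsc', TT2_eq N hN]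
  match i, j, hij with
  | 0, 0, _ =>
    simp only [bs, b2, sterm, TT2_eq N hN]
    push_cast; ring_nf
  | 0, 1, _ =>
    simp only [bs, b1, sterm]
    push_cast; ring_nf
  | 0, j + 2, _ =>
    rw [show 0 + (j + 2) = j + 2 from zero_add _]
    simp only [bs, b0, sterm]
    push_cast; ring_nf
  | i + 1, j + 1, _ =>
    have e1 : i + 1 + (j + 1) = (i + j) + 2 := by ring
    rw [e1]
    simp only [bs, b0, sterm, sub_zero]
    rw [← Complex.ofReal_pow, ← Real.exp_nat_mul, ← Complex.ofReal_neg, ← Complex.ofReal_exp,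
      ← Complex.ofReal_mul, ← Complex.ofReal_mul, ← Complex.ofReal_mul, mul_assoc (_ ^ _)]
    simp only [← Real.exp_add]
    congr 3
    push_cast; ring

/-- full expanded terms -/
def AA (f : ℕ → ℕ → ℕ → ℂ) (J N : ℕ) (m : ℤ) : ℂ :=
  (3 : ℂ) ^ m / 9 * ∑ j ∈ Finset.range J, ((1 / 2 : ℂ) ^ m) ^ j * ∑ l ∈ Finset.range (j + 1), (m : ℂ) ^ l *
    ∑ i ∈ Finset.range (j + 1), f i j l * ((TT2 N m : ℂ) ^ i * Complex.exp (-(TT2 N m : ℂ)))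

/-- renormalized expanded terms -/
def AT (f : ℕ → ℕ → ℕ → ℂ) (J N : ℕ) (m : ℤ) : ℂ :=
  ∑ j ∈ Finset.range J, ∑ l ∈ Finset.range (j + 1), ∑ i ∈ Finset.range (j + 1),
    f i j l / 9 * (((N : ℝ) ^ (gExp - j) : ℝ) : ℂ) * ((m : ℂ) ^ l * bs (i + j) (uN N - m))

/-- subtracted part -/
def ss (f : ℕ → ℕ → ℕ → ℂ) (N : ℕ) (m : ℤ) : ℂ :=
  (f 0 0 0 * (3 : ℂ) ^ m + (f 0 1 0 - N * f 0 0 0 + f 0 1 1 * m) * (3 / 2 : ℂ) ^ m) / 9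

/-- antidifference of `ss` -/
def SS (f : ℕ → ℕ → ℕ → ℂ) (N : ℕ) (m : ℤ) : ℂ :=
  (f 0 0 0 * (3 : ℂ) ^ m / 2 + (2 * (f 0 1 0 - N * f 0 0 0) - 6 * f 0 1 1 + 2 * f 0 1 1 * m) * (3 / 2 : ℂ) ^ m) / 9

lemma SS_diff (f : ℕ → ℕ → ℕ → ℂ) (N : ℕ) (m : ℤ) : SS f N (m + 1) - SS f N m = ss f N m := by
  unfold SS ss
  rw [zpow_add_one₀ (by norm_num), zpow_add_one₀ (by norm_num)]
  push_cast; ring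

lemma AA_eq (f : ℕ → ℕ → ℕ → ℂ) (J N : ℕ) (hN : 1 ≤ N) (m : ℤ) :
    AA f (J + 2) N m = AT f (J + 2) N m + ss f N m := by
  have h1 : AA f (J + 2) N m - AT f (J + 2) N m = ∑ j ∈ Finset.range (J + 2), ∑ l ∈ Finset.range (j + 1),
      ∑ i ∈ Finset.range (j + 1), (3 : ℂ) ^ m / 9 * ((1 / 2 : ℂ) ^ m) ^ j * (m : ℂ) ^ l * f i j l * sterm N m i j := by
    unfold AA AT
    simp only [Finset.mul_sum]
    rw [← Finset.sum_sub_distrib]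
    refine Finset.sum_congr rfl (fun j _ => ?_)
    rw [← Finset.sum_sub_distrib]
    refine Finset.sum_congr rfl (fun l _ => ?_)
    rw [← Finset.sum_sub_distrib]
    refine Finset.sum_congr rfl (fun i hi => ?_)
    have hb := bs_eq N hN m i j (by have := Finset.mem_range.mp hi; omega)
    linear_combination (-(f i j l / 9 * (m : ℂ) ^ l)) * hb
  have h2 : ∑ j ∈ Finset.range (J + 2), ∑ l ∈ Finset.range (j + 1),
      ∑ i ∈ Finset.range (j + 1), (3 : ℂ) ^ m / 9 * ((1 / 2 : ℂ) ^ m) ^ j * (m : ℂ) ^ l * f i j l * sterm N m i j =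
      ss f N m := by
    rw [Finset.sum_range_succ', Finset.sum_range_succ']
    rw [Finset.sum_eq_zero]
    · simp only [Finset.sum_range_succ, Finset.sum_range_zero, sterm, ss, TT2]
      push_cast
      rw [show (3 / 2 : ℂ) = 3 * (1 / 2) by norm_num, mul_zpow]
      ring
    · intro j _
      refine Finset.sum_eq_zero (fun l _ => Finset.sum_eq_zero (fun i _ => ?_))
      have : sterm N m i (j + 1 + 1) = 0 := by
        cases i <;> rfl
      rw [this, mul_zero]
  rw [← h2, ← h1]; ring


/-! ### Part 14: remainder bounds -/

lemma Dec.mul_one_abs {φ : ℝ → ℂ} (h : Dec φ) (J : ℕ) :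
    Dec (fun y => (((1 + |y|) ^ J : ℝ) : ℂ) * φ y) := by
  induction J with
  | zero => simpa using h
  | succ J ih =>
    have h1 : Dec (fun y => ((‖(((1 + |y|) ^ J : ℝ) : ℂ) * φ y‖ : ℝ) : ℂ)) := ih.mono (fun y => by simp)
    have h2 : Dec (fun y => ((‖(y : ℂ) * ((((1 + |y|) ^ J : ℝ) : ℂ) * φ y)‖ : ℝ) : ℂ)) :=
      ih.mul_y.mono (fun y => by simp)
    refine (h1.add h2).mono (fun y => ?_)
    rw [← Complex.ofReal_add, Complex.norm_real, Real.norm_of_nonneg (by positivity), norm_mul, norm_mul, norm_mul,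
      norm_mul, Complex.norm_real, Complex.norm_real, Complex.norm_real, Real.norm_of_nonneg (by positivity), Real.norm_of_nonneg (by positivity),
      Real.norm_eq_abs]
    apply le_of_eq; ring

def psi (J : ℕ) (y : ℝ) : ℂ := ((Real.exp ((J - gExp) * (LR * y)) * (1 + |y|) ^ J *
  ((1 + Real.exp (LR * y)) ^ J * Real.exp (-Real.exp (LR * y) / 2)) : ℝ) : ℂ)

lemma dec_psi (J : ℕ) (hJ : 2 ≤ J) : Dec (psi J) := by
  have hg := gExp_lt
  have hJ' : (2 : ℝ) ≤ J := by exact_mod_cast hJ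
  have h1 := dec_half (J - gExp) (by linarith)
  have h2 := dec_half (2 * J - gExp) (by linarith)
  refine (((h1.add h2).mul_one_abs J).const_mul ((2 : ℂ) ^ (J - 1))).mono (fun y => ?_)
  rw [← Complex.ofReal_add, ← Complex.ofReal_mul, psi]
  rw [norm_mul, norm_pow, Complex.norm_real, Complex.norm_real, Real.norm_of_nonneg (by positivity),
    Real.norm_of_nonneg (by positivity)]
  have h3 := add_pow_le (zero_le_one (α := ℝ)) (Real.exp_pos (LR * y)).le J
  have e : Real.exp ((2 * J - gExp) * (LR * y)) = Real.exp ((J - gExp) * (LR * y)) * Real.exp (LR * y) ^ J := by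
    rw [← Real.exp_nat_mul, ← Real.exp_add]; ring_nf
  rw [e]
  calc _ ≤ Real.exp ((J - gExp) * (LR * y)) * (1 + |y|) ^ J *
      ((2 ^ (J - 1) * (1 ^ J + Real.exp (LR * y) ^ J)) * Real.exp (-Real.exp (LR * y) / 2)) := by gcongr
    _ = _ := by simp; ring

def chi (J : ℕ) (y : ℝ) : ℂ := (((1 + |y|) ^ J : ℝ) : ℂ) * ((Real.exp (-|y|) : ℝ) : ℂ)

lemma dec_chi (J : ℕ) : Dec (chi J) := by
  refine Dec.mul_one_abs ⟨1, 1, one_pos, one_pos, fun y => ?_⟩ J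
  rw [Complex.norm_real, Real.norm_of_nonneg (Real.exp_pos _).le]; simp

lemma pow_mul_exp_neg_le (T : ℝ) (hT : 0 ≤ T) (n : ℕ) : T ^ n * Real.exp (-T) ≤ n.factorial := by
  have := Real.pow_div_factorial_le_exp T hT n
  rw [div_le_iff₀ (by positivity)] at this
  rw [Real.exp_neg, ← div_eq_mul_inv, div_le_iff₀ (Real.exp_pos _)]
  linarith

lemma log_three_ge : 1 ≤ Real.log 3 := by
  rw [Real.le_log_iff_exp_le (by norm_num)]
  have := Real.exp_one_lt_d9
  linarith

lemma three_zpow_le (m1 : ℕ) (m : ℤ) (hm : m < m1) :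
    (3 : ℝ) ^ m ≤ 3 ^ (2 * m1) * Real.exp (-|(m : ℝ)|) := by
  have h3 := log_three_ge
  have e : (3 : ℝ) ^ (2 * m1) = Real.exp (2 * m1 * Real.log 3) := by
    rw [← Real.exp_log (show (0 : ℝ) < 3 by norm_num), ← Real.exp_nat_mul, Real.exp_log (by norm_num)]
    push_cast; rfl
  rw [three_zpow, e, ← Real.exp_add]
  apply Real.exp_le_exp.mpr
  rw [← mul_assoc, gExp_LR]
  have hm' : (m : ℝ) < m1 := by exact_mod_cast hm
  have hm1 : (0 : ℝ) ≤ m1 := by positivity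
  rcases le_total 0 (m : ℝ) with h | h
  · rw [abs_of_nonneg h]; nlinarith
  · rw [abs_of_nonpos h]; nlinarith

lemma AA_term_bound (J m1 : ℕ) (N : ℕ) (hN : 1 ≤ N) (m : ℤ) (hm : m < m1) (i j : ℕ) (hj : j < J) (hi : i ≤ j) :
    ((1 / 2 : ℝ) ^ m) ^ j * (TT2 N m ^ i * Real.exp (-TT2 N m)) ≤
      ((N : ℝ)⁻¹) ^ J * ((2 * J).factorial * (2 ^ m1) ^ J) := by
  have hN0 : (0 : ℝ) < N := by exact_mod_cast hN
  have hT := TT2_pos N hN m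
  set T := TT2 N m with hTd
  set z : ℝ := (2 : ℝ) ^ m with hz
  have hz0 : 0 < z := by positivity
  have hx : (1 / 2 : ℝ) ^ m = z⁻¹ := by rw [one_div, inv_zpow]
  have hNz : (N : ℝ) = T * z := by
    rw [hTd, TT2, hx]; field_simp
  have hz1 : z ≤ 2 ^ m1 := by
    rw [hz, ← zpow_natCast]
    exact zpow_le_zpow_right₀ (by norm_num) hm.le
  have h1 := pow_mul_exp_neg_le T hT.le (i + J)
  have h2 : ((i + J).factorial : ℝ) ≤ (2 * J).factorial := by
    exact_mod_cast Nat.factorial_le (by omega)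
  have h3 : z ^ (J - j) ≤ (2 ^ m1) ^ J :=
    calc z ^ (J - j) ≤ ((2 : ℝ) ^ m1) ^ (J - j) := by gcongr
      _ ≤ _ := pow_le_pow_right₀ (one_le_pow₀ (by norm_num)) (by omega)
  have h4 : (N : ℝ) ^ J * (z⁻¹ ^ j * (T ^ i * Real.exp (-T))) =
      (T ^ (i + J) * Real.exp (-T)) * z ^ (J - j) := by
    have : z ^ J = z ^ (J - j) * z ^ j := by rw [← pow_add]; congr 1; omega
    rw [hNz, mul_pow, this, pow_add, inv_pow]
    field_simp
  rw [hx, inv_pow (N : ℝ), ← div_eq_inv_mul, le_div_iff₀ (by positivity), mul_comm, h4]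
  exact mul_le_mul (h1.trans h2) h3 (by positivity) (by positivity)

lemma AA_bound (f : ℕ → ℕ → ℕ → ℂ) (J m1 : ℕ) : ∃ C : ℝ, 0 < C ∧ ∀ N : ℕ, 1 ≤ N → ∀ m : ℤ, m < m1 →
    ‖AA f J N m‖ ≤ C * ((N : ℝ)⁻¹) ^ J * ‖chi J m‖ := by
  set F : ℝ := ∑ j ∈ Finset.range J, ∑ l ∈ Finset.range (j + 1), ∑ i ∈ Finset.range (j + 1), ‖f i j l‖ with hF
  have hF0 : 0 ≤ F := by positivity
  set K : ℝ := (2 * J).factorial * (2 ^ m1) ^ J with hK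
  have hK0 : 0 < K := by positivity
  refine ⟨3 ^ (2 * m1) / 9 * K * (F + 1), by positivity, fun N hN m hm => ?_⟩
  have h3 := three_zpow_le m1 m hm
  have hN0 : (0 : ℝ) < N := by exact_mod_cast hN
  have hT := TT2_pos N hN m
  have hchi : ‖chi J m‖ = (1 + |(m : ℝ)|) ^ J * Real.exp (-|(m : ℝ)|) := by
    rw [chi, norm_mul, Complex.norm_real, Complex.norm_real, Real.norm_of_nonneg (by positivity),
      Real.norm_of_nonneg (by positivity)]
  have hsum : ‖∑ j ∈ Finset.range J, ((1 / 2 : ℂ) ^ m) ^ j * ∑ l ∈ Finset.range (j + 1), (m : ℂ) ^ l *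
    ∑ i ∈ Finset.range (j + 1), f i j l * ((TT2 N m : ℂ) ^ i * Complex.exp (-(TT2 N m : ℂ)))‖ ≤
      F * (((N : ℝ)⁻¹) ^ J * K * (1 + |(m : ℝ)|) ^ J) := by
    simp only [Finset.mul_sum]
    rw [hF, Finset.sum_mul]
    refine (norm_sum_le _ _).trans (Finset.sum_le_sum fun j hj => ?_)
    rw [Finset.sum_mul]
    refine (norm_sum_le _ _).trans (Finset.sum_le_sum fun l hl => ?_)
    rw [Finset.sum_mul]
    refine (norm_sum_le _ _).trans (Finset.sum_le_sum fun i hi => ?_)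
    have hj' := Finset.mem_range.mp hj
    have hl' := Finset.mem_range.mp hl
    have hi' := Finset.mem_range.mp hi
    have hb := AA_term_bound J m1 N hN m hm i j hj' (by omega)
    have hml : |(m : ℝ)| ^ l ≤ (1 + |(m : ℝ)|) ^ J :=
      calc |(m : ℝ)| ^ l ≤ (1 + |(m : ℝ)|) ^ l := by gcongr; linarith
        _ ≤ _ := pow_le_pow_right₀ (by linarith [abs_nonneg (m : ℝ)]) (by omega)
    have e1 : ‖((1 / 2 : ℂ) ^ m) ^ j‖ = ((1 / 2 : ℝ) ^ m) ^ j := by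
      rw [norm_pow, norm_zpow]; norm_num
    have e2 : ‖(m : ℂ) ^ l‖ = |(m : ℝ)| ^ l := by
      rw [norm_pow, Complex.norm_intCast]
    have e3 : ‖(TT2 N m : ℂ) ^ i * Complex.exp (-(TT2 N m : ℂ))‖ = TT2 N m ^ i * Real.exp (-TT2 N m) := by
      rw [← Complex.ofReal_neg, ← Complex.ofReal_exp, ← Complex.ofReal_pow, ← Complex.ofReal_mul,
        Complex.norm_real, Real.norm_of_nonneg (by positivity)]
    rw [norm_mul, norm_mul, norm_mul (f i j l), e1, e2, e3]
    calc _ = ‖f i j l‖ * ((((1 / 2 : ℝ) ^ m) ^ j * (TT2 N m ^ i * Real.exp (-TT2 N m))) * |(m : ℝ)| ^ l) := by ring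
      _ ≤ _ := by gcongr
  rw [AA, norm_mul, norm_div, norm_zpow, hchi]
  have e9 : ‖(9 : ℂ)‖ = 9 := by norm_num
  have e3 : ‖(3 : ℂ)‖ = 3 := by norm_num
  rw [e9, e3]
  calc _ ≤ (3 ^ (2 * m1) * Real.exp (-|(m : ℝ)|)) / 9 * (F * (((N : ℝ)⁻¹) ^ J * K * (1 + |(m : ℝ)|) ^ J)) := by
        gcongr
    _ ≤ (3 ^ (2 * m1) * Real.exp (-|(m : ℝ)|)) / 9 * ((F + 1) * (((N : ℝ)⁻¹) ^ J * K * (1 + |(m : ℝ)|) ^ J)) := by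
        gcongr; linarith
    _ = _ := by ring

def rem (Rt Kt : ℂ × ℂ → ℂ) (f : ℕ → ℕ → ℕ → ℂ) (m1 J N : ℕ) (m : ℤ) : ℂ :=
  (if (m1 : ℤ) ≤ m then (3 : ℂ) ^ m / 9 * (Rt (ppt m.toNat) *
    Complex.exp (-((TT2 N m : ℂ) * (1 + Kt (ppt m.toNat))))) else 0) - AA f J N m

lemma rem_bound {Rt Kt : ℂ × ℂ → ℂ} {f : ℕ → ℕ → ℕ → ℂ} {m1 J : ℕ} (hJ : 2 ≤ J) (hm1 : 1 ≤ m1)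
    (hE : ∃ C : ℝ, 0 < C ∧ ∀ m : ℕ, m1 ≤ m → ∀ T : ℝ, 0 ≤ T →
      ‖Rt (ppt m) * Complex.exp (-(T * (1 + Kt (ppt m)))) -
        ∑ j ∈ Finset.range J, ((1 / 2 : ℂ) ^ m) ^ j * ∑ l ∈ Finset.range (j + 1), (m : ℂ) ^ l *
          ∑ i ∈ Finset.range (j + 1), f i j l * ((T : ℂ) ^ i * Complex.exp (-T))‖ ≤
      C * (m * (1 / 2 : ℝ) ^ m) ^ J * ((1 + T) ^ J * Real.exp (-T / 2))) :
    ∃ C : ℝ, 0 < C ∧ ∀ N : ℕ, 2 ≤ N → Summable (fun m : ℤ => ‖rem Rt Kt f m1 J N m‖) ∧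
      ∑' m : ℤ, ‖rem Rt Kt f m1 J N m‖ ≤ C * (N : ℝ) ^ (gExp - J) * uN N ^ J := by
  obtain ⟨C1, hC1, h1⟩ := hE
  obtain ⟨C2, hC2, h2⟩ := AA_bound f J m1
  obtain ⟨D1, hD1, hs1⟩ := (dec_psi J hJ).shift
  obtain ⟨D2, hD2, hs2⟩ := (dec_chi J).shift
  refine ⟨C1 * D1 + C2 * D2, by positivity, fun N hN => ?_⟩
  have hN0 : (0 : ℝ) < N := by exact_mod_cast (by omega : 0 < N)
  have hN1 : (1 : ℝ) ≤ N := by exact_mod_cast (by omega : 1 ≤ N)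
  have hu : 1 ≤ uN N := by
    rw [uN, Real.le_logb_iff_rpow_le (by norm_num) hN0]
    simpa using (by exact_mod_cast hN : (2 : ℝ) ≤ N)
  set P : ℝ := (N : ℝ) ^ (gExp - J) * uN N ^ J with hP
  have hP0 : 0 < P := by positivity
  have hNJ : ((N : ℝ)⁻¹) ^ J ≤ P := by
    have e1 : ((N : ℝ)⁻¹) ^ J ≤ (N : ℝ) ^ (gExp - J) := by
      rw [inv_pow, ← Real.rpow_natCast, ← Real.rpow_neg hN0.le]
      apply Real.rpow_le_rpow_of_exponent_le hN1
      linarith [gExp_gt]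
    calc _ ≤ (N : ℝ) ^ (gExp - J) * 1 := by rw [mul_one]; exact e1
      _ ≤ _ := by rw [hP]; gcongr; exact one_le_pow₀ hu
  have hchieq : ∀ m : ℤ, ‖chi J m‖ = ‖chi J ((0 : ℝ) - m)‖ := by
    intro m; simp [chi]
  have hb : ∀ m : ℤ, ‖rem Rt Kt f m1 J N m‖ ≤ C1 * P * ‖psi J (uN N - m)‖ + C2 * P * ‖chi J ((0 : ℝ) - m)‖ := by
    intro m
    by_cases hm : (m1 : ℤ) ≤ m
    · obtain ⟨n, rfl⟩ := Int.eq_ofNat_of_zero_le (by omega : 0 ≤ m)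
      have hn : m1 ≤ n := by exact_mod_cast hm
      have hT := TT2_pos N (by omega) (n : ℤ)
      have := h1 n hn (TT2 N n) hT.le
      have e1 : rem Rt Kt f m1 J N n = (3 : ℂ) ^ n / 9 * (Rt (ppt n) * Complex.exp (-(TT2 N n * (1 + Kt (ppt n)))) -
        ∑ j ∈ Finset.range J, ((1 / 2 : ℂ) ^ n) ^ j * ∑ l ∈ Finset.range (j + 1), (n : ℂ) ^ l *
          ∑ i ∈ Finset.range (j + 1), f i j l * ((TT2 N n : ℂ) ^ i * Complex.exp (-TT2 N n))) := by
        rw [rem, if_pos hm, AA, Int.toNat_natCast, mul_sub]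
        simp only [zpow_natCast, Int.cast_natCast]
      rw [e1, norm_mul, norm_div, norm_pow, show ‖(3 : ℂ)‖ = 3 by norm_num, show ‖(9 : ℂ)‖ = 9 by norm_num]
      have e2 : ‖psi J (uN N - (n : ℤ))‖ = Real.exp ((J - gExp) * (LR * (uN N - (n : ℤ)))) * (1 + |uN N - (n : ℤ)|) ^ J *
          ((1 + TT2 N n) ^ J * Real.exp (-TT2 N n / 2)) := by
        rw [psi, Complex.norm_real, Real.norm_of_nonneg (by positivity), ← TT2_eq N (by omega)]
      have hsc := scale_eq N (by omega) n J
      have hnu : (n : ℝ) ≤ uN N * (1 + |uN N - (n : ℤ)|) := by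
        push_cast
        have ha := neg_abs_le (uN N - n)
        have hb := abs_nonneg (uN N - n)
        nlinarith
      calc _ ≤ (3 : ℝ) ^ n / 9 * (C1 * (n * (1 / 2 : ℝ) ^ n) ^ J * ((1 + TT2 N n) ^ J * Real.exp (-TT2 N n / 2))) := by
            gcongr
        _ = (1 / 9) * (C1 * (((3 : ℝ) ^ (n : ℤ) * ((1 / 2 : ℝ) ^ (n : ℤ)) ^ J) * (n : ℝ) ^ J * ((1 + TT2 N n) ^ J * Real.exp (-TT2 N n / 2)))) := by
            rw [mul_pow, zpow_natCast, zpow_natCast]; ring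
        _ ≤ 1 * (C1 * (((3 : ℝ) ^ (n : ℤ) * ((1 / 2 : ℝ) ^ (n : ℤ)) ^ J) * (uN N * (1 + |uN N - (n : ℤ)|)) ^ J * ((1 + TT2 N n) ^ J * Real.exp (-TT2 N n / 2)))) := by
            gcongr; norm_num
        _ = C1 * P * ‖psi J (uN N - (n : ℤ))‖ := by
            rw [hsc, e2, hP, mul_pow]; ring
        _ ≤ _ := by
            have : 0 ≤ C2 * P * ‖chi J ((0 : ℝ) - (n : ℤ))‖ := by positivity
            linarith
    · rw [rem, if_neg hm, zero_sub, norm_neg]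
      have h3 := h2 N (by omega) m (by omega)
      have : 0 ≤ C1 * P * ‖psi J (uN N - m)‖ := by positivity
      calc _ ≤ C2 * ((N : ℝ)⁻¹) ^ J * ‖chi J m‖ := h3
        _ ≤ C2 * P * ‖chi J m‖ := by gcongr
        _ = C2 * P * ‖chi J ((0 : ℝ) - m)‖ := by rw [hchieq]
        _ ≤ _ := by linarith
  have hS := ((hs1 (uN N)).1.mul_left (C1 * P)).add ((hs2 0).1.mul_left (C2 * P))
  have hsum := Summable.of_nonneg_of_le (fun m => norm_nonneg _) hb hS
  refine ⟨hsum, (Summable.tsum_le_tsum hb hsum hS).trans ?_⟩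
  rw [Summable.tsum_add ((hs1 (uN N)).1.mul_left (C1 * P)) ((hs2 0).1.mul_left (C2 * P)), tsum_mul_left, tsum_mul_left]
  calc _ ≤ C1 * P * D1 + C2 * P * D2 := by
        gcongr
        · exact (hs1 _).2
        · exact (hs2 _).2
    _ = _ := by rw [hP]; ring


/-! ### Part 15: Fourier coefficients -/

/-- polynomially weighted base functions -/
def Th (s k : ℕ) (y : ℝ) : ℂ := (-(y : ℂ)) ^ k * bs s y

lemma DD_Th (n s k : ℕ) : DD n (Th s k) := by
  induction k with
  | zero =>
    have e2 : Th s 0 = bs s := funext (fun y => by simp [Th])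
    rw [e2]; exact DD_bs n s
  | succ k ih =>
    have e2 : Th s (k + 1) = fun y : ℝ => (-1 : ℂ) * ((y : ℂ) * Th s k y) :=
      funext (fun y => by simp only [Th]; ring)
    rw [e2]; exact (ih.mul_y).const_mul (-1)

/-- the Fourier exponential -/
def fe (u : ℝ) (k : ℤ) : ℂ := Complex.exp (2 * (Real.pi : ℂ) * Complex.I * (k : ℂ) * (u : ℂ))

lemma norm_fe (u : ℝ) (k : ℤ) : ‖fe u k‖ = 1 := by
  rw [fe, show 2 * (Real.pi : ℂ) * Complex.I * (k : ℂ) * (u : ℂ) = ((2 * Real.pi * k * u : ℝ) : ℂ) * Complex.I by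
    push_cast; ring]
  exact Complex.norm_exp_ofReal_mul_I _

lemma summable_fe {c : ℤ → ℂ} (h : Summable (fun k => ‖c k‖)) (u : ℝ) :
    Summable (fun k => c k * fe u k) := by
  refine Summable.of_norm ?_
  have e2 : (fun k => ‖c k * fe u k‖) = fun k => ‖c k‖ := funext (fun k => by rw [norm_mul, norm_fe, mul_one])
  rw [e2]; exact h

lemma norm_tsum_fe {c : ℤ → ℂ} (h : Summable (fun k => ‖c k‖)) (u : ℝ) :
    ‖∑' k, c k * fe u k‖ ≤ ∑' k, ‖c k‖ := by
  have e2 : (fun k => ‖c k * fe u k‖) = fun k => ‖c k‖ := funext (fun k => by rw [norm_mul, norm_fe, mul_one])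
  refine (norm_tsum_le_tsum_norm (by rw [e2]; exact h)).trans (le_of_eq ?_)
  rw [e2]

/-- the coefficients of the expansion -/
def cc (f : ℕ → ℕ → ℕ → ℂ) (j p : ℕ) (k : ℤ) : ℂ :=
  ∑ l ∈ Finset.range (j + 1), ∑ i ∈ Finset.range (j + 1),
    f i j l / 9 * (l.choose p : ℂ) * ((LR : ℂ)⁻¹) ^ p * FT (Th (i + j) (l - p)) k

lemma cc_summable (f : ℕ → ℕ → ℕ → ℂ) (j p : ℕ) : Summable (fun k : ℤ => ‖cc f j p k‖) := by
  unfold cc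
  refine Summable.norm ?_
  refine summable_sum (fun l _ => summable_sum (fun i _ => ?_))
  exact (FT_summable (DD_Th 2 _ _)).of_norm.mul_left _

lemma hasSum_Th (s k : ℕ) (u : ℝ) :
    HasSum (fun m : ℤ => Th s k (u - m)) (∑' n : ℤ, FT (Th s k) n * fe u n) := by
  obtain ⟨C, _, h⟩ := (DD_Th 2 s k).dec.shift
  have h1 := ((h u).1).of_norm.hasSum
  rw [poisson (DD_Th 2 s k) u] at h1
  exact h1

lemma tsum_cc (f : ℕ → ℕ → ℕ → ℂ) (j p : ℕ) (u : ℝ) :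
    ∑' k : ℤ, cc f j p k * fe u k = ∑ l ∈ Finset.range (j + 1), ∑ i ∈ Finset.range (j + 1),
    f i j l / 9 * (l.choose p : ℂ) * ((LR : ℂ)⁻¹) ^ p * ∑' n : ℤ, FT (Th (i + j) (l - p)) n * fe u n := by
  refine HasSum.tsum_eq ?_
  simp only [cc, Finset.sum_mul]
  refine hasSum_sum (fun l _ => hasSum_sum (fun i _ => ?_))
  have h1 := ((summable_fe (FT_summable (DD_Th 2 (i + j) (l - p))) u).hasSum).mul_left
    (f i j l / 9 * (l.choose p : ℂ) * ((LR : ℂ)⁻¹) ^ p)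
  simpa only [mul_assoc] using h1

lemma pow_split (l j : ℕ) (hl : l < j + 1) (u m : ℂ) :
    m ^ l = ∑ p ∈ Finset.range (j + 1), u ^ p * (l.choose p : ℂ) * (-(u - m)) ^ (l - p) := by
  have h1 : m ^ l = (u + (-(u - m))) ^ l := by congr 1; ring
  rw [h1, add_pow]
  refine (Finset.sum_subset (s₁ := Finset.range (l + 1)) (s₂ := Finset.range (j + 1)) (Finset.range_mono (by omega)) (fun p _ hp => ?_)).trans ?_
  · rw [Finset.mem_range, not_lt] at hp
    rw [Nat.choose_eq_zero_of_lt (by omega)]; simp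
  · exact Finset.sum_congr rfl (fun p _ => by ring)

/-- main expansion -/
def Xi (f : ℕ → ℕ → ℕ → ℂ) (J N : ℕ) : ℂ :=
  (((N : ℝ) ^ gExp : ℝ) : ℂ) * ∑ j ∈ Finset.range J, ((N : ℂ)⁻¹) ^ j *
    ∑ l ∈ Finset.range (j + 1), ((Real.log N : ℝ) : ℂ) ^ l * ∑' k : ℤ, cc f j l k * fe (uN N) k

lemma hasSum_AT (f : ℕ → ℕ → ℕ → ℂ) (J N : ℕ) (hN : 1 ≤ N) :
    HasSum (fun m : ℤ => AT f J N m) (Xi f J N) := by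
  have hN0 : (0 : ℝ) < N := by exact_mod_cast hN
  have hX : Xi f J N = ∑ j ∈ Finset.range J, ∑ l ∈ Finset.range (j + 1), ∑ i ∈ Finset.range (j + 1),
      f i j l / 9 * (((N : ℝ) ^ (gExp - j) : ℝ) : ℂ) * ∑ p ∈ Finset.range (j + 1),
        ((uN N : ℂ) ^ p * (l.choose p : ℂ)) * ∑' n : ℤ, FT (Th (i + j) (l - p)) n * fe (uN N) n := by
    unfold Xi
    rw [Finset.mul_sum]
    refine Finset.sum_congr rfl (fun j _ => ?_)
    have e1 : (((N : ℝ) ^ (gExp - j) : ℝ) : ℂ) = (((N : ℝ) ^ gExp : ℝ) : ℂ) * ((N : ℂ)⁻¹) ^ j := by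
      rw [Real.rpow_sub hN0, Real.rpow_natCast]; push_cast; rw [div_eq_mul_inv, inv_pow]
    rw [← mul_assoc, ← e1]
    simp only [tsum_cc, Finset.mul_sum]
    rw [Finset.sum_comm]
    refine Finset.sum_congr rfl (fun l _ => ?_)
    rw [Finset.sum_comm]
    refine Finset.sum_congr rfl (fun i _ => Finset.sum_congr rfl (fun p _ => ?_))
    have e3 : (uN N : ℂ) = ((Real.log N : ℝ) : ℂ) * (LR : ℂ)⁻¹ := by
      rw [← LR_uN]
      have : (LR : ℂ) ≠ 0 := by exact_mod_cast LR_pos.ne'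
      push_cast
      field_simp
    rw [e3, mul_pow]; ring
  rw [hX]
  unfold AT
  refine hasSum_sum (fun j _ => hasSum_sum (fun l hl => hasSum_sum (fun i _ => ?_)))
  refine HasSum.mul_left _ ?_
  have h2 := hasSum_sum (s := Finset.range (j + 1)) (fun p _ => (hasSum_Th (i + j) (l - p) (uN N)).mul_left
    ((uN N : ℂ) ^ p * (l.choose p : ℂ)))
  have e2 : (fun m : ℤ => (m : ℂ) ^ l * bs (i + j) (uN N - m)) = fun m : ℤ => ∑ p ∈ Finset.range (j + 1),
      ((uN N : ℂ) ^ p * (l.choose p : ℂ)) * Th (i + j) (l - p) (uN N - m) := by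
    funext m
    rw [pow_split l j (Finset.mem_range.mp hl) (uN N : ℂ) m, Finset.sum_mul]
    refine Finset.sum_congr rfl (fun p _ => ?_)
    simp only [Th]; push_cast; ring
  rw [e2]; exact h2


/-! ### Part 16: combining -/

lemma SS_tendsto (f : ℕ → ℕ → ℕ → ℂ) (N : ℕ) :
    Tendsto (fun K : ℕ => SS f N (2 - K)) atTop (𝓝 0) := by
  have z1 : Tendsto (fun M : ℕ => (1 / 3 : ℂ) ^ M) atTop (𝓝 0) :=
    tendsto_pow_atTop_nhds_zero_of_norm_lt_one (by norm_num)
  have z2 : Tendsto (fun M : ℕ => (2 / 3 : ℂ) ^ M) atTop (𝓝 0) :=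
    tendsto_pow_atTop_nhds_zero_of_norm_lt_one (by norm_num)
  have z3 : Tendsto (fun M : ℕ => (M : ℂ) * (2 / 3 : ℂ) ^ M) atTop (𝓝 0) :=
    by
    have h0 := (summable_pow_mul_geometric_of_norm_lt_one (R := ℂ) 1 (r := 2 / 3) (by norm_num)).tendsto_atTop_zero
    simpa using h0
  have h := ((z1.const_mul (f 0 0 0 * 9 / 18)).add (z2.const_mul ((2 * (f 0 1 0 - N * f 0 0 0) - 6 * f 0 1 1 + 4 * f 0 1 1) * (9 / 4) / 9))).add
    (z3.const_mul (-2 * f 0 1 1 * (9 / 4) / 9))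
  simp only [mul_zero, add_zero] at h
  refine h.congr (fun K => ?_)
  unfold SS
  rw [zpow_sub₀ (by norm_num), zpow_sub₀ (by norm_num), zpow_natCast, zpow_natCast]
  have e1 : (1 / 3 : ℂ) ^ K = ((3 : ℂ) ^ K)⁻¹ := by rw [one_div, inv_pow]
  have e2 : (2 / 3 : ℂ) ^ K = ((3 / 2 : ℂ) ^ K)⁻¹ := by rw [← inv_pow]; norm_num
  rw [e1, e2]
  push_cast
  norm_num [div_eq_mul_inv]
  ring

lemma SS_sum (f : ℕ → ℕ → ℕ → ℂ) (N M : ℕ) :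
    ∑ n ∈ Finset.range M, ss f N ((n : ℤ) + 2) = SS f N ((M : ℤ) + 2) - SS f N 2 := by
  induction M with
  | zero => simp
  | succ M ih =>
    rw [Finset.sum_range_succ, ih, ← SS_diff]
    push_cast
    rw [show (M : ℤ) + 1 + 2 = (M : ℤ) + 2 + 1 by ring]; ring

lemma SS_sum_neg (f : ℕ → ℕ → ℕ → ℂ) (N M : ℕ) :
    ∑ k ∈ Finset.range M, ss f N (1 - (k : ℤ)) = SS f N 2 - SS f N (2 - (M : ℤ)) := by
  induction M with
  | zero => simp
  | succ M ih =>
    rw [Finset.sum_range_succ, ih, ← SS_diff]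
    push_cast
    rw [show (1 : ℤ) - M + 1 = 2 - M by ring, show (2 : ℤ) - (M + 1) = 1 - M by ring]; ring

lemma SS_adm (f : ℕ → ℕ → ℕ → ℂ) (N : ℕ) : Adm 0 (fun M : ℕ => SS f N ((M : ℤ) + 2)) := by
  refine (Adm.of_eq (f 0 0 0 / 2) ((2 * (f 0 1 0 - N * f 0 0 0) - 6 * f 0 1 1 + 4 * f 0 1 1) / 4)
    (2 * f 0 1 1 / 4)).congr (fun M => ?_)
  unfold SS
  rw [zpow_add₀ (by norm_num), zpow_add₀ (by norm_num), zpow_natCast, zpow_natCast]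
  push_cast
  norm_num
  ring

/-- splitting of integer sums at `2` -/
lemma split_two {F : ℤ → ℂ} (h : Summable F) :
    Summable (fun n : ℕ => F ((n : ℤ) + 2)) ∧ Summable (fun k : ℕ => F (1 - (k : ℤ))) ∧
    ∑' m : ℤ, F m = (∑' n : ℕ, F ((n : ℤ) + 2)) + ∑' k : ℕ, F (1 - (k : ℤ)) := by
  have i1 : Function.Injective (fun n : ℕ => (n : ℤ) + 2) := fun a b hab => by
    simp only at hab; omega
  have i2 : Function.Injective (fun n : ℕ => 1 - (n : ℤ)) := fun a b hab => by
    simp only at hab; omega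
  have s1 : Summable (fun n : ℕ => F ((n : ℤ) + 2)) := h.comp_injective i1
  have s2 : Summable (fun n : ℕ => F (1 - (n : ℤ))) := h.comp_injective i2
  refine ⟨s1, s2, ?_⟩
  have e0 := (Equiv.addRight (2 : ℤ)).tsum_eq F
  rw [← e0]
  have h1 : HasSum (fun n : ℕ => (fun m : ℤ => F (m + 2)) n) (∑' n : ℕ, F ((n : ℤ) + 2)) := s1.hasSum
  have h2 : HasSum (fun n : ℕ => (fun m : ℤ => F (m + 2)) (-(n + 1))) (∑' k : ℕ, F (1 - (k : ℤ))) := by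
    have := s2.hasSum
    have e2 : (fun n : ℕ => (fun m : ℤ => F (m + 2)) (-(n + 1))) = fun k : ℕ => F (1 - (k : ℤ)) := by
      funext k
      simp only
      congr 1; ring
    rw [e2]; exact this
  have h3 : HasSum (fun m : ℤ => F (m + 2)) _ := HasSum.of_nat_of_neg_add_one h1 h2
  have e3 : (fun c : ℤ => F ((Equiv.addRight (2 : ℤ)) c)) = fun m : ℤ => F (m + 2) := funext (fun m => by
    rw [Equiv.coe_addRight])
  rw [e3]
  exact h3.tsum_eq

/-- abstract combination -/
lemma combine {F G s : ℤ → ℂ} {S : ℤ → ℂ} (hF : Summable F) (hG : Summable G)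
    (hneg : ∀ k : ℕ, F (1 - (k : ℤ)) = -(G (1 - (k : ℤ)) + s (1 - (k : ℤ))))
    (hsum : ∀ M : ℕ, ∑ k ∈ Finset.range M, s (1 - (k : ℤ)) = S 2 - S (2 - (M : ℤ)))
    (ht : Tendsto (fun K : ℕ => S (2 - K)) atTop (𝓝 0)) :
    (∑' n : ℕ, F ((n : ℤ) + 2)) + (∑' n : ℕ, G ((n : ℤ) + 2)) - S 2 = (∑' m : ℤ, F m) + ∑' m : ℤ, G m := by
  obtain ⟨_, f2, f3⟩ := split_two hF
  obtain ⟨_, g2, g3⟩ := split_two hG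
  rw [f3, g3]
  have h1 : HasSum (fun k : ℕ => F (1 - (k : ℤ)) + G (1 - (k : ℤ)))
    ((∑' k : ℕ, F (1 - (k : ℤ))) + ∑' k : ℕ, G (1 - (k : ℤ))) := f2.hasSum.add g2.hasSum
  have h2 : Tendsto (fun M : ℕ => S (2 - (M : ℤ)) - S 2) atTop (𝓝 (0 - S 2)) := ht.sub_const _
  have h3 := tendsto_nhds_unique (h1.tendsto_sum_nat.congr (fun M => ?_)) h2
  · linear_combination -h3
  · rw [← neg_sub, ← hsum M, ← Finset.sum_neg_distrib]
    exact Finset.sum_congr rfl (fun k _ => by rw [hneg]; ring)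


/-! ### Part 17: the main bound -/

lemma term_split {Rt Kt : ℂ × ℂ → ℂ} (f : ℕ → ℕ → ℕ → ℂ) {n1 : ℕ} {ρ : ℕ → ℂ} (J N : ℕ) (hN : 1 ≤ N)
    (hρ : ∀ n : ℕ, n1 ≤ n → ρ n = 3 ^ n * Rt (ppt (n + 2)) *
      Complex.exp (-((N : ℂ) * (1 / 2 : ℂ) ^ (n + 2) * (1 + Kt (ppt (n + 2)))))) (n : ℕ) :
    (if n1 ≤ n then ρ n else 0) = rem Rt Kt f (n1 + 2) (J + 2) N ((n : ℤ) + 2) + AT f (J + 2) N ((n : ℤ) + 2) +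
      ss f N ((n : ℤ) + 2) := by
  rw [add_assoc, ← AA_eq f J N hN, rem, sub_add_cancel]
  by_cases h : n1 ≤ n
  · have h' : ((n1 + 2 : ℕ) : ℤ) ≤ (n : ℤ) + 2 := by push_cast; omega
    rw [if_pos h, if_pos h', hρ n h]
    have e1 : ((n : ℤ) + 2) = ((n + 2 : ℕ) : ℤ) := by push_cast; rfl
    rw [e1, Int.toNat_natCast, TT2, zpow_natCast, zpow_natCast]
    push_cast
    ring
  · have h' : ¬ ((n1 + 2 : ℕ) : ℤ) ≤ (n : ℤ) + 2 := by push_cast; omega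
    rw [if_neg h, if_neg h']

lemma exact_formula {Rt Kt : ℂ × ℂ → ℂ} (f : ℕ → ℕ → ℕ → ℂ) {n1 : ℕ} {ρ : ℕ → ℂ} (J N : ℕ) (hN : 1 ≤ N)
    (hρ : ∀ n : ℕ, n1 ≤ n → ρ n = 3 ^ n * Rt (ppt (n + 2)) *
      Complex.exp (-((N : ℂ) * (1 / 2 : ℂ) ^ (n + 2) * (1 + Kt (ppt (n + 2))))))
    (hs : Summable (fun m : ℤ => rem Rt Kt f (n1 + 2) (J + 2) N m)) {L : ℂ}
    (hL : Tendsto (fun M : ℕ => (Ct (1 / 2) + ∑ n ∈ Finset.range M, pF n (1 / 2)) * (N + 1) -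
      (deriv Ct (1 / 2) + ∑ n ∈ Finset.range M, deriv (pF n) (1 / 2)) / 2 +
      ∑ n ∈ Finset.range M, if n1 ≤ n then ρ n else 0) atTop (𝓝 L)) :
    L - 1 - Xi f (J + 2) N = ∑' m : ℤ, rem Rt Kt f (n1 + 2) (J + 2) N m := by
  have hA := hasSum_AT f (J + 2) N hN
  have hneg : ∀ k : ℕ, rem Rt Kt f (n1 + 2) (J + 2) N (1 - (k : ℤ)) =
      -(AT f (J + 2) N (1 - (k : ℤ)) + ss f N (1 - (k : ℤ))) := by
    intro k
    rw [← AA_eq f J N hN, rem, if_neg (by push_cast; omega)]; ring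
  have hc := combine hs hA.summable hneg (SS_sum_neg f N) (SS_tendsto f N)
  obtain ⟨f1, _, _⟩ := split_two hs
  obtain ⟨g1, _, _⟩ := split_two hA.summable
  have a1 := (const_V.const_mul ((N : ℂ) + 1)).add (const_W.const_mul (-(1 / 2)))
  have a2 := (Adm.of_tendsto f1.hasSum.tendsto_sum_nat).add (Adm.of_tendsto g1.hasSum.tendsto_sum_nat)
  have a3 := (SS_adm f N).add (Adm.of_tendsto (tendsto_const_nhds (x := -SS f N 2)))
  have a4 := ((a1.add a2).add a3).congr (t := (fun M : ℕ => (Ct (1 / 2) + ∑ n ∈ Finset.range M, pF n (1 / 2)) * (N + 1) -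
      (deriv Ct (1 / 2) + ∑ n ∈ Finset.range M, deriv (pF n) (1 / 2)) / 2 +
      ∑ n ∈ Finset.range M, if n1 ≤ n then ρ n else 0)) (fun M => by
    have e1 : ∑ n ∈ Finset.range M, (if n1 ≤ n then ρ n else 0) = ∑ n ∈ Finset.range M,
        (rem Rt Kt f (n1 + 2) (J + 2) N ((n : ℤ) + 2) + AT f (J + 2) N ((n : ℤ) + 2) +
          ss f N ((n : ℤ) + 2)) := Finset.sum_congr rfl (fun n _ => term_split f J N hN hρ n)
    rw [e1, Finset.sum_add_distrib, Finset.sum_add_distrib, SS_sum]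
    ring)
  have h5 := a4.limit hL
  rw [h5, ← hA.tsum_eq]
  linear_combination hc

lemma geom_le_log (θ : ℝ) (h0 : 0 < θ) (h1 : θ < 1) (J : ℕ) : ∃ C : ℝ, 0 < C ∧ ∀ N : ℕ, 2 ≤ N →
    θ ^ N ≤ C * (N : ℝ) ^ (gExp - J) * Real.log N ^ J := by
  have ht := tendsto_pow_const_mul_const_pow_of_lt_one J h0.le h1
  obtain ⟨D, hD⟩ := ht.bddAbove_range
  have hD' : ∀ N : ℕ, (N : ℝ) ^ J * θ ^ N ≤ D := fun N => hD ⟨N, rfl⟩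
  have hL := LR_pos
  refine ⟨(|D| + 1) / LR ^ J, by positivity, fun N hN => ?_⟩
  have hN2 : (2 : ℝ) ≤ N := by exact_mod_cast hN
  have hN0 : (0 : ℝ) < N := by linarith
  have l1 : LR ≤ Real.log N := Real.log_le_log (by norm_num) hN2
  have l2 : LR ^ J ≤ Real.log N ^ J := pow_le_pow_left₀ hL.le l1 J
  have l3 : (1 : ℝ) ≤ (N : ℝ) ^ gExp := Real.one_le_rpow (by linarith) (by linarith [gExp_gt])
  rw [Real.rpow_sub hN0, Real.rpow_natCast]
  have l4 : θ ^ N ≤ (|D| + 1) / (N : ℝ) ^ J := by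
    rw [le_div_iff₀ (by positivity), mul_comm]
    linarith [hD' N, le_abs_self D]
  calc θ ^ N ≤ (|D| + 1) / (N : ℝ) ^ J := l4
    _ = (|D| + 1) / LR ^ J * (1 / (N : ℝ) ^ J) * LR ^ J := by field_simp
    _ ≤ _ := by gcongr

theorem main_bound : ∃ f : ℕ → ℕ → ℕ → ℂ, f 0 0 0 = -PiC ∧ ∀ pa : ℕ → ℂ,
    (∃ r : ℝ, 0 < r ∧ ∀ q : ℂ, ‖q‖ < r → HasSum (fun n => pa n * q ^ n) (PAseries q)) →
    ∀ J : ℕ, ∃ C : ℝ, 0 < C ∧ ∀ N : ℕ, 2 ≤ N →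
      ‖pa N / 2 ^ N - 1 - Xi f (J + 2) N‖ ≤ C * (N : ℝ) ^ (gExp - ((J + 2 : ℕ) : ℝ)) * Real.log N ^ (J + 2) := by
  obtain ⟨Rt, Kt, hR, hK, hK0, hR0, n1, a, r1, r2, r3, r4⟩ := roots
  obtain ⟨f, f0, _, m0, hm0, hE⟩ := E_expand hR hK hK0
  refine ⟨f, f0.trans hR0, fun pa hpa J => ?_⟩
  obtain ⟨C, θ, hC, hθ, hθ1, hex⟩ := extraction (n1 + m0) a (fun n hn => r1 n (by omega))
    (fun n hn => r2 n (by omega)) (fun n hn => r3 n (by omega))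
  obtain ⟨e, he⟩ := hex pa hpa
  obtain ⟨D, hD, hrem⟩ := rem_bound (Rt := Rt) (Kt := Kt) (f := f) (m1 := n1 + m0 + 2) (J := J + 2) (by omega) (by omega) (by
    obtain ⟨C1, hC1, h1⟩ := hE (J + 2)
    exact ⟨C1, hC1, fun m hm T hT => h1 m (by omega) T hT⟩)
  obtain ⟨G, hG, hgeom⟩ := geom_le_log θ hθ hθ1 (J + 2)
  have hL := LR_pos
  refine ⟨C * G + D / LR ^ (J + 2), by positivity, fun N hN => ?_⟩
  obtain ⟨hs, hb⟩ := hrem N hN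
  have hN1 : 1 ≤ N := by omega
  have hx := exact_formula (Rt := Rt) (Kt := Kt) f (n1 := n1 + m0) (ρ := fun n => rhoN a n * (2 * a n)⁻¹ ^ N) J N hN1
    (fun n hn => r4 n (by omega) N) hs.of_norm (he N).2
  have e1 : pa N / 2 ^ N - 1 - Xi f (J + 2) N = e N + ∑' m : ℤ, rem Rt Kt f (n1 + m0 + 2) (J + 2) N m := by
    rw [← hx]; ring
  rw [e1]
  have b1 : ‖∑' m : ℤ, rem Rt Kt f (n1 + m0 + 2) (J + 2) N m‖ ≤
    D * (N : ℝ) ^ (gExp - ((J + 2 : ℕ) : ℝ)) * uN N ^ (J + 2) := (norm_tsum_le_tsum_norm hs).trans hb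
  have b2 : uN N = Real.log N / LR := by rw [← LR_uN]; field_simp
  rw [b2, div_pow] at b1
  have b3 := mul_le_mul_of_nonneg_left (hgeom N hN) hC.le
  refine (norm_add_le _ _).trans ((add_le_add ((he N).1.trans b3) b1).trans (le_of_eq ?_))
  ring


/-! ### Part 18: the constants and the conclusion -/

lemma real_prod (x : ℝ) : ∃ p : ℝ, HasProd (fun j : ℕ => 1 - x * (2 : ℝ) ^ (-(j : ℤ))) p ∧
    (p : ℂ) = qPI x (1 / 2) := by
  have hs : Summable (fun j : ℕ => ‖-(x * (1 / 2 : ℝ) ^ j)‖) :=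
    ((summable_geometric_of_lt_one (by norm_num) (by norm_num : (1 / 2 : ℝ) < 1)).mul_left x).neg.norm
  have hm := (multipliable_one_add_of_summable hs).hasProd
  have e2 : (fun j : ℕ => 1 - x * (2 : ℝ) ^ (-(j : ℤ))) = fun j : ℕ => 1 + -(x * (1 / 2 : ℝ) ^ j) := by
    funext j
    rw [zpow_neg, zpow_natCast, one_div, inv_pow]; ring
  refine ⟨_, by rw [e2]; exact hm, ?_⟩
  have h3 := hm.map Complex.ofRealHom Complex.continuous_ofReal
  have h4 := (qPI_multipliable (x : ℂ) (1 / 2) (by norm_num)).hasProd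
  refine h3.unique ?_
  have e3 : (⇑Complex.ofRealHom ∘ fun j : ℕ => 1 + -(x * (1 / 2 : ℝ) ^ j)) =
      fun i : ℕ => 1 - (x : ℂ) * (1 / 2) ^ i := by
    funext j
    simp [sub_eq_add_neg]
  rw [e3]; exact h4

lemma PiC_eq : ((∏' j : ℕ, ((1 - (1 / 3) * (2 : ℝ) ^ (-(j : ℤ))) * (1 - (3 / 2) * (2 : ℝ) ^ (-(j : ℤ))) /
      (1 - (1 / 2) * (2 : ℝ) ^ (-(j : ℤ))) ^ 2) : ℝ) : ℂ) = PiC := by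
  obtain ⟨p1, h1, e1⟩ := real_prod (1 / 3)
  obtain ⟨p2, h2, e2⟩ := real_prod (3 / 2)
  obtain ⟨p3, h3, e3⟩ := real_prod (1 / 2)
  have hp3 : p3 ≠ 0 := by
    have : (p3 : ℂ) ≠ 0 := by
      rw [e3]
      refine qPI_ne_zero _ _ (by norm_num) (fun i hi => ?_)
      have h5 : ((1 / 2 : ℝ) : ℂ) * (1 / 2) ^ i = 1 := by linear_combination -hi
      have h6 := congrArg norm h5
      rw [norm_mul, norm_pow] at h6
      norm_num at h6
      have h7 : ((1 / 2 : ℝ)) ^ i ≤ 1 := pow_le_one₀ (by norm_num) (by norm_num)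
      linarith
    exact_mod_cast this
  have h4 : HasProd (fun j : ℕ => (1 - (1 / 2) * (2 : ℝ) ^ (-(j : ℤ))) ^ 2) (p3 ^ 2) := by
    simp only [pow_two]; exact h3.mul h3
  have h5 := (h1.mul h2).div₀ h4 (pow_ne_zero 2 hp3)
  rw [h5.tprod_eq, PiC]
  push_cast at e1 e2 e3 ⊢
  rw [e1, e2, e3]

lemma sin_g_ne : Real.sin (Real.pi * gExp) ≠ 0 := by
  have h1 := gExp_gt
  have h2 := gExp_lt
  have hp := Real.pi_pos
  have : 0 < Real.sin (Real.pi * gExp - Real.pi) := Real.sin_pos_of_pos_of_lt_pi (by nlinarith) (by nlinarith)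
  rw [Real.sin_sub_pi] at this
  intro h; rw [h] at this; simp at this

lemma kappaCoef_zero : kappaCoef 0 = (kappa0 : ℂ) := by
  have h1 : (Real.sin (Real.pi * gExp) : ℂ) ≠ 0 := by exact_mod_cast sin_g_ne
  have h2 : Complex.Gamma (1 + (gExp : ℂ)) ≠ 0 := Complex.Gamma_ne_zero_of_re_pos (by
    have := gExp_gt
    simp; linarith)
  unfold kappaCoef
  have e : Complex.sin ((Real.pi : ℂ) * (gExp : ℂ)) = (Real.sin (Real.pi * gExp) : ℂ) := by push_cast; rfl
  simp only [Int.cast_zero, mul_zero, zero_mul, zero_div, add_zero]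
  rw [e, div_self h1, div_self h2]; ring

lemma cc_zero (f : ℕ → ℕ → ℕ → ℂ) (hf : f 0 0 0 = -PiC) (k : ℤ) : cc f 0 0 k = kappaCoef k := by
  have hg := gExp_gt
  have hg2 := gExp_lt
  have hLR := LR_pos
  have eT : Th 0 0 = b2 (0 - gExp) := funext (fun y => by simp [Th, bs])
  have hc : cc f 0 0 k = -PiC / 9 * (Complex.Gamma (((0 - gExp : ℝ) : ℂ) - 2 * Real.pi * I * ((k : ℝ) : ℂ) / LR) / LR) := by
    rw [← FT_b2 (0 - gExp) (by linarith) (by linarith)]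
    simp [cc, hf, eT]
  set s : ℂ := (gExp : ℂ) + 2 * Complex.I * (k : ℂ) * (Real.pi : ℂ) / (LR : ℂ) with hs
  have es : ((0 - gExp : ℝ) : ℂ) - 2 * Real.pi * I * ((k : ℝ) : ℂ) / LR = -s := by
    rw [hs]; push_cast; ring
  rw [es] at hc
  have hre : 0 < (1 + s).re := by
    have : s.re = gExp := by
      rw [hs, show (gExp : ℂ) + 2 * Complex.I * (k : ℂ) * (Real.pi : ℂ) / (LR : ℂ) =
        (gExp : ℂ) + ((2 * k * Real.pi / LR : ℝ) : ℂ) * Complex.I by push_cast; ring]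
      simp
    simp [this]; linarith
  have hG1 : Complex.Gamma (1 + s) ≠ 0 := Complex.Gamma_ne_zero_of_re_pos hre
  have hrefl := Complex.Gamma_mul_Gamma_one_sub (-s)
  rw [sub_neg_eq_add, mul_neg, Complex.sin_neg] at hrefl
  have h1 : (Real.sin (Real.pi * gExp) : ℂ) ≠ 0 := by exact_mod_cast sin_g_ne
  have h2 : Complex.Gamma (1 + (gExp : ℂ)) ≠ 0 := Complex.Gamma_ne_zero_of_re_pos (by
    simp; linarith)
  have e1 : (Real.pi : ℂ) * (gExp : ℂ) + 2 * Complex.I * (k : ℂ) * (Real.pi : ℂ) ^ 2 / (Real.log 2 : ℂ) = Real.pi * s := by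
    rw [hs, LR]; ring
  have e2 : 1 + (gExp : ℂ) + 2 * Complex.I * (k : ℂ) * (Real.pi : ℂ) / (Real.log 2 : ℂ) = 1 + s := by
    rw [hs, LR]; ring
  have e3 : (kappa0 : ℂ) = Real.pi / (9 * LR * (Real.sin (Real.pi * gExp) : ℂ) * Complex.Gamma (1 + (gExp : ℂ))) * PiC := by
    rw [kappa0, Complex.ofReal_mul, PiC_eq, Complex.ofReal_div, Complex.ofReal_mul, Complex.ofReal_mul, Complex.ofReal_mul,
      ← Complex.Gamma_ofReal, LR]
    push_cast
    rw [add_comm (gExp : ℂ) 1]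
  rw [kappaCoef, e1, e2, e3, hc]
  have hL : (LR : ℂ) ≠ 0 := by exact_mod_cast hLR.ne'
  have e4 : Complex.Gamma (-s) = Real.pi / -Complex.sin (Real.pi * s) / Complex.Gamma (1 + s) := by
    rw [← hrefl]; field_simp
  rw [e4]
  generalize (Real.sin (Real.pi * gExp) : ℂ) = a1 at *
  generalize Complex.Gamma (1 + (gExp : ℂ)) = a2 at *
  generalize Complex.Gamma (1 + s) = a3 at *
  generalize Complex.sin (Real.pi * s) = a4 at *
  generalize (LR : ℂ) = a5 at *
  rw [div_neg]
  have h9 : (Real.pi : ℂ) / (9 * a5 * a1 * a2) * PiC * (a1 / a4) * (a2 / a3) =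
    (Real.pi : ℂ) * PiC * (a1 * a1⁻¹) * (a2 * a2⁻¹) / 9 / a5 / a4 / a3 := by
    simp only [div_eq_mul_inv, mul_inv]; ring
  rw [h9, mul_inv_cancel₀ h1, mul_inv_cancel₀ h2]
  simp only [div_eq_mul_inv]; ring

lemma one_bound (f : ℕ → ℕ → ℕ → ℂ) : ∃ C : ℝ, 0 < C ∧ ∀ N : ℕ, 2 ≤ N →
    ‖Xi f 2 N - Xi f 1 N‖ ≤ C * (N : ℝ) ^ (gExp - 1) * Real.log N := by
  have hL := LR_pos
  set A := ∑' k : ℤ, ‖cc f 1 0 k‖ with hA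
  set B := ∑' k : ℤ, ‖cc f 1 1 k‖ with hB
  have hA0 : 0 ≤ A := tsum_nonneg (fun _ => norm_nonneg _)
  have hB0 : 0 ≤ B := tsum_nonneg (fun _ => norm_nonneg _)
  refine ⟨A / LR + B + 1, by positivity, fun N hN => ?_⟩
  have hN2 : (2 : ℝ) ≤ N := by exact_mod_cast hN
  have hN0 : (0 : ℝ) < N := by linarith
  have l1 : LR ≤ Real.log N := Real.log_le_log (by norm_num) hN2
  have l0 : 0 < Real.log N := by linarith
  have e1 : Xi f 2 N - Xi f 1 N = (((N : ℝ) ^ (gExp - 1) : ℝ) : ℂ) *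
      ((∑' k : ℤ, cc f 1 0 k * fe (uN N) k) + ((Real.log N : ℝ) : ℂ) * ∑' k : ℤ, cc f 1 1 k * fe (uN N) k) := by
    rw [Real.rpow_sub_one hN0.ne']
    unfold Xi
    simp only [Finset.sum_range_succ, Finset.sum_range_zero]
    push_cast; ring
  have b1 := norm_tsum_fe (cc_summable f 1 0) (uN N)
  have b2 := norm_tsum_fe (cc_summable f 1 1) (uN N)
  rw [← hA] at b1
  rw [← hB] at b2
  rw [e1, norm_mul, Complex.norm_real, Real.norm_of_nonneg (by positivity)]
  have b3 : ‖(∑' k : ℤ, cc f 1 0 k * fe (uN N) k) + ((Real.log N : ℝ) : ℂ) * ∑' k : ℤ, cc f 1 1 k * fe (uN N) k‖ ≤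
      A + Real.log N * B := by
    refine (norm_add_le _ _).trans (add_le_add b1 ?_)
    rw [norm_mul, Complex.norm_real, Real.norm_of_nonneg l0.le]
    gcongr
  have b4 : A ≤ A / LR * Real.log N := by
    rw [div_mul_eq_mul_div, le_div_iff₀ hL]; gcongr
  have b5 : A + Real.log N * B ≤ (A / LR + B + 1) * Real.log N := by nlinarith
  calc _ ≤ (N : ℝ) ^ (gExp - 1) * ((A / LR + B + 1) * Real.log N) := by
        gcongr
        exact b3.trans b5
    _ = _ := by ring

theorem final_bound : ∃ f : ℕ → ℕ → ℕ → ℂ, f 0 0 0 = -PiC ∧ ∀ pa : ℕ → ℂ,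
    (∃ r : ℝ, 0 < r ∧ ∀ q : ℂ, ‖q‖ < r → HasSum (fun n => pa n * q ^ n) (PAseries q)) →
    ∀ J : ℕ, 1 ≤ J → ∃ C : ℝ, 0 < C ∧ ∀ N : ℕ, 2 ≤ N →
      ‖pa N / 2 ^ N - 1 - Xi f J N‖ ≤ C * (N : ℝ) ^ (gExp - (J : ℝ)) * Real.log N ^ J := by
  obtain ⟨f, hf, hm⟩ := main_bound
  refine ⟨f, hf, fun pa hpa J hJ => ?_⟩
  match J, hJ with
  | J + 2, _ => exact hm pa hpa J
  | 1, _ =>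
    obtain ⟨C, hC, h⟩ := hm pa hpa 0
    obtain ⟨D, hD, h'⟩ := one_bound f
    refine ⟨C + D, by positivity, fun N hN => ?_⟩
    have hN2 : (2 : ℝ) ≤ N := by exact_mod_cast hN
    have hN0 : (0 : ℝ) < N := by linarith
    have l0 : 0 < Real.log N := Real.log_pos (by linarith)
    have l1 : Real.log N ≤ N := (Real.log_le_sub_one_of_pos hN0).trans (by linarith)
    have e1 : pa N / 2 ^ N - 1 - Xi f 1 N = (pa N / 2 ^ N - 1 - Xi f (0 + 2) N) + (Xi f 2 N - Xi f 1 N) := by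
      rw [zero_add]; ring
    rw [e1]
    have h1 := h N hN
    have h2 : (N : ℝ) ^ (gExp - ((0 + 2 : ℕ) : ℝ)) * Real.log N ^ (0 + 2) ≤ (N : ℝ) ^ (gExp - 1) * Real.log N := by
      have : (N : ℝ) ^ (gExp - ((0 + 2 : ℕ) : ℝ)) = (N : ℝ) ^ (gExp - 1) / N := by
        rw [← Real.rpow_sub_one hN0.ne']; congr 1; push_cast; ring
      rw [this, zero_add, pow_two, div_mul_eq_mul_div, div_le_iff₀ hN0]
      have := mul_le_mul_of_nonneg_left l1 (by positivity : 0 ≤ (N : ℝ) ^ (gExp - 1) * Real.log N)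
      linarith
    have h3 := mul_le_mul_of_nonneg_left h2 hC.le
    refine (norm_add_le _ _).trans ((add_le_add h1 (h' N hN)).trans ?_)
    rw [Nat.cast_one, pow_one]
    linarith


/-- The coefficients `PA_n` admit a complete asymptotic expansion
`PA_n ~ 2ⁿ + 2ⁿ n^g ∑_{j≥0} n^{-j} ∑_{0≤ℓ≤j} (log n)^ℓ Ξ_{j,ℓ}(log₂ n)`, each
`Ξ_{j,ℓ}` an absolutely convergent Fourier series of period 1, with
`Ξ_{0,0}(u) = κ₀ + κ(u)`. -/
theorem PA_complete_asymptotic_expansion :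
    ∃ c : ℕ → ℕ → ℤ → ℂ,
      (∀ j ℓ : ℕ, Summable (fun k : ℤ => ‖c j ℓ k‖)) ∧
      c 0 0 0 = (kappa0 : ℂ) ∧
      (∀ k : ℤ, k ≠ 0 → c 0 0 k = kappaCoef k) ∧
      ∀ pa : ℕ → ℂ,
        (∃ r : ℝ, 0 < r ∧
          ∀ q : ℂ, ‖q‖ < r → HasSum (fun n => pa n * q ^ n) (PAseries q)) →
        ∀ J : ℕ, 1 ≤ J →
          ∃ Cb : ℝ, 0 < Cb ∧
            ∀ n : ℕ, 2 ≤ n →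
              ‖pa n - 2 ^ n -
                  (((2 : ℝ) ^ n * (n : ℝ) ^ gExp : ℝ) : ℂ) *
                    ∑ j ∈ Finset.range J, ((n : ℂ)⁻¹) ^ j *
                      ∑ ℓ ∈ Finset.range (j + 1), ((Real.log n : ℝ) : ℂ) ^ ℓ *
                        ∑' k : ℤ, c j ℓ k *
                          Complex.exp (2 * (Real.pi : ℂ) * Complex.I * (k : ℂ) *
                            ((Real.logb 2 n : ℝ) : ℂ))‖ ≤
                Cb * 2 ^ n * (n : ℝ) ^ (gExp - (J : ℝ)) * Real.log n ^ J := by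
  obtain ⟨f, hf, hm⟩ := final_bound
  refine ⟨cc f, cc_summable f, (cc_zero f hf 0).trans kappaCoef_zero, fun k _ => cc_zero f hf k, ?_⟩
  intro pa hpa J hJ
  obtain ⟨C, hC, h⟩ := hm pa hpa J hJ
  refine ⟨C, hC, fun n hn => ?_⟩
  have h1 := mul_le_mul_of_nonneg_left (h n hn) (by positivity : (0 : ℝ) ≤ 2 ^ n)
  have h2 : (2 : ℝ) ^ n * ‖pa n / 2 ^ n - 1 - Xi f J n‖ = ‖(2 : ℂ) ^ n * (pa n / 2 ^ n - 1 - Xi f J n)‖ := by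
    rw [norm_mul, norm_pow, show ‖(2 : ℂ)‖ = 2 by norm_num]
  have h3 : (2 : ℂ) ^ n * (pa n / 2 ^ n - 1 - Xi f J n) = pa n - 2 ^ n -
      (((2 : ℝ) ^ n * (n : ℝ) ^ gExp : ℝ) : ℂ) *
        ∑ j ∈ Finset.range J, ((n : ℂ)⁻¹) ^ j *
          ∑ ℓ ∈ Finset.range (j + 1), ((Real.log n : ℝ) : ℂ) ^ ℓ *
            ∑' k : ℤ, cc f j ℓ k * fe (uN n) k := by
    have h4 : (2 : ℂ) ^ n ≠ 0 := pow_ne_zero n two_ne_zero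
    rw [mul_sub, mul_sub, mul_div_cancel₀ _ h4, mul_one, Xi, ← mul_assoc, Complex.ofReal_mul]
    push_cast
    rfl
  rw [h2, h3] at h1
  refine le_trans (le_of_eq ?_) (h1.trans (le_of_eq (by ring)))
  rfl
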